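/- In the algebra 𝒮 with generators s_ij (1 ≤ i,j ≤ 2n) and s_{ii′}^{−1} (i odd) and defining relations s_ij = 0 for i < j with j ≠ i′; s_{i′i′} s_ii − q² s_{i′i} s_{ii′} = q³ and s_{ii′} s_{ii′}^{−1} = s_{ii′}^{−1} s_{ii′} = 1 for odd i; and R S₁ Rᵗ S₂ = S₂ Rᵗ S₁ R, the ordered monomials ∏_{i=1,3,…,2n−1} s_{i1}^{k_{i1}} s_{i2}^{k_{i2}} ⋯ s_{ii′}^{k_{ii′}} s_{i′i′}^{k_{i′i′}} s_{i′1}^{k_{i′1}} ⋯ s_{i′,i′−2}^{k_{i′,i′−2}}, with k_{ii′} ∈ ℤ arbitrary for odd i and all other exponents nonnegative integers, form a vector space basis of 𝒮. -/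

import Mathlib

noncomputable section

open scoped TensorProduct

abbrev FF : Type := RatFunc ℂ

def qq : FF := RatFunc.X

/-! Constant R-matrices acting in `ℂ^N ⊗ ℂ^N`, written as matrices indexed by pairs. -/

def Rc (F : Type) [Field F] (q : F) (N : ℕ) :
    Matrix (Fin N × Fin N) (Fin N × Fin N) F := Matrix.of fun p r =>
  (if p = r then (if p.1 = p.2 then q else 1) else 0)
  + (if p.1 = r.2 ∧ p.2 = r.1 ∧ p.1 < p.2 then q - q⁻¹ else 0)

/-- `R` transposed in the first tensor factor. -/
def Rct (F : Type) [Field F] (q : F) (N : ℕ) :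
    Matrix (Fin N × Fin N) (Fin N × Fin N) F :=
  Matrix.of fun p r => Rc F q N (r.1, p.2) (p.1, r.2)

def Rtil (F : Type) [Field F] (q : F) (N : ℕ) :
    Matrix (Fin N × Fin N) (Fin N × Fin N) F := Matrix.of fun p r =>
  (if p = r then (if p.1 = p.2 then q⁻¹ else 1) else 0)
  + (if p.1 = r.2 ∧ p.2 = r.1 ∧ p.2 < p.1 then q⁻¹ - q else 0)

def Rtilt (F : Type) [Field F] (q : F) (N : ℕ) :
    Matrix (Fin N × Fin N) (Fin N × Fin N) F :=
  Matrix.of fun p r => Rtil F q N (r.1, p.2) (p.1, r.2)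

/-- `S ↦ S ⊗ 1` (action in the first copy of `End ℂ^N`). -/
def amp1 {A : Type} [Ring A] {N : ℕ} (M : Matrix (Fin N) (Fin N) A) :
    Matrix (Fin N × Fin N) (Fin N × Fin N) A :=
  Matrix.of fun p r => if p.2 = r.2 then M p.1 r.1 else 0

/-- `S ↦ 1 ⊗ S` (action in the second copy of `End ℂ^N`). -/
def amp2 {A : Type} [Ring A] {N : ℕ} (M : Matrix (Fin N) (Fin N) A) :
    Matrix (Fin N × Fin N) (Fin N × Fin N) A :=
  Matrix.of fun p r => if p.1 = r.1 then M p.2 r.2 else 0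

/-- A scalar matrix viewed as a matrix over an `F`-algebra `A`. -/
def liftF (F : Type) [Field F] {A : Type} [Ring A] [Algebra F A] {m : Type}
    (M : Matrix m m F) : Matrix m m A := M.map (algebraMap F A)

/-- Left hand side `R S₁ Rᵗ S₂` of the reflection equation. -/
def reflLHS (F : Type) [Field F] (q : F) {N : ℕ} {A : Type} [Ring A] [Algebra F A]
    (S : Matrix (Fin N) (Fin N) A) : Matrix (Fin N × Fin N) (Fin N × Fin N) A :=
  liftF F (Rc F q N) * amp1 S * liftF F (Rct F q N) * amp2 S

/-- Right hand side `S₂ Rᵗ S₁ R` of the reflection equation. -/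
def reflRHS (F : Type) [Field F] (q : F) {N : ℕ} {A : Type} [Ring A] [Algebra F A]
    (S : Matrix (Fin N) (Fin N) A) : Matrix (Fin N × Fin N) (Fin N × Fin N) A :=
  amp2 S * liftF F (Rct F q N) * amp1 S * liftF F (Rc F q N)

/-- The list of index pairs `(i,j)` in lexicographic order. -/
def lexPairs (N : ℕ) : List (Fin N × Fin N) :=
  (List.finRange N).flatMap fun i => (List.finRange N).map fun j => (i, j)

/-! The generic matrix of generators. -/

def Sfree (F : Type) [Field F] (N : ℕ) :
    Matrix (Fin N) (Fin N) (FreeAlgebra F (Fin N × Fin N)) :=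
  Matrix.of fun i j => FreeAlgebra.ι F (i, j)

/-- Defining relations: only the reflection equation. -/
inductive Rel0 (F : Type) [Field F] (q : F) (N : ℕ) :
    FreeAlgebra F (Fin N × Fin N) → FreeAlgebra F (Fin N × Fin N) → Prop
  | refl (p r : Fin N × Fin N) :
      Rel0 F q N (reflLHS F q (Sfree F N) p r) (reflRHS F q (Sfree F N) p r)

/-- The algebra with generators `s_ij` and the reflection equation as defining relations. -/
abbrev Alg0 (F : Type) [Field F] (q : F) (N : ℕ) := RingQuot (Rel0 F q N)

def s0 (F : Type) [Field F] (q : F) (N : ℕ) (i j : Fin N) : Alg0 F q N :=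
  RingQuot.mkAlgHom F (Rel0 F q N) (FreeAlgebra.ι F (i, j))

/-- Defining relations of the presented algebra `𝒮` of the orthogonal case. -/
inductive OSRel (F : Type) [Field F] (q : F) (N : ℕ) :
    FreeAlgebra F (Fin N × Fin N) → FreeAlgebra F (Fin N × Fin N) → Prop
  | tri (i j : Fin N) (h : i < j) : OSRel F q N (FreeAlgebra.ι F (i, j)) 0
  | diag (i : Fin N) : OSRel F q N (FreeAlgebra.ι F (i, i)) 1
  | refl (p r : Fin N × Fin N) :
      OSRel F q N (reflLHS F q (Sfree F N) p r) (reflRHS F q (Sfree F N) p r)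

abbrev AlgOS (F : Type) [Field F] (q : F) (N : ℕ) := RingQuot (OSRel F q N)

def sOS (F : Type) [Field F] (q : F) (N : ℕ) (i j : Fin N) : AlgOS F q N :=
  RingQuot.mkAlgHom F (OSRel F q N) (FreeAlgebra.ι F (i, j))

/-! The quantized enveloping algebra `U_q(gl_N)` by its RTT presentation. -/

abbrev GlGen (N : ℕ) := (Fin N × Fin N) ⊕ (Fin N × Fin N)

def Tfree (F : Type) [Field F] (N : ℕ) :
    Matrix (Fin N) (Fin N) (FreeAlgebra F (GlGen N)) :=
  Matrix.of fun i j => FreeAlgebra.ι F (Sum.inl (i, j))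

def Tbfree (F : Type) [Field F] (N : ℕ) :
    Matrix (Fin N) (Fin N) (FreeAlgebra F (GlGen N)) :=
  Matrix.of fun i j => FreeAlgebra.ι F (Sum.inr (i, j))

/-- `R X₁ Y₂` -/
def rttLHS (F : Type) [Field F] (q : F) {N : ℕ} {A : Type} [Ring A] [Algebra F A]
    (X Y : Matrix (Fin N) (Fin N) A) : Matrix (Fin N × Fin N) (Fin N × Fin N) A :=
  liftF F (Rc F q N) * amp1 X * amp2 Y

/-- `Y₂ X₁ R` -/
def rttRHS (F : Type) [Field F] (q : F) {N : ℕ} {A : Type} [Ring A] [Algebra F A]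
    (X Y : Matrix (Fin N) (Fin N) A) : Matrix (Fin N × Fin N) (Fin N × Fin N) A :=
  amp2 Y * amp1 X * liftF F (Rc F q N)

inductive GlRel (F : Type) [Field F] (q : F) (N : ℕ) :
    FreeAlgebra F (GlGen N) → FreeAlgebra F (GlGen N) → Prop
  | t_zero (i j : Fin N) (h : i < j) : GlRel F q N (Tfree F N i j) 0
  | tb_zero (i j : Fin N) (h : j < i) : GlRel F q N (Tbfree F N i j) 0
  | t_tb (i : Fin N) : GlRel F q N (Tfree F N i i * Tbfree F N i i) 1
  | tb_t (i : Fin N) : GlRel F q N (Tbfree F N i i * Tfree F N i i) 1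
  | rtt (p r : Fin N × Fin N) :
      GlRel F q N (rttLHS F q (Tfree F N) (Tfree F N) p r)
        (rttRHS F q (Tfree F N) (Tfree F N) p r)
  | rtbtb (p r : Fin N × Fin N) :
      GlRel F q N (rttLHS F q (Tbfree F N) (Tbfree F N) p r)
        (rttRHS F q (Tbfree F N) (Tbfree F N) p r)
  | rtbt (p r : Fin N × Fin N) :
      GlRel F q N (rttLHS F q (Tbfree F N) (Tfree F N) p r)
        (rttRHS F q (Tbfree F N) (Tfree F N) p r)

/-- The quantized enveloping algebra `U_q(gl_N)`. -/
abbrev UqGl (F : Type) [Field F] (q : F) (N : ℕ) := RingQuot (GlRel F q N)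

def tE (F : Type) [Field F] (q : F) (N : ℕ) (i j : Fin N) : UqGl F q N :=
  RingQuot.mkAlgHom F (GlRel F q N) (FreeAlgebra.ι F (Sum.inl (i, j)))

def tbE (F : Type) [Field F] (q : F) (N : ℕ) (i j : Fin N) : UqGl F q N :=
  RingQuot.mkAlgHom F (GlRel F q N) (FreeAlgebra.ι F (Sum.inr (i, j)))

/-- The entries `s_ij = Σ_a t_ia t̄_ja` of `S = T T̄ᵗ`. -/
def sE (F : Type) [Field F] (q : F) (N : ℕ) (i j : Fin N) : UqGl F q N :=
  ∑ a : Fin N, tE F q N i a * tbE F q N j a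

/-- The twisted quantized enveloping algebra `U^tw_q(o_N)` as a subalgebra of `U_q(gl_N)`. -/
def UtwO (F : Type) [Field F] (q : F) (N : ℕ) : Subalgebra F (UqGl F q N) :=
  Algebra.adjoin F {x | ∃ i j, x = sE F q N i j}

/-! Symplectic (finite) case. -/

/-- `2k` as an element of `Fin (2n)` (the 0-based version of the odd index `2k-1`). -/
def fe (n : ℕ) (k : Fin n) : Fin (2 * n) := ⟨2 * k.val, by have := k.isLt; omega⟩

/-- `2k+1` as an element of `Fin (2n)` (the 0-based version of the even index `2k`). -/
def fo (n : ℕ) (k : Fin n) : Fin (2 * n) := ⟨2 * k.val + 1, by have := k.isLt; omega⟩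

/-- The entries `s_ij` of `S = T G T̄ᵗ` in `U_q(gl_2n)`. -/
def sSp (F : Type) [Field F] (q : F) (n : ℕ) (i j : Fin (2 * n)) : UqGl F q (2 * n) :=
  algebraMap F _ q * ∑ a : Fin n, tE F q (2 * n) i (fe n a) * tbE F q (2 * n) j (fo n a)
    - ∑ a : Fin n, tE F q (2 * n) i (fo n a) * tbE F q (2 * n) j (fe n a)

abbrev SpGen (n : ℕ) := (Fin (2 * n) × Fin (2 * n)) ⊕ Fin n

def SpFreeS (F : Type) [Field F] (n : ℕ) :
    Matrix (Fin (2 * n)) (Fin (2 * n)) (FreeAlgebra F (SpGen n)) :=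
  Matrix.of fun i j => FreeAlgebra.ι F (Sum.inl (i, j))

/-- Defining relations of the presented algebra `𝒮` of the symplectic case. -/
inductive SpRel (F : Type) [Field F] (q : F) (n : ℕ) :
    FreeAlgebra F (SpGen n) → FreeAlgebra F (SpGen n) → Prop
  | tri (i j : Fin (2 * n)) (h : i < j) (h' : ¬(i.val % 2 = 0 ∧ j.val = i.val + 1)) :
      SpRel F q n (FreeAlgebra.ι F (Sum.inl (i, j))) 0
  | quad (k : Fin n) :
      SpRel F q n
        (FreeAlgebra.ι F (Sum.inl (fo n k, fo n k)) * FreeAlgebra.ι F (Sum.inl (fe n k, fe n k)))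
        (algebraMap F _ (q ^ 2) *
            (FreeAlgebra.ι F (Sum.inl (fo n k, fe n k)) *
              FreeAlgebra.ι F (Sum.inl (fe n k, fo n k)))
          + algebraMap F _ (q ^ 3))
  | invR (k : Fin n) :
      SpRel F q n
        (FreeAlgebra.ι F (Sum.inl (fe n k, fo n k)) * FreeAlgebra.ι F (Sum.inr k)) 1
  | invL (k : Fin n) :
      SpRel F q n
        (FreeAlgebra.ι F (Sum.inr k) * FreeAlgebra.ι F (Sum.inl (fe n k, fo n k))) 1
  | refl (p r : Fin (2 * n) × Fin (2 * n)) :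
      SpRel F q n (reflLHS F q (SpFreeS F n) p r) (reflRHS F q (SpFreeS F n) p r)

abbrev AlgSp (F : Type) [Field F] (q : F) (n : ℕ) := RingQuot (SpRel F q n)

def sSpP (F : Type) [Field F] (q : F) (n : ℕ) (i j : Fin (2 * n)) : AlgSp F q n :=
  RingQuot.mkAlgHom F (SpRel F q n) (FreeAlgebra.ι F (Sum.inl (i, j)))

def sInvP (F : Type) [Field F] (q : F) (n : ℕ) (k : Fin n) : AlgSp F q n :=
  RingQuot.mkAlgHom F (SpRel F q n) (FreeAlgebra.ι F (Sum.inr k))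

/-- row `i = 2k` of the symplectic ordered monomial: positions `(i,0),…,(i,2k)`. -/
def rowA (n : ℕ) (k : Fin n) : List (Fin (2 * n) × Fin (2 * n)) :=
  ((List.finRange (2 * n)).filter fun j => j.val ≤ 2 * k.val).map fun j => (fe n k, j)

/-- row `i' = 2k+1` of the symplectic ordered monomial: positions `(i',0),…,(i',2k-1)`. -/
def rowB (n : ℕ) (k : Fin n) : List (Fin (2 * n) × Fin (2 * n)) :=
  ((List.finRange (2 * n)).filter fun j => j.val + 2 ≤ 2 * k.val + 1).map fun j => (fo n k, j)

/-- The ordered monomials of the symplectic case, with an arbitrary integer exponent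
on each `s_{i i'}` and nonnegative exponents elsewhere. -/
def monomSp {A : Type} [Ring A] (n : ℕ) (s : Fin (2 * n) × Fin (2 * n) → A) (sI : Fin n → A)
    (kN : Fin (2 * n) × Fin (2 * n) → ℕ) (kZ : Fin n → ℤ) : A :=
  ((List.finRange n).map fun k =>
    ((rowA n k).map fun p => s p ^ kN p).prod *
      (if 0 ≤ kZ k then s (fe n k, fo n k) ^ (kZ k).toNat else sI k ^ (-(kZ k)).toNat) *
      s (fo n k, fo n k) ^ kN (fo n k, fo n k) *
      ((rowB n k).map fun p => s p ^ kN p).prod).prod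

/-! Affine (twisted q-Yangian) machinery.  Series are treated coefficientwise. -/

/-- `z1 S r` is the coefficient matrix (in the first copy) of a series indexed by
nonnegative integers, extended by zero to `ℤ`. -/
def z1 {A : Type} [Ring A] {N : ℕ} (S : ℕ → Matrix (Fin N) (Fin N) A) (r : ℤ) :
    Matrix (Fin N × Fin N) (Fin N × Fin N) A :=
  if 0 ≤ r then amp1 (S r.toNat) else 0

def z2 {A : Type} [Ring A] {N : ℕ} (S : ℕ → Matrix (Fin N) (Fin N) A) (r : ℤ) :
    Matrix (Fin N × Fin N) (Fin N × Fin N) A :=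
  if 0 ≤ r then amp2 (S r.toNat) else 0

/-- Coefficient of `u^a v^b` in `R(u,v) S₁(u) Rᵗ(u⁻¹,v) S₂(v)`,
using `R(u,v) = u R̃ - v R` and `Rᵗ(u⁻¹,v) = u⁻¹ R̃ᵗ - v Rᵗ`. -/
def affLHS (F : Type) [Field F] (q : F) {N : ℕ} {A : Type} [Ring A] [Algebra F A]
    (S : ℕ → Matrix (Fin N) (Fin N) A) (a b : ℤ) :
    Matrix (Fin N × Fin N) (Fin N × Fin N) A :=
  liftF F (Rtil F q N) * z1 S (-a) * liftF F (Rtilt F q N) * z2 S (-b)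
    - liftF F (Rtil F q N) * z1 S (1 - a) * liftF F (Rct F q N) * z2 S (1 - b)
    - liftF F (Rc F q N) * z1 S (-1 - a) * liftF F (Rtilt F q N) * z2 S (1 - b)
    + liftF F (Rc F q N) * z1 S (-a) * liftF F (Rct F q N) * z2 S (2 - b)

/-- Coefficient of `u^a v^b` in `S₂(v) Rᵗ(u⁻¹,v) S₁(u) R(u,v)`. -/
def affRHS (F : Type) [Field F] (q : F) {N : ℕ} {A : Type} [Ring A] [Algebra F A]
    (S : ℕ → Matrix (Fin N) (Fin N) A) (a b : ℤ) :
    Matrix (Fin N × Fin N) (Fin N × Fin N) A :=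
  z2 S (-b) * liftF F (Rtilt F q N) * z1 S (-a) * liftF F (Rtil F q N)
    - z2 S (1 - b) * liftF F (Rtilt F q N) * z1 S (-1 - a) * liftF F (Rc F q N)
    - z2 S (1 - b) * liftF F (Rct F q N) * z1 S (1 - a) * liftF F (Rtil F q N)
    + z2 S (2 - b) * liftF F (Rct F q N) * z1 S (-a) * liftF F (Rc F q N)

def SfreeA (F : Type) [Field F] (N : ℕ) (r : ℕ) :
    Matrix (Fin N) (Fin N) (FreeAlgebra F (ℕ × Fin N × Fin N)) :=
  Matrix.of fun i j => FreeAlgebra.ι F (r, i, j)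

/-- Defining relations: only the affine reflection equation (coefficientwise). -/
inductive Rel9 (F : Type) [Field F] (q : F) (N : ℕ) :
    FreeAlgebra F (ℕ × Fin N × Fin N) → FreeAlgebra F (ℕ × Fin N × Fin N) → Prop
  | refl (a b : ℤ) (p r : Fin N × Fin N) :
      Rel9 F q N (affLHS F q (SfreeA F N) a b p r) (affRHS F q (SfreeA F N) a b p r)

abbrev Alg9 (F : Type) [Field F] (q : F) (N : ℕ) := RingQuot (Rel9 F q N)

def s9 (F : Type) [Field F] (q : F) (N : ℕ) (r : ℕ) (i j : Fin N) : Alg9 F q N :=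
  RingQuot.mkAlgHom F (Rel9 F q N) (FreeAlgebra.ι F (r, i, j))

/-- Defining relations of the presented twisted q-Yangian (orthogonal case). -/
inductive AORel (F : Type) [Field F] (q : F) (N : ℕ) :
    FreeAlgebra F (ℕ × Fin N × Fin N) → FreeAlgebra F (ℕ × Fin N × Fin N) → Prop
  | tri (i j : Fin N) (h : i < j) : AORel F q N (FreeAlgebra.ι F (0, i, j)) 0
  | diag (i : Fin N) : AORel F q N (FreeAlgebra.ι F (0, i, i)) 1
  | refl (a b : ℤ) (p r : Fin N × Fin N) :
      AORel F q N (affLHS F q (SfreeA F N) a b p r) (affRHS F q (SfreeA F N) a b p r)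

abbrev AlgAO (F : Type) [Field F] (q : F) (N : ℕ) := RingQuot (AORel F q N)

def sAO (F : Type) [Field F] (q : F) (N : ℕ) (r : ℕ) (i j : Fin N) : AlgAO F q N :=
  RingQuot.mkAlgHom F (AORel F q N) (FreeAlgebra.ι F (r, i, j))

/-- Lexicographic (non-strict) comparison of triples. -/
def tripLe (x y : ℕ × ℕ × ℕ) : Prop :=
  x.1 < y.1 ∨ (x.1 = y.1 ∧ (x.2.1 < y.2.1 ∨ (x.2.1 = y.2.1 ∧ x.2.2 ≤ y.2.2)))

/-- A list of generator indices `(r,i,j)` is ordered if it is weakly increasing with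
respect to the lexicographic order on `(r,i,j)`. -/
def sortedGens {N : ℕ} (l : List (ℕ × Fin N × Fin N)) : Prop :=
  l.Chain' fun x y => tripLe (x.1, x.2.1.val, x.2.2.val) (y.1, y.2.1.val, y.2.2.val)

/-! The quantum affine algebra `U_q(ĝl_N)` by its RTT presentation, coefficientwise. -/

abbrev AffGen (N : ℕ) := (ℕ × Fin N × Fin N) ⊕ (ℕ × Fin N × Fin N)

def TfA (F : Type) [Field F] (N : ℕ) (r : ℕ) :
    Matrix (Fin N) (Fin N) (FreeAlgebra F (AffGen N)) :=
  Matrix.of fun i j => FreeAlgebra.ι F (Sum.inl (r, i, j))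

def TbfA (F : Type) [Field F] (N : ℕ) (r : ℕ) :
    Matrix (Fin N) (Fin N) (FreeAlgebra F (AffGen N)) :=
  Matrix.of fun i j => FreeAlgebra.ι F (Sum.inr (r, i, j))

/-- Coefficient of `u^a v^b` in `R(u,v) X₁ Y₂` with prescribed coefficient extractions. -/
def affRttL (F : Type) [Field F] (q : F) {N : ℕ} {A : Type} [Ring A] [Algebra F A]
    (X Y : ℕ → Matrix (Fin N) (Fin N) A) (a b a' b' : ℤ) :
    Matrix (Fin N × Fin N) (Fin N × Fin N) A :=
  liftF F (Rtil F q N) * z1 X a * z2 Y b - liftF F (Rc F q N) * z1 X a' * z2 Y b'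

def affRttR (F : Type) [Field F] (q : F) {N : ℕ} {A : Type} [Ring A] [Algebra F A]
    (X Y : ℕ → Matrix (Fin N) (Fin N) A) (a b a' b' : ℤ) :
    Matrix (Fin N × Fin N) (Fin N × Fin N) A :=
  z2 Y b * z1 X a * liftF F (Rtil F q N) - z2 Y b' * z1 X a' * liftF F (Rc F q N)

inductive AffGlRel (F : Type) [Field F] (q : F) (N : ℕ) :
    FreeAlgebra F (AffGen N) → FreeAlgebra F (AffGen N) → Prop
  | t0_tri (i j : Fin N) (h : i < j) : AffGlRel F q N (TfA F N 0 i j) 0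
  | tb0_tri (i j : Fin N) (h : j < i) : AffGlRel F q N (TbfA F N 0 i j) 0
  | t_tb (i : Fin N) : AffGlRel F q N (TfA F N 0 i i * TbfA F N 0 i i) 1
  | tb_t (i : Fin N) : AffGlRel F q N (TbfA F N 0 i i * TfA F N 0 i i) 1
  | rtt (a b : ℤ) (p r : Fin N × Fin N) :
      AffGlRel F q N
        (affRttL F q (TfA F N) (TfA F N) (1 - a) (-b) (-a) (1 - b) p r)
        (affRttR F q (TfA F N) (TfA F N) (1 - a) (-b) (-a) (1 - b) p r)
  | rtbtb (a b : ℤ) (p r : Fin N × Fin N) :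
      AffGlRel F q N
        (affRttL F q (TbfA F N) (TbfA F N) (a - 1) b a (b - 1) p r)
        (affRttR F q (TbfA F N) (TbfA F N) (a - 1) b a (b - 1) p r)
  | rtbt (a b : ℤ) (p r : Fin N × Fin N) :
      AffGlRel F q N
        (affRttL F q (TbfA F N) (TfA F N) (a - 1) (-b) a (1 - b) p r)
        (affRttR F q (TbfA F N) (TfA F N) (a - 1) (-b) a (1 - b) p r)

/-- The quantum affine algebra `U_q(ĝl_N)`. -/
abbrev UqAff (F : Type) [Field F] (q : F) (N : ℕ) := RingQuot (AffGlRel F q N)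

def tA (F : Type) [Field F] (q : F) (N : ℕ) (r : ℕ) (i j : Fin N) : UqAff F q N :=
  RingQuot.mkAlgHom F (AffGlRel F q N) (FreeAlgebra.ι F (Sum.inl (r, i, j)))

def tbA (F : Type) [Field F] (q : F) (N : ℕ) (r : ℕ) (i j : Fin N) : UqAff F q N :=
  RingQuot.mkAlgHom F (AffGlRel F q N) (FreeAlgebra.ι F (Sum.inr (r, i, j)))

/-- Coefficient of `u^{-r}` in `s_ij(u) = Σ_a t_ia(u) t̄_ja(u⁻¹)`. -/
def Scoef (F : Type) [Field F] (q : F) (N : ℕ) (r : ℕ) (i j : Fin N) : UqAff F q N :=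
  ∑ a : Fin N, ∑ p ∈ Finset.range (r + 1), tA F q N p i a * tbA F q N (r - p) j a

/-- The twisted q-Yangian `Y^tw_q(o_N)` as a subalgebra of `U_q(ĝl_N)`. -/
def YtwO (F : Type) [Field F] (q : F) (N : ℕ) : Subalgebra F (UqAff F q N) :=
  Algebra.adjoin F {x | ∃ r i j, x = Scoef F q N r i j}

/-- Coefficient of `u^{-r}` in `s_ij(u)`, the `(i,j)` entry of `S(u) = T(u) G T̄(u⁻¹)ᵗ`
in the symplectic case. -/
def ScoefSp (F : Type) [Field F] (q : F) (n : ℕ) (r : ℕ) (i j : Fin (2 * n)) :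
    UqAff F q (2 * n) :=
  ∑ a : Fin n, ∑ p ∈ Finset.range (r + 1),
    (algebraMap F _ q * (tA F q (2 * n) p i (fe n a) * tbA F q (2 * n) (r - p) j (fo n a))
      - tA F q (2 * n) p i (fo n a) * tbA F q (2 * n) (r - p) j (fe n a))

/-- The twisted q-Yangian `Y^tw_q(sp_2n)` as a subalgebra of `U_q(ĝl_2n)`,
with a prescribed family of inverses of `s^{(0)}_{ii'}`. -/
def YtwSp (F : Type) [Field F] (q : F) (n : ℕ) (inv : Fin n → UqAff F q (2 * n)) :
    Subalgebra F (UqAff F q (2 * n)) :=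
  Algebra.adjoin F ({x | ∃ r i j, x = ScoefSp F q n r i j} ∪ Set.range inv)

abbrev ASpGen (n : ℕ) := (ℕ × Fin (2 * n) × Fin (2 * n)) ⊕ Fin n

def SfreeASp (F : Type) [Field F] (n : ℕ) (r : ℕ) :
    Matrix (Fin (2 * n)) (Fin (2 * n)) (FreeAlgebra F (ASpGen n)) :=
  Matrix.of fun i j => FreeAlgebra.ι F (Sum.inl (r, i, j))

/-- Defining relations of the presented twisted q-Yangian (symplectic case). -/
inductive ASpRel (F : Type) [Field F] (q : F) (n : ℕ) :
    FreeAlgebra F (ASpGen n) → FreeAlgebra F (ASpGen n) → Prop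
  | tri (i j : Fin (2 * n)) (h : i < j) (h' : ¬(i.val % 2 = 0 ∧ j.val = i.val + 1)) :
      ASpRel F q n (FreeAlgebra.ι F (Sum.inl (0, i, j))) 0
  | quad (k : Fin n) :
      ASpRel F q n
        (FreeAlgebra.ι F (Sum.inl (0, fo n k, fo n k)) *
          FreeAlgebra.ι F (Sum.inl (0, fe n k, fe n k)))
        (algebraMap F _ (q ^ 2) *
            (FreeAlgebra.ι F (Sum.inl (0, fo n k, fe n k)) *
              FreeAlgebra.ι F (Sum.inl (0, fe n k, fo n k)))
          + algebraMap F _ (q ^ 3))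
  | invR (k : Fin n) :
      ASpRel F q n
        (FreeAlgebra.ι F (Sum.inl (0, fe n k, fo n k)) * FreeAlgebra.ι F (Sum.inr k)) 1
  | invL (k : Fin n) :
      ASpRel F q n
        (FreeAlgebra.ι F (Sum.inr k) * FreeAlgebra.ι F (Sum.inl (0, fe n k, fo n k))) 1
  | refl (a b : ℤ) (p r : Fin (2 * n) × Fin (2 * n)) :
      ASpRel F q n (affLHS F q (SfreeASp F n) a b p r) (affRHS F q (SfreeASp F n) a b p r)

abbrev AlgASp (F : Type) [Field F] (q : F) (n : ℕ) := RingQuot (ASpRel F q n)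

def sASp (F : Type) [Field F] (q : F) (n : ℕ) (r : ℕ) (i j : Fin (2 * n)) : AlgASp F q n :=
  RingQuot.mkAlgHom F (ASpRel F q n) (FreeAlgebra.ι F (Sum.inl (r, i, j)))

def sInvASp (F : Type) [Field F] (q : F) (n : ℕ) (k : Fin n) : AlgASp F q n :=
  RingQuot.mkAlgHom F (ASpRel F q n) (FreeAlgebra.ι F (Sum.inr k))

/-! q-antisymmetrizer and Sklyanin/quantum determinant machinery. -/

/-- The trigonometric R-matrix `R(u,v)`. -/
def Rtrig (F : Type) [Field F] (q : F) (N : ℕ) (u v : F) :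
    Matrix (Fin N × Fin N) (Fin N × Fin N) F := Matrix.of fun p r =>
  (if p = r then (if p.1 = p.2 then q⁻¹ * u - q * v else u - v) else 0)
  + (if p.1 = r.2 ∧ p.2 = r.1 ∧ p.1 ≠ p.2 then
      (q⁻¹ - q) * (if p.2 < p.1 then u else v) else 0)

/-- An operator on `ℂ^N ⊗ ℂ^N` acting in the `i`-th and `j`-th factors of `(ℂ^N)^{⊗ r}`. -/
def big2 (F : Type) [Field F] {N r : ℕ} (i j : Fin r)
    (M : Matrix (Fin N × Fin N) (Fin N × Fin N) F) :
    Matrix (Fin r → Fin N) (Fin r → Fin N) F :=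
  Matrix.of fun f g =>
    if ∀ k, k ≠ i → k ≠ j → f k = g k then M (f i, f j) (g i, g j) else 0

/-- The list of the pairs `(i,j)`, `i < j`, in lexicographic order. -/
def pairsLex (r : ℕ) : List (Fin r × Fin r) :=
  (List.finRange r).flatMap fun i =>
    ((List.finRange r).filter fun j => i < j).map fun j => (i, j)

/-- The number of inversions (the Coxeter length) of a permutation. -/
def invCount {r : ℕ} (σ : Equiv.Perm (Fin r)) : ℕ :=
  (Finset.univ.filter fun p : Fin r × Fin r => p.1 < p.2 ∧ σ p.2 < σ p.1).card

/-- The q-permutation operator `P^q` on `ℂ^N ⊗ ℂ^N`. -/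
def PqSmall (F : Type) [Field F] (q : F) (N : ℕ) :
    Matrix (Fin N × Fin N) (Fin N × Fin N) F := Matrix.of fun p r =>
  if r.1 = p.2 ∧ r.2 = p.1 then (if p.1 = p.2 then 1 else if p.2 < p.1 then q else q⁻¹)
  else 0

/-- The hypothesis that `Pq` is the extension of the q-permutation operators along
reduced decompositions: `P^q_{σ s_i} = P^q_σ P^q_{s_i}` whenever the length grows. -/
def PqExt (F : Type) [Field F] (q : F) (N r : ℕ)
    (Pq : Equiv.Perm (Fin r) → Matrix (Fin r → Fin N) (Fin r → Fin N) F) : Prop :=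
  Pq 1 = 1 ∧
    ∀ (σ : Equiv.Perm (Fin r)) (i : ℕ) (h : i + 1 < r),
      invCount (σ * Equiv.swap ⟨i, Nat.lt_of_succ_lt h⟩ ⟨i + 1, h⟩) = invCount σ + 1 →
        Pq (σ * Equiv.swap ⟨i, Nat.lt_of_succ_lt h⟩ ⟨i + 1, h⟩) =
          Pq σ * big2 F ⟨i, Nat.lt_of_succ_lt h⟩ ⟨i + 1, h⟩ (PqSmall F q N)

/-- The q-antisymmetrizer `A^q_r = Σ_σ sgn(σ) P^q_σ`. -/
def AqM (F : Type) [Field F] {N r : ℕ}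
    (Pq : Equiv.Perm (Fin r) → Matrix (Fin r → Fin N) (Fin r → Fin N) F) :
    Matrix (Fin r → Fin N) (Fin r → Fin N) F :=
  ∑ σ : Equiv.Perm (Fin r), ((Equiv.Perm.sign σ : ℤ) : F) • Pq σ

/-- A matrix acting in the `k`-th factor of `(ℂ^N)^{⊗ N}`, with entries in `A`. -/
def ampAt {A : Type} [Ring A] {N : ℕ} (k : Fin N) (M : Matrix (Fin N) (Fin N) A) :
    Matrix (Fin N → Fin N) (Fin N → Fin N) A :=
  Matrix.of fun f g => if ∀ l, l ≠ k → f l = g l then M (f k) (g k) else 0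

/-- A scalar two-site operator viewed over `A`, acting at sites `i`, `j`. -/
def big2A (F : Type) [Field F] {A : Type} [Ring A] [Algebra F A] {N : ℕ} (i j : Fin N)
    (M : Matrix (Fin N × Fin N) (Fin N × Fin N) F) :
    Matrix (Fin N → Fin N) (Fin N → Fin N) A :=
  (big2 F i j M).map (algebraMap F A)

/-- Coefficient of `u^m` in a product of formal series, each of which is supported in
degrees `≤ 1`; the series are given by their coefficient functions `ℤ → M`. -/
def seriesProdCoeff {M : Type} [Ring M] : List (ℤ → M) → ℤ → M
  | [], m => if m = 0 then 1 else 0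
  | c :: t, m => ∑ k ∈ Finset.Icc (m - t.length) 1, c k * seriesProdCoeff t (m - k)

/-! Series factors entering the Sklyanin determinant. -/

/-- The matrix `S^{(r)}` of the coefficients of `S(u)` (orthogonal case). -/
def SmatA (F : Type) [Field F] (q : F) (N : ℕ) (r : ℕ) :
    Matrix (Fin N) (Fin N) (UqAff F q N) :=
  Matrix.of fun i j => Scoef F q N r i j

/-- The series `S_k(q^{-2k+2} u)` acting at site `k` (0-based `k`), coefficientwise. -/
def SfacO (F : Type) [Field F] (q : F) (N : ℕ) (k : Fin N) (m : ℤ) :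
    Matrix (Fin N → Fin N) (Fin N → Fin N) (UqAff F q N) :=
  if m ≤ 0 then q ^ (2 * (k.val : ℤ) * (-m)) • ampAt k (SmatA F q N (-m).toNat) else 0

/-- The series `R_{ij}ᵗ((q^{-2i+2}u)⁻¹, q^{-2j+2}u)` (0-based `i`, `j`), coefficientwise. -/
def RtfacO (F : Type) [Field F] (q : F) (N : ℕ) (i j : Fin N) (m : ℤ) :
    Matrix (Fin N → Fin N) (Fin N → Fin N) (UqAff F q N) :=
  if m = -1 then q ^ (2 * (i.val : ℤ)) • big2A F i j (Rtilt F q N)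
  else if m = 1 then (-(q ^ (-2 * (j.val : ℤ)))) • big2A F i j (Rct F q N)
  else 0

/-- The ordered list of factors `S₁(u) R₁₂ᵗ ⋯ R₁Nᵗ S₂(q⁻²u) ⋯ S_N(q^{-2N+2}u)`. -/
def sdetFacsO (F : Type) [Field F] (q : F) (N : ℕ) :
    List (ℤ → Matrix (Fin N → Fin N) (Fin N → Fin N) (UqAff F q N)) :=
  (List.finRange N).flatMap fun i =>
    SfacO F q N i :: (((List.finRange N).filter fun j => i < j).map fun j => RtfacO F q N i j)

/-- The matrix `S^{(r)}` of the coefficients of `S(u)` (symplectic case). -/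
def SmatASp (F : Type) [Field F] (q : F) (n : ℕ) (r : ℕ) :
    Matrix (Fin (2 * n)) (Fin (2 * n)) (UqAff F q (2 * n)) :=
  Matrix.of fun i j => ScoefSp F q n r i j

def SfacSp (F : Type) [Field F] (q : F) (n : ℕ) (k : Fin (2 * n)) (m : ℤ) :
    Matrix (Fin (2 * n) → Fin (2 * n)) (Fin (2 * n) → Fin (2 * n)) (UqAff F q (2 * n)) :=
  if m ≤ 0 then q ^ (2 * (k.val : ℤ) * (-m)) • ampAt k (SmatASp F q n (-m).toNat) else 0

def sdetFacsSp (F : Type) [Field F] (q : F) (n : ℕ) :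
    List (ℤ → Matrix (Fin (2 * n) → Fin (2 * n)) (Fin (2 * n) → Fin (2 * n))
      (UqAff F q (2 * n))) :=
  (List.finRange (2 * n)).flatMap fun i =>
    SfacSp F q n i ::
      (((List.finRange (2 * n)).filter fun j => i < j).map fun j => RtfacO F q (2 * n) i j)

/-- Coefficientwise quantum determinant `qdet T(u)`:
the coefficient of `u^m` (nonzero only for `m ≤ 0`). -/
def qdetTc (F : Type) [Field F] (q : F) (N : ℕ) (m : ℤ) : UqAff F q N :=
  if m ≤ 0 then
    ∑ σ : Equiv.Perm (Fin N), ∑ rv ∈ Finset.Nat.antidiagonalTuple N (-m).toNat,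
      (((-q)⁻¹ ^ invCount σ) * ∏ k : Fin N, q ^ (2 * (k.val : ℤ) * (rv k : ℤ))) •
        ((List.finRange N).map fun k => tA F q N (rv k) (σ k) k).prod
  else 0

/-- Coefficientwise quantum determinant `qdet T̄(q^{2N-2} u⁻¹)`:
the coefficient of `u^m` (nonzero only for `m ≤ 0`). -/
def qdetTbc (F : Type) [Field F] (q : F) (N : ℕ) (m : ℤ) : UqAff F q N :=
  if m ≤ 0 then
    ∑ σ : Equiv.Perm (Fin N), ∑ rv ∈ Finset.Nat.antidiagonalTuple N (-m).toNat,
      (((-q)⁻¹ ^ invCount σ) *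
          ∏ k : Fin N, q ^ ((2 * (N : ℤ) - 2 - 2 * (k.val : ℤ)) * (rv k : ℤ))) •
        ((List.finRange N).map fun k => tbA F q N (rv k) (σ k) k).prod
  else 0

/-- The linear factor `q^{2i-2}u⁻¹ - q^{-2j+2}u` of `γ_N(u)` (0-based `i`, `j`),
viewed as an `A`-valued series. -/
def gamFac (F : Type) [Field F] (q : F) (N : ℕ) (p : Fin N × Fin N) (m : ℤ) : UqAff F q N :=
  if m = -1 then algebraMap F _ (q ^ (2 * (p.1.val : ℤ)))
  else if m = 1 then algebraMap F _ (-(q ^ (-2 * (p.2.val : ℤ)))) else 0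

/-- The list of series whose product is `γ_N(u) qdet T(u) qdet T̄(q^{2N-2}u⁻¹)`
in the orthogonal case. -/
def rhsO (F : Type) [Field F] (q : F) (N : ℕ) : List (ℤ → UqAff F q N) :=
  ((pairsLex N).map fun p => gamFac F q N p) ++ [qdetTc F q N, qdetTbc F q N]

/-- The positions of the generators with nonnegative exponents in the symplectic
ordered monomials. -/
def allowedSp (n : ℕ) (p : Fin (2 * n) × Fin (2 * n)) : Prop :=
  (p.1.val % 2 = 0 ∧ p.2.val ≤ p.1.val) ∨
    (p.1.val % 2 = 1 ∧ (p.2 = p.1 ∨ p.2.val + 2 ≤ p.1.val))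

instance (n : ℕ) : DecidablePred (allowedSp n) := fun p => by
  unfold allowedSp; infer_instance

/-- The family of symplectic ordered monomials. -/
def famSp (n : ℕ)
    (kk : ({p : Fin (2 * n) × Fin (2 * n) // allowedSp n p} → ℕ) × (Fin n → ℤ)) :
    AlgSp FF qq n :=
  monomSp n (fun p => sSpP FF qq n p.1 p.2) (sInvP FF qq n)
    (fun p => if h : allowedSp n p then kk.1 ⟨p, h⟩ else 0) kk.2

section Components

variable {F : Type} [Field F] (q : F) {N : ℕ} {A : Type} [Ring A] [Algebra F A]

theorem Rc_mul_amp1_apply (S : Matrix (Fin N) (Fin N) A) (i j a b : Fin N) :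
    (liftF F (Rc F q N) * amp1 S : Matrix _ _ A) (i, j) (a, b) =
      (if b = j then (if i = j then q else 1) • S i a else 0)
        + (if b = i ∧ i < j then (q - q⁻¹) • S j a else 0) := by
  rw [Matrix.mul_apply, Fintype.sum_prod_type]
  simp only [liftF, Rc, amp1, Matrix.map_apply, Matrix.of_apply, Prod.mk.injEq, map_add, add_mul,
    Finset.sum_add_distrib]
  congr 1
  · rw [Finset.sum_eq_single i, Finset.sum_eq_single j]
    · simp only [Algebra.smul_def, Algebra.commutes]
      split_ifs <;> first | (exfalso; grind) | simp
    · intro c _ hc; simp [hc.symm]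
    · simp
    · intro c _ hc; apply Finset.sum_eq_zero; intro d _; simp [hc.symm]
    · simp
  · rw [Finset.sum_eq_single j, Finset.sum_eq_single i]
    · simp only [Algebra.smul_def, Algebra.commutes]
      split_ifs <;> first | (exfalso; grind) | simp
    · intro c _ hc; simp [hc.symm]
    · simp
    · intro c _ hc; apply Finset.sum_eq_zero; intro d _; simp [hc.symm]
    · simp

theorem Rct_mul_amp2_apply (S : Matrix (Fin N) (Fin N) A) (a b k l : Fin N) :
    (liftF F (Rct F q N) * amp2 S : Matrix _ _ A) (a, b) (k, l) =
      (if a = k then (if k = b then q else 1) • S b l else 0)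
        + (if a = b ∧ k < b then (q - q⁻¹) • S k l else 0) := by
  rw [Matrix.mul_apply, Fintype.sum_prod_type]
  simp only [liftF, Rct, Rc, amp2, Matrix.map_apply, Matrix.of_apply, Prod.mk.injEq, map_add,
    add_mul, Finset.sum_add_distrib]
  congr 1
  · rw [Finset.sum_eq_single k, Finset.sum_eq_single b]
    · simp only [Algebra.smul_def, Algebra.commutes]
      split_ifs <;> first | (exfalso; grind) | simp
    · intro c _ hc; simp [hc.symm]
    · simp
    · intro c _ hc; apply Finset.sum_eq_zero; intro d _; simp [hc]
    · simp
  · rw [Finset.sum_eq_single k, Finset.sum_eq_single k]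
    · simp only [Algebra.smul_def, Algebra.commutes]
      split_ifs <;> first | (exfalso; grind) | simp
    · intro c _ hc; simp [hc.symm]
    · simp
    · intro c _ hc; apply Finset.sum_eq_zero; intro d _; simp [hc]
    · simp

theorem amp1_mul_Rc_apply (S : Matrix (Fin N) (Fin N) A) (a b k l : Fin N) :
    (amp1 S * liftF F (Rc F q N) : Matrix _ _ A) (a, b) (k, l) =
      (if b = l then (if k = l then q else 1) • S a k else 0)
        + (if b = k ∧ l < k then (q - q⁻¹) • S a l else 0) := by
  rw [Matrix.mul_apply, Fintype.sum_prod_type]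
  simp only [liftF, Rc, amp1, Matrix.map_apply, Matrix.of_apply, Prod.mk.injEq, map_add, mul_add,
    Finset.sum_add_distrib]
  congr 1
  · rw [Finset.sum_eq_single k, Finset.sum_eq_single l]
    · simp only [Algebra.smul_def, Algebra.commutes]
      split_ifs <;> first | (exfalso; grind) | simp
    · intro c _ hc; simp [hc]
    · simp
    · intro c _ hc; apply Finset.sum_eq_zero; intro d _; simp [hc]
    · simp
  · rw [Finset.sum_eq_single l, Finset.sum_eq_single k]
    · simp only [Algebra.smul_def, Algebra.commutes]
      split_ifs <;> first | (exfalso; grind) | simp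
    · intro c _ hc; simp [hc]
    · simp
    · intro c _ hc; apply Finset.sum_eq_zero; intro d _; simp [hc]
    · simp

theorem amp2_mul_Rct_apply (S : Matrix (Fin N) (Fin N) A) (i j a b : Fin N) :
    (amp2 S * liftF F (Rct F q N) : Matrix _ _ A) (i, j) (a, b) =
      (if i = a then (if i = b then q else 1) • S j b else 0)
        + (if a = b ∧ a < i then (q - q⁻¹) • S j i else 0) := by
  rw [Matrix.mul_apply, Fintype.sum_prod_type]
  simp only [liftF, Rct, Rc, amp2, Matrix.map_apply, Matrix.of_apply, Prod.mk.injEq, map_add,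
    mul_add, Finset.sum_add_distrib]
  congr 1
  · rw [Finset.sum_eq_single i, Finset.sum_eq_single b]
    · simp only [Algebra.smul_def, Algebra.commutes]
      split_ifs <;> first | (exfalso; grind) | simp
    · intro c _ hc; simp [hc]
    · simp
    · intro c _ hc; apply Finset.sum_eq_zero; intro d _; simp [hc.symm]
    · simp
  · rw [Finset.sum_eq_single i, Finset.sum_eq_single i]
    · simp only [Algebra.smul_def, Algebra.commutes]
      split_ifs <;> first | (exfalso; grind) | simp
    · intro c _ hc; simp [hc]
    · simp
    · intro c _ hc; apply Finset.sum_eq_zero; intro d _; simp [hc.symm]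
    · simp

theorem sum_pair_mul {A : Type} [Ring A] {N : ℕ} (i j k : Fin N) (c : Prop) [Decidable c]
    (d : Fin N → Prop) [DecidablePred d] (f g u v : Fin N → A) :
    ∑ x : Fin N, ∑ y : Fin N, ((if y = j then f x else 0) + (if y = i ∧ c then g x else 0)) *
        ((if x = k then u y else 0) + (if x = y ∧ d y then v y else 0)) =
      f k * u j + (if d j then f j * v j else 0)
        + (if c then g k * u i + (if d i then g i * v i else 0) else 0) := by
  simp only [add_mul, mul_add, Finset.sum_add_distrib]
  have e1 : ∀ (j : Fin N) (f : Fin N → A), ∑ x : Fin N, ∑ y : Fin N,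
      (if y = j then f x else 0) * (if x = k then u y else 0) = f k * u j := by
    intro j f
    simp [ite_mul, mul_ite]
  have e2 : ∀ (j : Fin N) (f : Fin N → A), ∑ x : Fin N, ∑ y : Fin N,
      (if y = j then f x else 0) * (if x = y ∧ d y then v y else 0) =
        if d j then f j * v j else 0 := by
    intro j f
    rw [Finset.sum_eq_single j]
    · simp [ite_and]
    · intro x _ hx
      simp [ite_and, hx]
    · simp
  by_cases hc : c
  · simp only [hc, and_true, if_true, e1, e2]
    abel
  · simp only [hc, and_false, if_false, e1, e2, zero_mul, Finset.sum_const_zero, add_zero]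

theorem sum_pair_mul' {A : Type} [Ring A] {N : ℕ} (i j k : Fin N) (c : Prop) [Decidable c]
    (d : Fin N → Prop) [DecidablePred d] (f g u v : Fin N → A) :
    ∑ x : Fin N, ∑ y : Fin N, ((if k = x then u y else 0) + (if x = y ∧ d x then v y else 0)) *
        ((if y = j then f x else 0) + (if y = i ∧ c then g x else 0)) =
      u j * f k + (if d j then v j * f j else 0)
        + (if c then u i * g k + (if d i then v i * g i else 0) else 0) := by
  simp only [add_mul, mul_add, Finset.sum_add_distrib]
  have e1 : ∀ (j : Fin N) (f : Fin N → A), ∑ x : Fin N, ∑ y : Fin N,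
      (if k = x then u y else 0) * (if y = j then f x else 0) = u j * f k := by
    intro j f
    simp [ite_mul, mul_ite]
  have e2 : ∀ (j : Fin N) (f : Fin N → A), ∑ x : Fin N, ∑ y : Fin N,
      (if x = y ∧ d x then v y else 0) * (if y = j then f x else 0) =
        if d j then v j * f j else 0 := by
    intro j f
    rw [Finset.sum_eq_single j]
    · simp [ite_and]
    · intro x _ hx
      simp [ite_and, hx]
    · simp
  by_cases hc : c
  · simp only [hc, and_true, if_true, e1, e2]
  · simp only [hc, and_false, if_false, e1, e2, mul_zero, Finset.sum_const_zero, add_zero]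

theorem reflLHS_apply (S : Matrix (Fin N) (Fin N) A) (i j k l : Fin N) :
    reflLHS F q S (i, j) (k, l) =
      (if i = j then q else 1) • ((if k = j then q else 1) • (S i k * S j l)
        + (if k < j then q - q⁻¹ else 0) • (S i j * S k l))
      + (if i < j then q - q⁻¹ else 0) • ((if k = i then q else 1) • (S j k * S i l)
        + (if k < i then q - q⁻¹ else 0) • (S j i * S k l)) := by
  rw [reflLHS, Matrix.mul_assoc, Matrix.mul_apply, Fintype.sum_prod_type]
  simp only [Rc_mul_amp1_apply, Rct_mul_amp2_apply]
  rw [sum_pair_mul i j k (i < j) (fun y => k < y) (fun x => (if i = j then q else 1) • S i x)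
    (fun x => (q - q⁻¹) • S j x) (fun y => (if k = y then q else 1) • S y l)
    (fun _ => (q - q⁻¹) • S k l)]
  simp only [smul_mul_smul_comm, smul_add, smul_smul]
  congr 1
  · by_cases h : k < j <;> simp [h]
  · by_cases h : i < j <;> by_cases h' : k < i <;> simp [h, h']

theorem reflRHS_apply (S : Matrix (Fin N) (Fin N) A) (i j k l : Fin N) :
    reflRHS F q S (i, j) (k, l) =
      (if k = l then q else 1) • ((if i = l then q else 1) • (S j l * S i k)
        + (if l < i then q - q⁻¹ else 0) • (S j i * S l k))
      + (if l < k then q - q⁻¹ else 0) • ((if i = k then q else 1) • (S j k * S i l)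
        + (if k < i then q - q⁻¹ else 0) • (S j i * S k l)) := by
  rw [reflRHS, Matrix.mul_assoc, Matrix.mul_apply, Fintype.sum_prod_type]
  simp only [amp1_mul_Rc_apply, amp2_mul_Rct_apply]
  rw [sum_pair_mul' k l i (l < k) (fun y => y < i) (fun x => (if k = l then q else 1) • S x k)
    (fun x => (q - q⁻¹) • S x l) (fun y => (if i = y then q else 1) • S j y)
    (fun _ => (q - q⁻¹) • S j i)]
  simp only [smul_mul_smul_comm, smul_add, smul_smul]
  congr 1
  · by_cases h : l < i <;> simp [h, mul_comm]
  · by_cases h : l < k <;> by_cases h' : k < i <;> simp [h, h', mul_comm]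

end Components

/-- `S`, together with inverses `sI` of its entries `s_{ii'}`, satisfies the defining relations
of the symplectic presentation. -/
structure IsSpSolution (F : Type) [Field F] (q : F) {n : ℕ} {A : Type} [Ring A] [Algebra F A]
    (S : Matrix (Fin (2 * n)) (Fin (2 * n)) A) (sI : Fin n → A) : Prop where
  tri : ∀ i j : Fin (2 * n), i < j → ¬(i.val % 2 = 0 ∧ j.val = i.val + 1) → S i j = 0
  quad : ∀ k : Fin n, S (fo n k) (fo n k) * S (fe n k) (fe n k) =
    q ^ 2 • (S (fo n k) (fe n k) * S (fe n k) (fo n k)) + algebraMap F A (q ^ 3)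
  invR : ∀ k : Fin n, S (fe n k) (fo n k) * sI k = 1
  invL : ∀ k : Fin n, sI k * S (fe n k) (fo n k) = 1
  refl : reflLHS F q S = reflRHS F q S

section Lift

variable (F : Type) [Field F] (q : F) (n : ℕ)

theorem AlgHom.map_liftF_mul {A B : Type} [Ring A] [Algebra F A] [Ring B] [Algebra F B]
    (f : A →ₐ[F] B) {N : ℕ} (S : Matrix (Fin N) (Fin N) A) (i j k l : Fin N) :
    f (reflLHS F q S (i, j) (k, l)) = reflLHS F q (S.map f) (i, j) (k, l) ∧
      f (reflRHS F q S (i, j) (k, l)) = reflRHS F q (S.map f) (i, j) (k, l) := by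
  simp only [reflLHS_apply, reflRHS_apply, map_add, map_smul, map_mul, Matrix.map_apply, and_self]

theorem isSpSolution_algSp :
    IsSpSolution F q (Matrix.of (sSpP F q n)) (sInvP F q n) where
  tri i j h h' := by
    have := RingQuot.mkAlgHom_rel F (SpRel.tri (F := F) (q := q) i j h h')
    simpa [sSpP] using this
  quad k := by
    have := RingQuot.mkAlgHom_rel F (SpRel.quad (F := F) (q := q) k)
    simpa [sSpP, Algebra.smul_def] using this
  invR k := by
    have := RingQuot.mkAlgHom_rel F (SpRel.invR (F := F) (q := q) k)
    simpa [sSpP, sInvP] using this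
  invL k := by
    have := RingQuot.mkAlgHom_rel F (SpRel.invL (F := F) (q := q) k)
    simpa [sSpP, sInvP] using this
  refl := by
    ext ⟨i, j⟩ ⟨k, l⟩
    have := RingQuot.mkAlgHom_rel F (SpRel.refl (F := F) (q := q) (n := n) (i, j) (k, l))
    have h := AlgHom.map_liftF_mul F q (RingQuot.mkAlgHom F (SpRel F q n)) (SpFreeS F n) i j k l
    rw [h.1, h.2] at this
    exact this

variable {F q n}

/-- The algebra map out of the presented algebra attached to a solution of its relations. -/
theorem IsSpSolution.exists_lift {A : Type} [Ring A] [Algebra F A]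
    {S : Matrix (Fin (2 * n)) (Fin (2 * n)) A} {sI : Fin n → A} (h : IsSpSolution F q S sI) :
    ∃ f : AlgSp F q n →ₐ[F] A, (∀ i j, f (sSpP F q n i j) = S i j) ∧
      ∀ k, f (sInvP F q n k) = sI k := by
  let g : FreeAlgebra F (SpGen n) →ₐ[F] A :=
    FreeAlgebra.lift F (Sum.elim (fun p => S p.1 p.2) sI)
  have hg : (SpFreeS F n).map g = S := by
    ext i j; simp [g, SpFreeS]
  refine ⟨RingQuot.liftAlgHom F ⟨g, ?_⟩, fun i j => ?_, fun k => ?_⟩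
  · intro x y hxy
    induction hxy with
    | tri i j hij hij' => simpa [g] using h.tri i j hij hij'
    | quad k => simpa [g, Algebra.smul_def] using h.quad k
    | invR k => simpa [g] using h.invR k
    | invL k => simpa [g] using h.invL k
    | refl p r =>
      obtain ⟨i, j⟩ := p
      obtain ⟨k, l⟩ := r
      have e := AlgHom.map_liftF_mul F q g (SpFreeS F n) i j k l
      rw [e.1, e.2, hg, h.refl]
  · simp [sSpP, g]
  · simp [sInvP, g]

end Lift

section Commutation

variable {F : Type} [Field F] {q : F} {n : ℕ} {A : Type} [Ring A] [Algebra F A]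
  {S : Matrix (Fin (2 * n)) (Fin (2 * n)) A} {sI : Fin n → A}

theorem IsSpSolution.refl_apply (h : IsSpSolution F q S sI) (i j k l : Fin (2 * n)) :
    (if i = j then q else 1) • ((if k = j then q else 1) • (S i k * S j l)
        + (if k < j then q - q⁻¹ else 0) • (S i j * S k l))
      + (if i < j then q - q⁻¹ else 0) • ((if k = i then q else 1) • (S j k * S i l)
        + (if k < i then q - q⁻¹ else 0) • (S j i * S k l)) =
      (if k = l then q else 1) • ((if i = l then q else 1) • (S j l * S i k)
        + (if l < i then q - q⁻¹ else 0) • (S j i * S l k))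
      + (if l < k then q - q⁻¹ else 0) • ((if i = k then q else 1) • (S j k * S i l)
        + (if k < i then q - q⁻¹ else 0) • (S j i * S k l)) := by
  rw [← reflLHS_apply, ← reflRHS_apply, h.refl]

theorem IsSpSolution.z_comm (h : IsSpSolution F q S sI) (hq : q ≠ 0) (k : Fin n)
    (a b : Fin (2 * n)) :
    ∃ c : F, c ≠ 0 ∧ S (fe n k) (fo n k) * S a b = c • (S a b * S (fe n k) (fo n k)) := by
  have e := h.refl_apply (fe n k) a (fo n k) b
  have ve : (fe n k).val = 2 * k.val := rfl
  have vo : (fo n k).val = 2 * k.val + 1 := rfl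
  have hlt : fe n k < fo n k := by simp [fe, fo, Fin.lt_def]
  have hne : fe n k ≠ fo n k := hlt.ne
  simp only [hne, hne.symm, hlt.not_gt, if_false, one_smul, zero_smul, add_zero] at e
  by_cases hz : S a b = 0
  · exact ⟨1, one_ne_zero, by simp [hz]⟩
  have hab : b ≤ a ∨ (a.val % 2 = 0 ∧ b.val = a.val + 1) := by
    by_contra hc
    push Not at hc
    exact hz (h.tri a b hc.1 (by tauto))
  have e1 : (if fo n k < a then q - q⁻¹ else 0) • (S (fe n k) a * S (fo n k) b) = 0 := by
    split_ifs with h1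
    · rw [h.tri (fe n k) a (hlt.trans h1) (by omega)]; simp
    · simp
  have e2 : (if b < fe n k then q - q⁻¹ else 0) • (S a (fe n k) * S b (fo n k)) = 0 := by
    split_ifs with h1
    · rw [h.tri b (fo n k) (h1.trans hlt) (by omega)]; simp
    · simp
  rw [e1, e2] at e
  rcases lt_trichotomy a (fe n k) with ha | ha | ha
  · have e3 : S a (fo n k) = 0 :=
      h.tri _ _ (ha.trans hlt) (by omega)
    have h1 : ¬ fe n k = a := ha.ne'
    have h2 : ¬ fo n k = a := (ha.trans hlt).ne'
    have h3 : ¬ fo n k = b := by omega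
    simp only [e3, h1, h2, h3, if_false, one_smul, zero_mul, smul_zero, add_zero] at e
    exact ⟨_, by split_ifs; exacts [hq, one_ne_zero], e⟩
  · subst ha
    simp only [hne.symm, if_false, if_true, one_smul, add_zero, lt_irrefl, zero_smul] at e
    by_cases hb : b = fo n k
    · exact ⟨1, one_ne_zero, by simp [hb]⟩
    have h1 : b < fo n k := by omega
    simp only [h1, h1.ne', if_true, if_false, one_smul] at e
    refine ⟨q * (if fe n k = b then q else 1),
      mul_ne_zero hq (by split_ifs; exacts [hq, one_ne_zero]), ?_⟩
    rw [mul_smul, ← sub_eq_iff_eq_add.2 e, ← sub_smul q (q - q⁻¹), smul_smul]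
    rw [show q * (q - (q - q⁻¹)) = 1 by field_simp; ring, one_smul]
  · have h0 : ¬ fe n k = a := ha.ne
    have h0' : fo n k ≤ a := by omega
    simp only [h0, ha, if_false, if_true, one_smul, add_zero] at e
    by_cases hb : fo n k = b
    · subst hb
      simp only [hne, lt_irrefl, if_false, if_true, zero_smul, one_smul, add_zero] at e
      refine ⟨(if fo n k = a then q else 1)⁻¹ * q⁻¹, ?_, ?_⟩
      · split_ifs <;> simp [hq]
      · have h2 : (if fo n k = a then q else 1) ≠ 0 := by split_ifs; exacts [hq, one_ne_zero]
        rw [mul_smul, eq_inv_smul_iff₀ h2, eq_sub_of_add_eq e, ← sub_smul q (q - q⁻¹)]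
        congr 1; ring
    · by_cases hb' : b < fo n k
      · simp only [hb, hb', if_false, if_true, one_smul, add_left_inj] at e
        refine ⟨(if fo n k = a then q else 1)⁻¹ * (if fe n k = b then q else 1), ?_, ?_⟩
        · split_ifs <;> simp [hq]
        · have h2 : (if fo n k = a then q else 1) ≠ 0 := by split_ifs; exacts [hq, one_ne_zero]
          rw [mul_smul, eq_inv_smul_iff₀ h2, e]
      · have e3 : S (fe n k) b = 0 :=
          h.tri _ _ (by omega)
            (by omega)
        simp only [hb, hb', e3, if_false, mul_zero, smul_zero, add_zero, one_smul] at e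
        refine ⟨(if fo n k = a then q else 1)⁻¹ * (if fe n k = b then q else 1), ?_, ?_⟩
        · split_ifs <;> simp [hq]
        · have h2 : (if fo n k = a then q else 1) ≠ 0 := by split_ifs; exacts [hq, one_ne_zero]
          rw [mul_smul, eq_inv_smul_iff₀ h2, e]

end Commutation

section Straightening

variable {F : Type} [Field F] {B : Type} [Ring B] [Algebra F B] {ι : Type}

/-- The span of the words in the letters of `ord` of weight less than `m`. -/
def wordSpan (F : Type) [Field F] {B : Type} [Ring B] [Algebra F B] {ι : Type}
    (x : ι → B) (w : ι → ℕ) (ord : List ι) (m : ℕ) : Submodule F B :=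
  Submodule.span F {b | ∃ l : List ι, (∀ a ∈ l, a ∈ ord) ∧ (l.map w).sum < m ∧ b = (l.map x).prod}

variable {x : ι → B} {w : ι → ℕ} {ord : List ι}

theorem word_mem_wordSpan {l : List ι} (hl : ∀ a ∈ l, a ∈ ord) {m : ℕ}
    (hm : (l.map w).sum < m) : (l.map x).prod ∈ wordSpan F x w ord m :=
  Submodule.subset_span ⟨l, hl, hm, rfl⟩

theorem mul_mem_wordSpan {m m' k : ℕ} (hk : m + m' ≤ k + 1) {u v : B}
    (hu : u ∈ wordSpan F x w ord m) (hv : v ∈ wordSpan F x w ord m') :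
    u * v ∈ wordSpan F x w ord k := by
  induction hu using Submodule.span_induction with
  | mem u hu =>
    obtain ⟨l, hl, hm, rfl⟩ := hu
    induction hv using Submodule.span_induction with
    | mem v hv =>
      obtain ⟨l', hl', hm', rfl⟩ := hv
      rw [← List.prod_append, ← List.map_append]
      refine word_mem_wordSpan (fun a ha => ?_) (by simp; omega)
      rcases List.mem_append.1 ha with h | h
      exacts [hl a h, hl' a h]
    | zero => simp
    | add v v' _ _ h h' => rw [mul_add]; exact add_mem h h'
    | smul c v _ h => rw [mul_smul_comm]; exact Submodule.smul_mem _ _ h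
  | zero => simp
  | add v v' _ _ h h' => rw [add_mul]; exact add_mem h h'
  | smul c v _ h => rw [smul_mul_assoc]; exact Submodule.smul_mem _ _ h

theorem exists_perm_sub_smul_mem_wordSpan
    (H : ∀ a ∈ ord, ∀ b ∈ ord, ∃ c : F, c ≠ 0 ∧
      x a * x b - c • (x b * x a) ∈ wordSpan F x w ord (w a + w b))
    {l l' : List ι} (h : l.Perm l') (hl : ∀ a ∈ l, a ∈ ord) :
    ∃ c : F, c ≠ 0 ∧
      (l.map x).prod - c • (l'.map x).prod ∈ wordSpan F x w ord (l.map w).sum := by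
  induction h with
  | nil => exact ⟨1, one_ne_zero, by simp⟩
  | @cons a l l' _ ih =>
    obtain ⟨c, hc, h⟩ := ih fun b hb => hl b (List.mem_cons_of_mem _ hb)
    refine ⟨c, hc, ?_⟩
    have ha : (([a] : List ι).map x).prod ∈ wordSpan F x w ord (w a + 1) :=
      word_mem_wordSpan (by simpa using hl a List.mem_cons_self) (by simp)
    have := mul_mem_wordSpan (k := ((a :: l).map w).sum) (by simp; omega) ha h
    simpa [mul_sub] using this
  | swap a b l =>
    obtain ⟨c, hc, h⟩ := H b (hl b (by simp)) a (hl a (by simp))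
    refine ⟨c, hc, ?_⟩
    have hlw : (l.map x).prod ∈ wordSpan F x w ord ((l.map w).sum + 1) :=
      word_mem_wordSpan (fun a ha => hl a (by simp [ha])) (by simp)
    have := mul_mem_wordSpan (k := ((b :: a :: l).map w).sum) (by simp; omega) h hlw
    simpa [sub_mul, mul_assoc] using this
  | @trans l₁ l₂ l₃ h₁ h₂ ih₁ ih₂ =>
    obtain ⟨c, hc, h⟩ := ih₁ hl
    obtain ⟨c', hc', h'⟩ := ih₂ fun a ha => hl a (h₁.mem_iff.2 ha)
    refine ⟨c * c', mul_ne_zero hc hc', ?_⟩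
    rw [← (h₁.map w).sum_eq] at h'
    have := add_mem h (Submodule.smul_mem _ c h')
    rw [smul_sub, smul_smul] at this
    simpa using this

theorem word_mem_span_ordered [DecidableEq ι] (hnd : ord.Nodup)
    (H : ∀ a ∈ ord, ∀ b ∈ ord, ∃ c : F, c ≠ 0 ∧
      x a * x b - c • (x b * x a) ∈ wordSpan F x w ord (w a + w b))
    (l : List ι) (hl : ∀ a ∈ l, a ∈ ord) :
    (l.map x).prod ∈
      Submodule.span F (Set.range fun cnt : ι → ℕ => (ord.map fun a => x a ^ cnt a).prod) := by
  induction hm : (l.map w).sum using Nat.strong_induction_on generalizing l with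
  | _ m ih =>
    set V := Submodule.span F (Set.range fun cnt : ι → ℕ => (ord.map fun a => x a ^ cnt a).prod)
    have hW : wordSpan F x w ord m ≤ V := by
      refine Submodule.span_le.2 ?_
      rintro _ ⟨l', hl', hm', rfl⟩
      exact ih _ hm' l' hl' rfl
    have hcan : ∀ ord' : List ι, ((ord'.flatMap fun a => List.replicate (l.count a) a).map x).prod =
        (ord'.map fun a => x a ^ l.count a).prod := by
      intro ord'
      induction ord' with
      | nil => simp
      | cons a t iht => simp [List.flatMap_cons, iht]
    have hcount : ∀ ord' : List ι, ord'.Nodup → ∀ b,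
        (ord'.flatMap fun a => List.replicate (l.count a) a).count b =
          if b ∈ ord' then l.count b else 0 := by
      intro ord' h' b
      induction ord' with
      | nil => simp
      | cons a t iht =>
        rw [List.nodup_cons] at h'
        rw [List.flatMap_cons, List.count_append, iht h'.2, List.count_replicate]
        by_cases hab : a = b
        · subst hab; simp [h'.1]
        · simp [hab, Ne.symm hab]
    have hperm : l.Perm (ord.flatMap fun a => List.replicate (l.count a) a) := by
      rw [List.perm_iff_count]
      intro b
      rw [hcount ord hnd]
      split_ifs with hb
      · rfl
      · exact List.count_eq_zero.2 fun h => hb (hl b h)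
    obtain ⟨c, -, hc⟩ := exists_perm_sub_smul_mem_wordSpan H hperm hl
    rw [hm, hcan] at hc
    have h1 : (ord.map fun a => x a ^ l.count a).prod ∈ V :=
      Submodule.subset_span ⟨fun a => l.count a, rfl⟩
    simpa using add_mem (hW hc) (Submodule.smul_mem _ c h1)

end Straightening

section Weights

/-- The weight of a position, used to order words in the generators. -/
def posWt (N a b : ℕ) : ℕ :=
  if a % 2 = 0 ∧ b = a + 1 then 0
  else if a % 2 = 1 ∧ a = b + 1 then 8 * N
  else (a - b) * (4 * N - (a - b)) + 4 * N

/-- The positions `(a, b)` with `b ≤ a`, other than those of the form `(i', i)`. -/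
def IsPlain (a b : ℕ) : Prop := b ≤ a ∧ ¬(a % 2 = 1 ∧ a = b + 1)

/-- The positions at which the matrix of generators may be nonzero. -/
def IsSupp (a b : ℕ) : Prop := b ≤ a ∨ (a % 2 = 0 ∧ b = a + 1)

theorem posWt_plain {N a b : ℕ} (h : IsPlain a b) (ha : a < N) :
    (posWt N a b : ℤ) = ((a : ℤ) - b) * (4 * N - (a - b)) + 4 * N := by
  obtain ⟨h1, h2⟩ := h
  have h3 : ¬(a % 2 = 0 ∧ b = a + 1) := by omega
  have h4 : a - b ≤ 4 * N := by omega
  simp only [posWt, h2, h3, if_false]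
  push_cast [h1, h4]
  ring

theorem posWt_cases {N a b : ℕ} (h : IsSupp a b) (ha : a < N) :
    (a % 2 = 0 ∧ b = a + 1 ∧ (posWt N a b : ℤ) = 0) ∨
      (a % 2 = 1 ∧ a = b + 1 ∧ (posWt N a b : ℤ) = 8 * N) ∨
      (b ≤ a ∧ ¬(a % 2 = 1 ∧ a = b + 1) ∧
        (posWt N a b : ℤ) = ((a : ℤ) - b) * (4 * N - (a - b)) + 4 * N) := by
  by_cases hz : a % 2 = 0 ∧ b = a + 1
  · left; simp [posWt, hz]
  by_cases hy : a % 2 = 1 ∧ a = b + 1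
  · right; left
    refine ⟨hy.1, hy.2, ?_⟩
    have : (if a % 2 = 0 ∧ b = a + 1 then 0 else if a % 2 = 1 ∧ a = b + 1 then 8 * N
      else (a - b) * (4 * N - (a - b)) + 4 * N) = 8 * N := by rw [if_neg hz, if_pos hy]
    simp only [posWt, this]
    norm_num
  · right; right
    have : b ≤ a := by unfold IsSupp at h; omega
    exact ⟨this, hy, posWt_plain ⟨this, hy⟩ ha⟩

theorem posWt_lt_of_mid {N i j k l : ℕ} (hi : i < N) (hik : IsPlain i k) (hjl : IsPlain j l)
    (hij : j ≤ i) (hk : k < j) (h1 : IsSupp i j) (h2 : IsSupp k l) :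
    posWt N i j + posWt N k l < posWt N i k + posWt N j l := by
  zify
  rw [posWt_plain hik hi, posWt_plain hjl (by omega)]
  obtain ⟨hik, hik'⟩ := hik
  obtain ⟨hjl, hjl'⟩ := hjl
  rcases posWt_cases (N := N) h1 (by omega) with ⟨a1, a2, e⟩ | ⟨a1, a2, e⟩ | ⟨a1, a2, e⟩ <;>
  rcases posWt_cases (N := N) h2 (by omega) with ⟨b1, b2, e'⟩ | ⟨b1, b2, e'⟩ | ⟨b1, b2, e'⟩ <;>
  rw [e, e'] <;> first | (exfalso; omega) | skip
  all_goals clear h1 h2 e e'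
  all_goals zify at *
  all_goals nlinarith

theorem posWt_lt_of_low {N i j k l : ℕ} (hi : i < N) (hik : IsPlain i k) (hjl : IsPlain j l)
    (hij : j ≤ i) (hl : l < i) (h1 : IsSupp j i) (h2 : IsSupp l k) :
    posWt N j i + posWt N l k < posWt N i k + posWt N j l := by
  zify
  rw [posWt_plain hik hi, posWt_plain hjl (by omega)]
  obtain ⟨hik, hik'⟩ := hik
  obtain ⟨hjl, hjl'⟩ := hjl
  rcases posWt_cases (N := N) h1 (by omega) with ⟨a1, a2, e⟩ | ⟨a1, a2, e⟩ | ⟨a1, a2, e⟩ <;>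
  rcases posWt_cases (N := N) h2 (by omega) with ⟨b1, b2, e'⟩ | ⟨b1, b2, e'⟩ | ⟨b1, b2, e'⟩ <;>
  rw [e, e'] <;> first | (exfalso; omega) | skip
  all_goals clear h1 h2 e e'
  all_goals zify at *
  all_goals nlinarith

theorem posWt_lt_of_cross {N i j k l : ℕ} (hi : i < N) (hik : IsPlain i k) (hjl : IsPlain j l)
    (hij : j < i) (hl : l < k)
    (hex : ¬(j % 2 = 0 ∧ i = j + 1 ∧ k = i ∧ l = j)) (h1 : IsSupp j k) (h2 : IsSupp i l) :
    posWt N j k + posWt N i l < posWt N i k + posWt N j l := by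
  zify
  rw [posWt_plain hik hi, posWt_plain hjl (by omega)]
  obtain ⟨hik, hik'⟩ := hik
  obtain ⟨hjl, hjl'⟩ := hjl
  rcases posWt_cases (N := N) h1 (by omega) with ⟨a1, a2, e⟩ | ⟨a1, a2, e⟩ | ⟨a1, a2, e⟩ <;>
  rcases posWt_cases (N := N) h2 (by omega) with ⟨b1, b2, e'⟩ | ⟨b1, b2, e'⟩ | ⟨b1, b2, e'⟩ <;>
  rw [e, e'] <;> first | (exfalso; omega) | skip
  all_goals clear h1 h2 e e'
  all_goals zify at *
  all_goals nlinarith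

theorem posWt_lt_of_both {N i j k l : ℕ} (hi : i < N) (hik : IsPlain i k) (hjl : IsPlain j l)
    (hij : j ≤ i) (hl : l < k) (hk : k < i) (h1 : IsSupp j i) (h2 : IsSupp k l) :
    posWt N j i + posWt N k l < posWt N i k + posWt N j l := by
  zify
  rw [posWt_plain hik hi, posWt_plain hjl (by omega)]
  obtain ⟨hik, hik'⟩ := hik
  obtain ⟨hjl, hjl'⟩ := hjl
  rcases posWt_cases (N := N) h1 (by omega) with ⟨a1, a2, e⟩ | ⟨a1, a2, e⟩ | ⟨a1, a2, e⟩ <;>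
  rcases posWt_cases (N := N) h2 (by omega) with ⟨b1, b2, e'⟩ | ⟨b1, b2, e'⟩ | ⟨b1, b2, e'⟩ <;>
  rw [e, e'] <;> first | (exfalso; omega) | skip
  all_goals clear h1 h2 e e'
  all_goals zify at *
  all_goals nlinarith

end Weights

section Spanning

/-- The generators listed in the order in which they occur in the ordered monomials. -/
def spOrd (n : ℕ) : List (SpGen n) :=
  (List.finRange n).flatMap fun k =>
    (rowA n k).map Sum.inl ++ ([Sum.inl (fe n k, fo n k), Sum.inr k, Sum.inl (fo n k, fo n k)] ++
      (rowB n k).map Sum.inl)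

/-- The weight of a generator. -/
def genWt (n : ℕ) : SpGen n → ℕ := Sum.elim (fun p => posWt (2 * n) p.1 p.2) fun _ => 0

theorem mem_rowA {n : ℕ} {k : Fin n} {p : Fin (2 * n) × Fin (2 * n)} :
    p ∈ rowA n k ↔ p.1.val = 2 * k.val ∧ p.2.val ≤ 2 * k.val := by
  obtain ⟨a, b⟩ := p
  simp only [rowA, List.mem_map, List.mem_filter, List.mem_finRange, true_and, Prod.mk.injEq, fe,
    Fin.ext_iff, decide_eq_true_eq]
  constructor
  · rintro ⟨c, h1, h2, h3⟩; omega
  · rintro ⟨h1, h2⟩; exact ⟨b, h2, h1.symm, rfl⟩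

theorem mem_rowB {n : ℕ} {k : Fin n} {p : Fin (2 * n) × Fin (2 * n)} :
    p ∈ rowB n k ↔ p.1.val = 2 * k.val + 1 ∧ p.2.val + 2 ≤ 2 * k.val + 1 := by
  obtain ⟨a, b⟩ := p
  simp only [rowB, List.mem_map, List.mem_filter, List.mem_finRange, true_and, Prod.mk.injEq, fo,
    Fin.ext_iff, decide_eq_true_eq]
  constructor
  · rintro ⟨c, h1, h2, h3⟩; omega
  · rintro ⟨h1, h2⟩; exact ⟨b, h2, h1.symm, rfl⟩

theorem inl_mem_spOrd {n : ℕ} {p : Fin (2 * n) × Fin (2 * n)} :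
    Sum.inl p ∈ spOrd n ↔
      IsPlain p.1 p.2 ∨ (p.1.val % 2 = 0 ∧ p.2.val = p.1.val + 1) := by
  obtain ⟨⟨a, ha⟩, ⟨b, hb⟩⟩ := p
  simp only [spOrd, List.mem_flatMap, List.mem_finRange, true_and, List.mem_append, List.mem_map,
    Sum.inl.injEq, exists_eq_right, List.mem_cons, reduceCtorEq, false_or,
    List.not_mem_nil, or_false, mem_rowA, mem_rowB, IsPlain, Prod.mk.injEq, fe, fo, Fin.mk.injEq]
  constructor
  · rintro ⟨⟨k, hk⟩, h⟩
    simp only at h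
    omega
  · intro h
    refine ⟨⟨a / 2, by omega⟩, ?_⟩
    simp only
    omega

theorem inr_mem_spOrd {n : ℕ} (k : Fin n) : Sum.inr k ∈ spOrd n := by
  simp [spOrd]

theorem nodup_spOrd (n : ℕ) : (spOrd n).Nodup := by
  have hinj : Function.Injective (Sum.inl : _ → SpGen n) := Sum.inl_injective
  rw [spOrd, List.nodup_flatMap]
  refine ⟨fun k _ => ?_, ?_⟩
  · have hA : (rowA n k).Nodup :=
      ((List.nodup_finRange _).filter _).map fun a b h => (Prod.mk.inj h).2
    have hB : (rowB n k).Nodup :=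
      ((List.nodup_finRange _).filter _).map fun a b h => (Prod.mk.inj h).2
    refine List.Nodup.append (hA.map hinj) (List.Nodup.append ?_ (hB.map hinj) ?_) ?_
    · simp [fe, fo]
    · intro g h1 h2
      obtain ⟨p, hp, rfl⟩ := List.mem_map.1 h2
      rw [mem_rowB] at hp
      simp [fe, fo, Prod.ext_iff, Fin.ext_iff] at h1
      omega
    · intro g h1 h2
      obtain ⟨p, hp, rfl⟩ := List.mem_map.1 h1
      rw [mem_rowA] at hp
      simp [mem_rowB, fe, fo, Prod.ext_iff, Fin.ext_iff] at h2
      omega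
  · refine (List.nodup_finRange n).imp fun {k k'} hkk => ?_
    intro g h1 h2
    have hv : k.val ≠ k'.val := fun h => hkk (Fin.ext h)
    rcases g with p | k''
    · have hblock : ∀ j : Fin n, Sum.inl p ∈ (rowA n j).map Sum.inl ++
          ([Sum.inl (fe n j, fo n j), Sum.inr j, Sum.inl (fo n j, fo n j)] ++
            (rowB n j).map (Sum.inl : _ → SpGen n)) → p.1.val / 2 = j.val := by
        intro j hj
        obtain ⟨a, b⟩ := p
        simp only [List.mem_append, List.mem_map, Sum.inl.injEq, exists_eq_right, List.mem_cons,
          reduceCtorEq, false_or, List.not_mem_nil, or_false, mem_rowA, mem_rowB, Prod.mk.injEq,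
          Fin.ext_iff, fe, fo] at hj ⊢
        omega
      exact hv ((hblock k h1).symm.trans (hblock k' h2))
    · simp at h1 h2
      exact hkk (h1.symm.trans h2)

variable {F : Type} [Field F] {q : F} {n : ℕ} {A : Type} [Ring A] [Algebra F A]
  {S : Matrix (Fin (2 * n)) (Fin (2 * n)) A} {sI : Fin n → A}

/-- The values of the generators, given the matrix `S` and the inverses `sI`. -/
def genVal (S : Matrix (Fin (2 * n)) (Fin (2 * n)) A) (sI : Fin n → A) : SpGen n → A :=
  Sum.elim (fun p => S p.1 p.2) sI

theorem IsSpSolution.isSupp (h : IsSpSolution F q S sI) {a b : Fin (2 * n)} (hz : S a b ≠ 0) :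
    IsSupp a b := by
  by_contra hc
  unfold IsSupp at hc
  exact hz (h.tri a b (by omega) (by omega))

theorem smul_mul_swap_of_inverse {z z' x : A} (h : z * z' = 1) (h' : z' * z = 1) {c : F}
    (e : z * x = c • (x * z)) : x * z' = c • (z' * x) := by
  calc x * z' = z' * (z * x) * z' := by rw [← mul_assoc, h', one_mul]
    _ = c • (z' * x) := by rw [e, mul_smul_comm, smul_mul_assoc, mul_assoc, mul_assoc, h, mul_one]

theorem IsSpSolution.y_eq (h : IsSpSolution F q S sI) (hq : q ≠ 0) (k : Fin n) :
    S (fo n k) (fe n k) = (q ^ 2)⁻¹ •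
      (S (fo n k) (fo n k) * S (fe n k) (fe n k) * sI k - q ^ 3 • sI k) := by
  rw [eq_inv_smul_iff₀ (pow_ne_zero 2 hq), h.quad k, add_mul, smul_mul_assoc, mul_assoc, h.invR,
    mul_one, Algebra.smul_def (q ^ 3), add_sub_cancel_right]

theorem IsSpSolution.entry_mem (h : IsSpSolution F q S sI) (hq : q ≠ 0) (a b : Fin (2 * n)) :
    S a b ∈ wordSpan F (genVal S sI) (genWt n) (spOrd n) (posWt (2 * n) a b + 1) := by
  by_cases hz : S a b = 0
  · rw [hz]; exact zero_mem _
  by_cases hy : a.val % 2 = 1 ∧ a.val = b.val + 1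
  · obtain ⟨k, hk⟩ : ∃ k : Fin n, k.val = b.val / 2 := ⟨⟨b.val / 2, by omega⟩, rfl⟩
    have ve : (fe n k).val = 2 * k.val := rfl
    have vo : (fo n k).val = 2 * k.val + 1 := rfl
    have ha : a = fo n k := by omega
    have hb : b = fe n k := by omega
    have hw : posWt (2 * n) a b = 16 * n := by
      have : ¬(a.val % 2 = 0 ∧ b.val = a.val + 1) := by omega
      rw [posWt, if_neg this, if_pos hy]; ring
    rw [hw, ha, hb, h.y_eq hq k]
    have hwd : ∀ c : Fin (2 * n), posWt (2 * n) c c = 8 * n := fun c => by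
      rw [posWt, if_neg (by omega), if_neg (by omega)]; simp; ring
    have h1 := word_mem_wordSpan (F := F) (x := genVal S sI) (w := genWt n) (ord := spOrd n)
      (l := [Sum.inl (fo n k, fo n k), Sum.inl (fe n k, fe n k), Sum.inr k]) (m := 16 * n + 1)
      (by
        simp only [List.mem_cons, List.not_mem_nil, or_false, forall_eq_or_imp, forall_eq,
          inl_mem_spOrd, inr_mem_spOrd, IsPlain]
        exact ⟨Or.inl ⟨le_rfl, by omega⟩, Or.inl ⟨le_rfl, by omega⟩, trivial⟩)
      (by simp [genWt, hwd]; omega)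
    have h2 := word_mem_wordSpan (F := F) (x := genVal S sI) (w := genWt n) (ord := spOrd n)
      (l := [Sum.inr k]) (m := 16 * n + 1)
      (by simp [inr_mem_spOrd]) (by simp [genWt])
    simp only [List.map_cons, List.map_nil, List.prod_cons, List.prod_nil, mul_one, genVal,
      Sum.elim_inl, Sum.elim_inr, ← mul_assoc] at h1 h2
    exact Submodule.smul_mem _ _ (sub_mem h1 (Submodule.smul_mem _ _ h2))
  · have hs := h.isSupp hz
    have := word_mem_wordSpan (F := F) (x := genVal S sI) (w := genWt n) (ord := spOrd n)
      (l := [Sum.inl (a, b)]) (m := posWt (2 * n) a b + 1)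
      (by
        simp only [List.mem_cons, List.not_mem_nil, or_false, forall_eq, inl_mem_spOrd, IsPlain]
        unfold IsSupp at hs
        omega)
      (by simp [genWt])
    simpa [genVal] using this

theorem IsSpSolution.mul_mem (h : IsSpSolution F q S sI) (hq : q ≠ 0) (a b c d : Fin (2 * n))
    {m : ℕ} (hm : IsSupp a b → IsSupp c d → posWt (2 * n) a b + posWt (2 * n) c d < m) :
    S a b * S c d ∈ wordSpan F (genVal S sI) (genWt n) (spOrd n) m := by
  by_cases h1 : S a b = 0
  · rw [h1, zero_mul]; exact zero_mem _
  by_cases h2 : S c d = 0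
  · rw [h2, mul_zero]; exact zero_mem _
  exact mul_mem_wordSpan (by have := hm (h.isSupp h1) (h.isSupp h2); omega)
    (h.entry_mem hq a b) (h.entry_mem hq c d)

theorem exists_sub_smul_mem_of_smul_sub {V : Submodule F A} {u v : A} {c d : F} (hc : c ≠ 0)
    (hd : d ≠ 0) (h : c • u - d • v ∈ V) : ∃ e : F, e ≠ 0 ∧ u - e • v ∈ V := by
  refine ⟨c⁻¹ * d, mul_ne_zero (inv_ne_zero hc) hd, ?_⟩
  have := V.smul_mem c⁻¹ h
  rwa [smul_sub, smul_smul, smul_smul, inv_mul_cancel₀ hc, one_smul] at this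

/-- Plain generators commute up to a scalar and terms of smaller weight, away from the pairs
`s_{i'i'}, s_{ii}`. -/
theorem IsSpSolution.plain_comm (h : IsSpSolution F q S sI) (hq : q ≠ 0) {i j k l : Fin (2 * n)}
    (hik : IsPlain i k) (hjl : IsPlain j l) (hij : j < i ∨ (j = i ∧ k < l))
    (hex : ¬(j.val % 2 = 0 ∧ i.val = j.val + 1 ∧ k = i ∧ l = j)) :
    ∃ c : F, c ≠ 0 ∧ S i k * S j l - c • (S j l * S i k) ∈
      wordSpan F (genVal S sI) (genWt n) (spOrd n) (posWt (2 * n) i k + posWt (2 * n) j l) := by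
  have e := h.refl_apply i j k l
  have hji : j ≤ i := hij.elim le_of_lt fun h => h.1.le
  have key : ((if i = j then q else 1) * (if k = j then q else 1)) • (S i k * S j l) -
      ((if k = l then q else 1) * (if i = l then q else 1)) • (S j l * S i k) ∈
      wordSpan F (genVal S sI) (genWt n) (spOrd n)
        (posWt (2 * n) i k + posWt (2 * n) j l) := by
    rw [if_neg hji.not_gt, zero_smul, add_zero, smul_add, smul_add, smul_smul, smul_smul,
      ← eq_sub_iff_add_eq] at e
    rw [e]
    have t1 : (if k < j then q - q⁻¹ else 0) • (S i j * S k l) ∈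
        wordSpan F (genVal S sI) (genWt n) (spOrd n)
          (posWt (2 * n) i k + posWt (2 * n) j l) := by
      split_ifs with hk
      · exact Submodule.smul_mem _ _ (h.mul_mem hq _ _ _ _
          (posWt_lt_of_mid i.2 hik hjl hji hk))
      · rw [zero_smul]; exact zero_mem _
    have t2 : (if l < i then q - q⁻¹ else 0) • (S j i * S l k) ∈
        wordSpan F (genVal S sI) (genWt n) (spOrd n)
          (posWt (2 * n) i k + posWt (2 * n) j l) := by
      split_ifs with hl
      · exact Submodule.smul_mem _ _ (h.mul_mem hq _ _ _ _
          (posWt_lt_of_low i.2 hik hjl hji hl))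
      · rw [zero_smul]; exact zero_mem _
    have t3 : (if l < k then q - q⁻¹ else 0) • ((if i = k then q else 1) • (S j k * S i l)
        + (if k < i then q - q⁻¹ else 0) • (S j i * S k l)) ∈
        wordSpan F (genVal S sI) (genWt n) (spOrd n)
          (posWt (2 * n) i k + posWt (2 * n) j l) := by
      split_ifs with hl h1 h2 h2
      all_goals first
        | (rw [zero_smul]; exact zero_mem _)
        | refine Submodule.smul_mem _ _ (add_mem (Submodule.smul_mem _ _ ?_) ?_)
      all_goals first
        | (rw [zero_smul]; exact zero_mem _)
        | (refine Submodule.smul_mem _ _ (h.mul_mem hq _ _ _ _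
            (posWt_lt_of_both i.2 hik hjl hji hl h2)))
        | exact h.mul_mem hq _ _ _ _ (posWt_lt_of_cross i.2 hik hjl (by omega) hl
            (by simpa [Fin.ext_iff] using hex))
    convert sub_mem (add_mem (Submodule.smul_mem _ (if k = l then q else 1) t2) t3)
      (Submodule.smul_mem _ (if i = j then q else 1) t1) using 1
    rw [mul_smul, mul_smul (if k = l then q else 1) (if i = l then q else 1)]
    abel
  refine exists_sub_smul_mem_of_smul_sub (mul_ne_zero ?_ ?_) (mul_ne_zero ?_ ?_) key
  all_goals split_ifs; exacts [hq, one_ne_zero]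

end Spanning

section Spanning

variable {F : Type} [Field F] {q : F} {n : ℕ} {A : Type} [Ring A] [Algebra F A]
  {S : Matrix (Fin (2 * n)) (Fin (2 * n)) A} {sI : Fin n → A}

theorem IsSpSolution.diag_comm (h : IsSpSolution F q S sI) (hq : q ≠ 0) (k : Fin n) :
    ∃ c : F, c ≠ 0 ∧
      S (fo n k) (fo n k) * S (fe n k) (fe n k) - c • (S (fe n k) (fe n k) * S (fo n k) (fo n k)) ∈
      wordSpan F (genVal S sI) (genWt n) (spOrd n)
        (posWt (2 * n) (fo n k) (fo n k) + posWt (2 * n) (fe n k) (fe n k)) := by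
  have hlt : fe n k < fo n k := by simp [fe, fo, Fin.lt_def]
  have e1 := h.refl_apply (fo n k) (fe n k) (fo n k) (fe n k)
  have e2 := h.refl_apply (fe n k) (fo n k) (fo n k) (fe n k)
  have e3 := h.quad k
  simp only [hlt.ne, hlt.ne', hlt.not_gt, hlt, if_true, if_false, one_smul, zero_smul, add_zero,
    lt_irrefl, add_left_inj] at e1 e2
  rw [(smul_right_injective A hq) e2] at e1
  rw [Algebra.algebraMap_eq_smul_one] at e3
  have hz := h.mul_mem hq (fe n k) (fo n k) (fe n k) (fo n k) (m := posWt (2 * n) (fo n k) (fo n k)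
    + posWt (2 * n) (fe n k) (fe n k)) (fun _ _ => by
      have hwd : ∀ c : Fin (2 * n), posWt (2 * n) c c = 8 * n := fun c => by
        rw [posWt, if_neg (by omega), if_neg (by omega)]; simp; ring
      have : posWt (2 * n) (fe n k) (fo n k) = 0 := by rw [posWt, if_pos (by simp [fe, fo])]
      have := k.2
      simp only [*]
      omega)
  have h1 := word_mem_wordSpan (F := F) (x := genVal S sI) (w := genWt n) (ord := spOrd n)
      (l := []) (m := posWt (2 * n) (fo n k) (fo n k) + posWt (2 * n) (fe n k) (fe n k))
      (by simp) (by
        have hwd : ∀ c : Fin (2 * n), posWt (2 * n) c c = 8 * n := fun c => by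
          rw [posWt, if_neg (by omega), if_neg (by omega)]; simp; ring
        have := k.2
        simp only [*, List.map_nil, List.sum_nil]
        omega)
  simp only [List.map_nil, List.prod_nil] at h1
  refine exists_sub_smul_mem_of_smul_sub (c := (q ^ 2)⁻¹) (d := 1)
    (inv_ne_zero (pow_ne_zero 2 hq)) one_ne_zero ?_
  convert sub_mem (Submodule.smul_mem _ (q - q⁻¹) hz)
    (Submodule.smul_mem _ ((q - q⁻¹) * q ^ 2) h1) using 1
  generalize S (fo n k) (fo n k) * S (fe n k) (fe n k) = X at *
  generalize S (fo n k) (fe n k) * S (fe n k) (fo n k) = Y at *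
  have e4 : Y = (q ^ 2)⁻¹ • (X - q ^ 3 • 1) := by
    rw [e3, add_sub_cancel_right, smul_smul, inv_mul_cancel₀ (pow_ne_zero 2 hq), one_smul]
  rw [e4, ← sub_eq_zero] at e1
  rw [← sub_eq_zero, ← e1]
  match_scalars <;> field_simp <;> ring

theorem IsSpSolution.gen_comm (h : IsSpSolution F q S sI) (hq : q ≠ 0) :
    ∀ a ∈ spOrd n, ∀ b ∈ spOrd n, ∃ c : F, c ≠ 0 ∧
      genVal S sI a * genVal S sI b - c • (genVal S sI b * genVal S sI a) ∈
        wordSpan F (genVal S sI) (genWt n) (spOrd n) (genWt n a + genWt n b) := by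
  have hsymm : ∀ a b, (∃ c : F, c ≠ 0 ∧
      genVal S sI a * genVal S sI b - c • (genVal S sI b * genVal S sI a) ∈
        wordSpan F (genVal S sI) (genWt n) (spOrd n) (genWt n a + genWt n b)) →
      ∃ c : F, c ≠ 0 ∧
      genVal S sI b * genVal S sI a - c • (genVal S sI a * genVal S sI b) ∈
        wordSpan F (genVal S sI) (genWt n) (spOrd n) (genWt n b + genWt n a) := by
    rintro a b ⟨c, hc, hm⟩
    rw [add_comm]
    refine exists_sub_smul_mem_of_smul_sub (c := c) (d := 1) hc one_ne_zero ?_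
    rw [← neg_mem_iff]
    convert hm using 1
    rw [one_smul, neg_sub]
  have hexact : ∀ a b (c : F), c ≠ 0 →
      genVal S sI a * genVal S sI b = c • (genVal S sI b * genVal S sI a) → ∃ c : F, c ≠ 0 ∧
      genVal S sI a * genVal S sI b - c • (genVal S sI b * genVal S sI a) ∈
        wordSpan F (genVal S sI) (genWt n) (spOrd n) (genWt n a + genWt n b) := by
    intro a b c hc e
    exact ⟨c, hc, by rw [e, sub_self]; exact zero_mem _⟩
  have hinl : ∀ (p : Fin (2 * n) × Fin (2 * n)) (k : Fin n), ∃ c : F, c ≠ 0 ∧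
      S p.1 p.2 * sI k = c • (sI k * S p.1 p.2) := by
    intro p k
    obtain ⟨c, hc, e⟩ := h.z_comm hq k p.1 p.2
    exact ⟨c, hc, smul_mul_swap_of_inverse (h.invR k) (h.invL k) e⟩
  have hzz : ∀ (p : Fin (2 * n) × Fin (2 * n)), (p.1.val % 2 = 0 ∧ p.2.val = p.1.val + 1) →
      ∀ p' : Fin (2 * n) × Fin (2 * n), ∃ c : F, c ≠ 0 ∧
        S p.1 p.2 * S p'.1 p'.2 = c • (S p'.1 p'.2 * S p.1 p.2) := by
    intro p hp p'
    obtain ⟨k, hk⟩ : ∃ k : Fin n, k.val = p.1.val / 2 := ⟨⟨p.1.val / 2, by omega⟩, rfl⟩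
    have ve : (fe n k).val = 2 * k.val := rfl
    have vo : (fo n k).val = 2 * k.val + 1 := rfl
    rw [show p.1 = fe n k by omega, show p.2 = fo n k by omega]
    exact h.z_comm hq k _ _
  have hpl : ∀ i k j l : Fin (2 * n), IsPlain i k → IsPlain j l → (j < i ∨ (j = i ∧ k < l)) →
      ∃ c : F, c ≠ 0 ∧ S i k * S j l - c • (S j l * S i k) ∈
        wordSpan F (genVal S sI) (genWt n) (spOrd n) (posWt (2 * n) i k + posWt (2 * n) j l) := by
    intro i k j l hik hjl hij
    by_cases hex : j.val % 2 = 0 ∧ i.val = j.val + 1 ∧ k = i ∧ l = j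
    · obtain ⟨m, hm⟩ : ∃ m : Fin n, m.val = j.val / 2 := ⟨⟨j.val / 2, by omega⟩, rfl⟩
      have ve : (fe n m).val = 2 * m.val := rfl
      have vo : (fo n m).val = 2 * m.val + 1 := rfl
      rw [hex.2.2.1, hex.2.2.2, show i = fo n m by omega, show j = fe n m by omega]
      exact h.diag_comm hq m
    · exact h.plain_comm hq hik hjl hij hex
  rintro (p | k) ha (p' | k') hb
  · rw [inl_mem_spOrd] at ha hb
    rcases ha with ha | ha
    · rcases hb with hb | hb
      · by_cases hpp : p = p'
        · subst hpp
          exact hexact _ _ 1 one_ne_zero (by rw [one_smul])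
        · by_cases hlt : p'.1 < p.1 ∨ (p'.1 = p.1 ∧ p.2 < p'.2)
          · exact hpl _ _ _ _ ha hb hlt
          · refine hsymm (Sum.inl p') (Sum.inl p) (hpl _ _ _ _ hb ha ?_)
            have : ¬(p.1 = p'.1 ∧ p.2 = p'.2) := fun h => hpp (Prod.ext h.1 h.2)
            omega
      · obtain ⟨c, hc, e⟩ := hzz p' hb p
        exact hsymm (Sum.inl p') (Sum.inl p) (hexact _ _ c hc e)
    · obtain ⟨c, hc, e⟩ := hzz p ha p'
      exact hexact _ _ c hc e
  · obtain ⟨c, hc, e⟩ := hinl p k'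
    exact hexact (Sum.inl p) (Sum.inr k') c hc e
  · obtain ⟨c, hc, e⟩ := hinl p' k
    exact hsymm (Sum.inl p') (Sum.inr k) (hexact _ _ c hc e)
  · obtain ⟨c, hc, e⟩ := hinl (fe n k, fo n k) k'
    have := smul_mul_swap_of_inverse (h.invR k) (h.invL k) e
    exact hsymm (Sum.inr k') (Sum.inr k) (hexact _ _ c hc this)

theorem List.prod_map_flatMap {α β M : Type} [Monoid M] (l : List α) (f : α → List β) (g : β → M) :
    ((l.flatMap f).map g).prod = (l.map fun a => ((f a).map g).prod).prod := by
  induction l with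
  | nil => simp
  | cons a t ih => simp [List.flatMap_cons, ih]

theorem pow_mul_pow_of_inverse {M : Type} [Monoid M] {z z' : M} (h : z * z' = 1) (a b : ℕ) :
    z ^ a * z' ^ b = if 0 ≤ (a : ℤ) - b then z ^ ((a : ℤ) - b).toNat
      else z' ^ (-((a : ℤ) - b)).toNat := by
  induction b generalizing a with
  | zero => simp
  | succ b ih =>
    cases a with
    | zero => rw [if_neg (by push_cast; omega), pow_zero, one_mul]; congr 1
    | succ a =>
      rw [pow_succ, pow_succ', mul_assoc, ← mul_assoc z, h, one_mul, ih]
      simp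

theorem prod_spOrd_eq_monomSp {M : Type} [Ring M] (s : Fin (2 * n) × Fin (2 * n) → M)
    (s' : Fin n → M) (h : ∀ k, s (fe n k, fo n k) * s' k = 1) (cnt : SpGen n → ℕ) :
    ((spOrd n).map fun a => Sum.elim s s' a ^ cnt a).prod =
      monomSp n s s' (fun p => if allowedSp n p then cnt (Sum.inl p) else 0)
        fun k => (cnt (Sum.inl (fe n k, fo n k)) : ℤ) - cnt (Sum.inr k) := by
  rw [spOrd, List.prod_map_flatMap, monomSp]
  congr 1
  refine List.map_congr_left fun k _ => ?_
  rw [← pow_mul_pow_of_inverse (h k)]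
  have hA : ((rowA n k).map fun p => s p ^ if allowedSp n p then cnt (Sum.inl p) else 0) =
      (rowA n k).map fun p => s p ^ cnt (Sum.inl p) := by
    refine List.map_congr_left fun p hp => ?_
    rw [mem_rowA] at hp
    rw [if_pos (by unfold allowedSp; omega)]
  have hB : ((rowB n k).map fun p => s p ^ if allowedSp n p then cnt (Sum.inl p) else 0) =
      (rowB n k).map fun p => s p ^ cnt (Sum.inl p) := by
    refine List.map_congr_left fun p hp => ?_
    rw [mem_rowB] at hp
    rw [if_pos (by unfold allowedSp; omega)]
  have hO : allowedSp n (fo n k, fo n k) := by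
    right; simp [fo]
  rw [hA, hB, if_pos hO]
  simp [mul_assoc, Function.comp_def]

theorem span_famSp (n : ℕ) : Submodule.span FF (Set.range (famSp n)) = ⊤ := by
  have hq : qq ≠ 0 := RatFunc.X_ne_zero
  have h := isSpSolution_algSp FF qq n
  set S : Matrix (Fin (2 * n)) (Fin (2 * n)) (AlgSp FF qq n) := Matrix.of (sSpP FF qq n)
  set sI := sInvP FF qq n
  have hmono : ∀ m, wordSpan FF (genVal S sI) (genWt n) (spOrd n) m ≤
      Submodule.span FF (Set.range (famSp n)) := by
    intro m
    refine Submodule.span_le.2 ?_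
    rintro _ ⟨l, hl, -, rfl⟩
    refine Submodule.span_mono ?_
      (word_mem_span_ordered (nodup_spOrd n) (h.gen_comm hq) l hl)
    rintro _ ⟨cnt, rfl⟩
    refine ⟨(fun p => cnt (Sum.inl p.1),
      fun k => (cnt (Sum.inl (fe n k, fo n k)) : ℤ) - cnt (Sum.inr k)), ?_⟩
    exact (prod_spOrd_eq_monomSp (fun p => S p.1 p.2) sI h.invR cnt).symm
  refine eq_top_iff.2 fun x hx => ?_
  clear hx
  obtain ⟨y, rfl⟩ := RingQuot.mkAlgHom_surjective FF (SpRel FF qq n) x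
  have hy : y ∈ Subalgebra.toSubmodule (Algebra.adjoin FF (Set.range (FreeAlgebra.ι FF))) := by
    rw [FreeAlgebra.adjoin_range_ι]; trivial
  rw [Algebra.adjoin_eq_span] at hy
  induction hy using Submodule.span_induction with
  | zero => simp
  | add u v _ _ hu hv => rw [map_add]; exact add_mem hu hv
  | smul c u _ hu => rw [map_smul]; exact Submodule.smul_mem _ _ hu
  | mem u hu =>
    suffices ∃ m, RingQuot.mkAlgHom FF (SpRel FF qq n) u ∈
        wordSpan FF (genVal S sI) (genWt n) (spOrd n) m from hmono _ this.choose_spec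
    induction hu using Submonoid.closure_induction with
    | one =>
      refine ⟨1, ?_⟩
      rw [map_one]
      exact word_mem_wordSpan (l := ([] : List (SpGen n))) (by simp) (by simp)
    | mul u v _ _ hu hv =>
      obtain ⟨m, hm⟩ := hu
      obtain ⟨m', hm'⟩ := hv
      exact ⟨m + m', by rw [map_mul]; exact mul_mem_wordSpan (by omega) hm hm'⟩
    | mem u hu =>
      obtain ⟨g, rfl⟩ := hu
      rcases g with ⟨a, b⟩ | k
      · exact ⟨_, h.entry_mem hq a b⟩
      · refine ⟨1 + 1, ?_⟩
        have := word_mem_wordSpan (F := FF) (x := genVal S sI) (w := genWt n) (ord := spOrd n)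
          (l := [Sum.inr k]) (m := 1 + 1) (by simp [inr_mem_spOrd]) (by simp [genWt])
        rwa [List.map_singleton, List.prod_singleton] at this

end Spanning

section Coaction

variable {F : Type} [Field F] {q : F} {N n : ℕ} {A : Type} [Ring A] [Algebra F A]

/-- The relation `R X₁ Y₂ = Y₂ X₁ R`, entry by entry. -/
def IsRTT (q : F) (X Y : Matrix (Fin N) (Fin N) A) : Prop := ∀ i j k l : Fin N,
  (if i = j then q else 1) • (X i k * Y j l) + (if i < j then q - q⁻¹ else 0) • (X j k * Y i l) =
    (if k = l then q else 1) • (Y j l * X i k)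
      + (if l < k then q - q⁻¹ else 0) • (Y j k * X i l)

theorem mul_amp2_apply (M : Matrix (Fin N × Fin N) (Fin N × Fin N) A)
    (Y : Matrix (Fin N) (Fin N) A) (p : Fin N × Fin N) (k l : Fin N) :
    (M * amp2 Y) p (k, l) = ∑ b, M p (k, b) * Y b l := by
  rw [Matrix.mul_apply, Fintype.sum_prod_type, Finset.sum_eq_single k]
  · simp [amp2]
  · intro b _ hb
    simp [amp2, hb]
  · simp

theorem mul_amp1_apply (M : Matrix (Fin N × Fin N) (Fin N × Fin N) A)
    (X : Matrix (Fin N) (Fin N) A) (p : Fin N × Fin N) (k l : Fin N) :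
    (M * amp1 X) p (k, l) = ∑ a, M p (a, l) * X a k := by
  rw [Matrix.mul_apply, Fintype.sum_prod_type_right, Finset.sum_eq_single l]
  · simp [amp1]
  · intro b _ hb
    simp [amp1, hb]
  · simp

theorem amp2_mul_apply (M : Matrix (Fin N × Fin N) (Fin N × Fin N) A)
    (Y : Matrix (Fin N) (Fin N) A) (i j : Fin N) (r : Fin N × Fin N) :
    (amp2 Y * M) (i, j) r = ∑ b, Y j b * M (i, b) r := by
  rw [Matrix.mul_apply, Fintype.sum_prod_type, Finset.sum_eq_single i]
  · simp [amp2]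
  · intro b _ hb
    simp [amp2, hb.symm]
  · simp

theorem amp1_mul_apply (M : Matrix (Fin N × Fin N) (Fin N × Fin N) A)
    (X : Matrix (Fin N) (Fin N) A) (i j : Fin N) (r : Fin N × Fin N) :
    (amp1 X * M) (i, j) r = ∑ a, X i a * M (a, j) r := by
  rw [Matrix.mul_apply, Fintype.sum_prod_type_right, Finset.sum_eq_single j]
  · simp [amp1]
  · intro b _ hb
    simp [amp1, hb.symm]
  · simp

theorem amp1_mul_amp1 (X Y : Matrix (Fin N) (Fin N) A) : amp1 (X * Y) = amp1 X * amp1 Y := by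
  ext ⟨i, j⟩ ⟨k, l⟩
  rw [amp1_mul_apply]
  by_cases h : j = l <;> simp [amp1, h, Matrix.mul_apply]

theorem amp2_mul_amp2 (X Y : Matrix (Fin N) (Fin N) A) : amp2 (X * Y) = amp2 X * amp2 Y := by
  ext ⟨i, j⟩ ⟨k, l⟩
  rw [amp2_mul_apply]
  by_cases h : i = k <;> simp [amp2, h, Matrix.mul_apply]

theorem amp1_mul_amp2_comm {X Y : Matrix (Fin N) (Fin N) A}
    (h : ∀ i j k l, Commute (X i j) (Y k l)) : amp1 X * amp2 Y = amp2 Y * amp1 X := by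
  ext ⟨i, j⟩ ⟨k, l⟩
  rw [amp1_mul_apply, amp2_mul_apply]
  simp [amp1, amp2, (h _ _ _ _).eq]

theorem IsRTT.mul_eq {X Y : Matrix (Fin N) (Fin N) A} (h : IsRTT q X Y) :
    liftF F (Rc F q N) * amp1 X * amp2 Y = amp2 Y * (amp1 X * liftF F (Rc F q N)) := by
  ext ⟨i, j⟩ ⟨k, l⟩
  rw [mul_amp2_apply, amp2_mul_apply]
  simp only [Rc_mul_amp1_apply, amp1_mul_Rc_apply, add_mul, mul_add, Finset.sum_add_distrib,
    ite_mul, zero_mul, mul_ite, mul_zero, ite_and, Finset.sum_ite_eq', Finset.mem_univ, if_true,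
    Algebra.smul_mul_assoc, Algebra.mul_smul_comm]
  simpa only [ite_smul, zero_smul] using h i j k l

theorem IsRTT.transpose_mul_eq {X : Matrix (Fin N) (Fin N) A} (h : IsRTT q X X) :
    liftF F (Rc F q N) * amp1 X.transpose * amp2 X.transpose =
      amp2 X.transpose * (amp1 X.transpose * liftF F (Rc F q N)) := by
  ext ⟨i, j⟩ ⟨k, l⟩
  rw [mul_amp2_apply, amp2_mul_apply]
  simp only [Rc_mul_amp1_apply, amp1_mul_Rc_apply, add_mul, mul_add, Finset.sum_add_distrib,
    ite_mul, zero_mul, mul_ite, mul_zero, ite_and, Finset.sum_ite_eq', Finset.mem_univ, if_true,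
    Algebra.smul_mul_assoc, Algebra.mul_smul_comm, Matrix.transpose_apply]
  have := (h l k j i).symm
  simp only [ite_smul, zero_smul] at this ⊢
  simpa only [eq_comm (a := j), eq_comm (a := l)] using this

theorem IsRTT.transpose_left_mul_eq {X Y : Matrix (Fin N) (Fin N) A} (h : IsRTT q X Y) :
    amp1 X.transpose * (liftF F (Rct F q N) * amp2 Y) =
      amp2 Y * liftF F (Rct F q N) * amp1 X.transpose := by
  ext ⟨i, j⟩ ⟨k, l⟩
  rw [mul_amp1_apply, amp1_mul_apply]
  simp only [Rct_mul_amp2_apply, amp2_mul_Rct_apply, add_mul, mul_add, Finset.sum_add_distrib,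
    ite_mul, zero_mul, mul_ite, mul_zero, ite_and, Finset.sum_ite_eq', Finset.sum_ite_eq,
    Finset.mem_univ, if_true,
    Algebra.smul_mul_assoc, Algebra.mul_smul_comm, Matrix.transpose_apply]
  simpa only [ite_smul, zero_smul] using h k j i l

theorem IsRTT.transpose_right_mul_eq {X Y : Matrix (Fin N) (Fin N) A} (h : IsRTT q X Y) :
    amp1 Y * (liftF F (Rct F q N) * amp2 X.transpose) =
      amp2 X.transpose * liftF F (Rct F q N) * amp1 Y := by
  ext ⟨i, j⟩ ⟨k, l⟩
  rw [mul_amp1_apply, amp1_mul_apply]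
  simp only [Rct_mul_amp2_apply, amp2_mul_Rct_apply, add_mul, mul_add, Finset.sum_add_distrib,
    ite_mul, zero_mul, mul_ite, mul_zero, ite_and, Finset.sum_ite_eq', Finset.sum_ite_eq,
    Finset.mem_univ, if_true,
    Algebra.smul_mul_assoc, Algebra.mul_smul_comm, Matrix.transpose_apply]
  have := (h l i j k).symm
  simp only [ite_smul, zero_smul] at this ⊢
  simpa only [eq_comm (a := j), eq_comm (a := l)] using this

/-- The coaction `S ↦ T S T̄ᵗ` preserves the reflection equation. -/
theorem reflLHS_coaction {T Tb S : Matrix (Fin N) (Fin N) A}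
    (hT : IsRTT q T T) (hb : IsRTT q Tb Tb) (hm : IsRTT q Tb T)
    (cT : ∀ i j k l, Commute (S i j) (T k l)) (cb : ∀ i j k l, Commute (S i j) (Tb k l))
    (h : reflLHS F q S = reflRHS F q S) :
    reflLHS F q (T * S * Tb.transpose) = reflRHS F q (T * S * Tb.transpose) := by
  have e1 := hT.mul_eq
  have e2 := hm.transpose_left_mul_eq
  have e3 := hb.transpose_mul_eq
  have e4 := hm.transpose_right_mul_eq
  have c1 : amp1 S * amp2 T = amp2 T * amp1 S := amp1_mul_amp2_comm cT
  have c2 : amp1 Tb.transpose * amp2 S = amp2 S * amp1 Tb.transpose :=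
    amp1_mul_amp2_comm fun i j k l => (cb k l j i).symm
  have c3 : amp1 T * amp2 S = amp2 S * amp1 T :=
    amp1_mul_amp2_comm fun i j k l => (cT k l i j).symm
  have c4 : amp1 S * amp2 Tb.transpose = amp2 Tb.transpose * amp1 S :=
    amp1_mul_amp2_comm fun i j k l => cb i j l k
  rw [reflLHS, reflRHS] at h ⊢
  simp only [amp1_mul_amp1, amp2_mul_amp2]
  generalize (liftF F (Rc F q N) : Matrix _ _ A) = R at *
  generalize (liftF F (Rct F q N) : Matrix _ _ A) = Rt at *
  generalize amp1 T = T1 at *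
  generalize amp2 T = T2 at *
  generalize amp1 S = S1 at *
  generalize amp2 S = S2 at *
  generalize amp1 Tb.transpose = B1 at *
  generalize amp2 Tb.transpose = B2 at *
  simp only [← mul_assoc] at e1 e2 e3 e4 h
  calc R * (T1 * S1 * B1) * Rt * (T2 * S2 * B2)
      = R * T1 * S1 * (B1 * Rt * T2) * S2 * B2 := by noncomm_ring
    _ = R * T1 * (S1 * T2) * Rt * (B1 * S2) * B2 := by rw [e2]; noncomm_ring
    _ = (R * T1 * T2) * S1 * Rt * S2 * B1 * B2 := by rw [c1, c2]; noncomm_ring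
    _ = T2 * T1 * (R * S1 * Rt * S2) * B1 * B2 := by rw [e1]; noncomm_ring
    _ = T2 * T1 * S2 * Rt * S1 * (R * B1 * B2) := by rw [h]; noncomm_ring
    _ = T2 * (T1 * S2) * Rt * (S1 * B2) * B1 * R := by rw [e3]; noncomm_ring
    _ = T2 * S2 * (T1 * Rt * B2) * S1 * B1 * R := by rw [c3, c4]; noncomm_ring
    _ = T2 * S2 * B2 * Rt * (T1 * S1 * B1) * R := by rw [e4]; noncomm_ring

end Coaction

section Twist

variable {F : Type} [Field F] {q : F} {N n : ℕ} {A : Type} [Ring A] [Algebra F A]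

/-- A pair of matrices satisfying the defining relations of `U_q(gl_N)`. -/
structure IsGlSolution (q : F) (T Tb : Matrix (Fin N) (Fin N) A) : Prop where
  lower : ∀ i j, i < j → T i j = 0
  upper : ∀ i j, j < i → Tb i j = 0
  mul_bar : ∀ i, T i i * Tb i i = 1
  bar_mul : ∀ i, Tb i i * T i i = 1
  rtt : IsRTT q T T
  rbb : IsRTT q Tb Tb
  rbt : IsRTT q Tb T

variable {T Tb : Matrix (Fin N) (Fin N) A}

theorem IsGlSolution.diag_commute (h : IsGlSolution q T Tb) (i j : Fin N) :
    Commute (Tb i i) (T j j) := by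
  have e := h.rbt i j i j
  rcases lt_trichotomy i j with hij | rfl | hij
  · simpa [hij, hij.ne, hij.not_gt, h.lower _ _ hij, Commute, SemiconjBy] using e
  · exact (h.bar_mul i).trans (h.mul_bar i).symm
  · simpa [hij, hij.ne', hij.not_gt, h.lower _ _ hij, Commute, SemiconjBy] using e

theorem IsGlSolution.bar_mul_bar (h : IsGlSolution q T Tb) {i j : Fin N} (hij : i < j) :
    Tb i j * Tb j j = q⁻¹ • (Tb j j * Tb i j) := by
  have e := h.rbb i j j j
  simp only [hij, hij.ne, if_true, if_false, one_smul, lt_irrefl, zero_smul, add_zero] at e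
  rw [eq_sub_of_add_eq e, ← sub_smul, sub_sub_cancel]

theorem IsGlSolution.mul_bar_upper (h : IsGlSolution q T Tb) {i j : Fin N} (hij : i < j) :
    T i i * Tb i j = q • (Tb i j * T i i) := by
  have e := h.rbt i i j i
  simpa [hij, hij.ne', h.lower _ _ hij] using e.symm

variable {S : Matrix (Fin (2 * n)) (Fin (2 * n)) A} {sI : Fin n → A}

theorem IsSpSolution.z_mul_diag (h : IsSpSolution F q S sI) (k : Fin n) :
    S (fe n k) (fo n k) * S (fe n k) (fe n k) =
      q ^ 2 • (S (fe n k) (fe n k) * S (fe n k) (fo n k)) := by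
  have e := h.refl_apply (fe n k) (fe n k) (fe n k) (fo n k)
  have lt : fe n k < fo n k := Nat.lt_succ_self _
  simpa [lt, lt.ne, lt.not_gt, smul_smul, ← sq] using e.symm

/-- If the entries of `S` commute with those of `T` and `T̄`, the triple products in
`T S T̄ᵗ` reduce to sums. -/
theorem coaction_apply {S T Tb : Matrix (Fin N) (Fin N) A}
    (cT : ∀ i j k l, Commute (S i j) (T k l)) (i j : Fin N) :
    (T * S * Tb.transpose) i j = ∑ b, ∑ a, S a b * T i a * Tb j b := by
  simp only [Matrix.mul_apply, Matrix.transpose_apply, Finset.sum_mul, (cT _ _ _ _).eq]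

theorem sum_eq_of_ne_zero_mem {M : Type} [AddCommMonoid M] {α : Type} [Fintype α] [DecidableEq α]
    (s : Finset (α × α)) (f : α → α → M) (h : ∀ a b, (a, b) ∉ s → f a b = 0) :
    ∑ b, ∑ a, f a b = ∑ p ∈ s, f p.1 p.2 := by
  rw [Finset.sum_comm, ← Fintype.sum_prod_type']
  exact (Finset.sum_subset (Finset.subset_univ s) fun p _ hp => h p.1 p.2 hp).symm

theorem IsSpSolution.coaction {T Tb : Matrix (Fin (2 * n)) (Fin (2 * n)) A}
    (h : IsSpSolution F q S sI) (hq : q ≠ 0) (g : IsGlSolution q T Tb)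
    (cT : ∀ i j k l, Commute (S i j) (T k l)) (cb : ∀ i j k l, Commute (S i j) (Tb k l))
    (iT : ∀ i k l, Commute (sI i) (T k l)) (ib : ∀ i k l, Commute (sI i) (Tb k l)) :
    IsSpSolution F q (T * S * Tb.transpose)
      fun k => sI k * T (fo n k) (fo n k) * Tb (fe n k) (fe n k) := by
  have hz : ∀ i j a b : Fin (2 * n), (i < a ∨ b < j ∨
      (a < b ∧ ¬(a.val % 2 = 0 ∧ b.val = a.val + 1))) → S a b * T i a * Tb j b = 0 := by
    rintro i j a b (h' | h' | h')
    · rw [g.lower _ _ h', mul_zero, zero_mul]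
    · rw [g.upper _ _ h', mul_zero]
    · rw [h.tri _ _ h'.1 h'.2, zero_mul, zero_mul]
  have zval : ∀ k, (T * S * Tb.transpose) (fe n k) (fo n k) =
      S (fe n k) (fo n k) * T (fe n k) (fe n k) * Tb (fo n k) (fo n k) := by
    intro k
    have ve : (fe n k).val = 2 * k.val := rfl
    have vo : (fo n k).val = 2 * k.val + 1 := rfl
    rw [coaction_apply cT, sum_eq_of_ne_zero_mem {(fe n k, fo n k)}]
    · rw [Finset.sum_singleton]
    · intro a b hab
      simp only [Finset.mem_singleton, Prod.mk.injEq] at hab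
      exact hz _ _ _ _ (by omega)
  refine ⟨fun i j hij h' => ?_, fun k => ?_, fun k => ?_, fun k => ?_,
    reflLHS_coaction g.rtt g.rbb g.rbt cT cb h.refl⟩
  · rw [coaction_apply cT, sum_eq_of_ne_zero_mem ∅]
    · rw [Finset.sum_empty]
    · intro a b _
      exact hz _ _ _ _ (by omega)
  · have ve : (fe n k).val = 2 * k.val := rfl
    have vo : (fo n k).val = 2 * k.val + 1 := rfl
    have lt : fe n k < fo n k := Nat.lt_succ_self _
    have e1 : (T * S * Tb.transpose) (fe n k) (fe n k) = S (fe n k) (fe n k)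
        + T (fe n k) (fe n k) * Tb (fe n k) (fo n k) * S (fe n k) (fo n k) := by
      rw [coaction_apply cT, sum_eq_of_ne_zero_mem {(fe n k, fe n k), (fe n k, fo n k)}]
      · rw [Finset.sum_pair (by simp [lt.ne]), mul_assoc, g.mul_bar, mul_one, mul_assoc,
          ((cT _ _ _ _).mul_right (cb _ _ _ _)).eq]
      · intro a b hab
        simp only [Finset.mem_singleton, Finset.mem_insert, Prod.mk.injEq] at hab
        exact hz _ _ _ _ (by omega)
    have e2 : (T * S * Tb.transpose) (fo n k) (fo n k) = S (fo n k) (fo n k)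
        + T (fo n k) (fe n k) * Tb (fo n k) (fo n k) * S (fe n k) (fo n k) := by
      rw [coaction_apply cT, sum_eq_of_ne_zero_mem {(fo n k, fo n k), (fe n k, fo n k)}]
      · rw [Finset.sum_pair (by simp [lt.ne']), mul_assoc, g.mul_bar, mul_one, mul_assoc,
          ((cT _ _ _ _).mul_right (cb _ _ _ _)).eq]
      · intro a b hab
        simp only [Finset.mem_singleton, Finset.mem_insert, Prod.mk.injEq] at hab
        exact hz _ _ _ _ (by omega)
    have e3 : (T * S * Tb.transpose) (fo n k) (fe n k) =
        T (fo n k) (fe n k) * Tb (fe n k) (fe n k) * S (fe n k) (fe n k)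
        + (T (fo n k) (fo n k) * Tb (fe n k) (fe n k) * S (fo n k) (fe n k)
        + (T (fo n k) (fo n k) * Tb (fe n k) (fo n k) * S (fo n k) (fo n k)
        + T (fo n k) (fe n k) * Tb (fe n k) (fo n k) * S (fe n k) (fo n k))) := by
      rw [coaction_apply cT, sum_eq_of_ne_zero_mem
        {(fe n k, fe n k), (fo n k, fe n k), (fo n k, fo n k), (fe n k, fo n k)}]
      · rw [Finset.sum_insert (by simp [lt.ne]), Finset.sum_insert (by simp [lt.ne, lt.ne']),
          Finset.sum_pair (by simp [lt.ne'])]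
        simp only [mul_assoc, ((cT _ _ _ _).mul_right (cb _ _ _ _)).eq]
      · intro a b hab
        simp only [Finset.mem_singleton, Finset.mem_insert, Prod.mk.injEq] at hab
        exact hz _ _ _ _ (by omega)
    have e4 : (T * S * Tb.transpose) (fe n k) (fo n k) =
        T (fe n k) (fe n k) * Tb (fo n k) (fo n k) * S (fe n k) (fo n k) := by
      rw [zval, mul_assoc, ((cT _ _ _ _).mul_right (cb _ _ _ _)).eq]
    rw [e1, e2, e3, e4]
    have r1 := g.mul_bar_upper lt
    have r2 := g.bar_mul_bar lt
    have r3 := g.bar_mul (fe n k)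
    have r4 := g.mul_bar (fo n k)
    have r5 := g.diag_commute (fo n k) (fe n k)
    have r6 := h.z_mul_diag k
    have hQ := h.quad k
    have cx : ∀ {i j : Fin (2 * n)} (k' l k'' l'), Commute (S i j) (T k' l * Tb k'' l') :=
      fun k' l k'' l' => (cT _ _ _ _).mul_right (cb _ _ _ _)
    have r7 : T (fo n k) (fo n k) * Tb (fe n k) (fo n k) * (T (fe n k) (fe n k)
        * Tb (fo n k) (fo n k)) = (q ^ 2)⁻¹ • (T (fe n k) (fe n k) * Tb (fe n k) (fo n k)) := by
      rw [← r5.eq, r1, mul_assoc, ← mul_assoc (Tb (fe n k) (fo n k)), r2, smul_mul_assoc,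
        mul_smul_comm, ← mul_assoc, ← mul_assoc, r4, one_mul, smul_smul]
      congr 1
      field_simp
    have r8 : T (fo n k) (fe n k) * Tb (fe n k) (fo n k) * (T (fe n k) (fe n k)
        * Tb (fo n k) (fo n k)) = (q ^ 2)⁻¹ • (T (fo n k) (fe n k) * Tb (fo n k) (fo n k) *
          (T (fe n k) (fe n k) * Tb (fe n k) (fo n k))) := by
      rw [← r5.eq, r1, mul_assoc, ← mul_assoc (Tb (fe n k) (fo n k)), r2, smul_mul_assoc,
        mul_smul_comm, mul_smul_comm, smul_smul, mul_assoc, mul_assoc]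
      congr 1
      field_simp
    have r9 : T (fo n k) (fe n k) * Tb (fe n k) (fe n k) * (T (fe n k) (fe n k)
        * Tb (fo n k) (fo n k)) = T (fo n k) (fe n k) * Tb (fo n k) (fo n k) := by
      rw [mul_assoc, ← mul_assoc (Tb (fe n k) (fe n k)), r3, one_mul]
    have r10 : T (fo n k) (fo n k) * Tb (fe n k) (fe n k) * (T (fe n k) (fe n k)
        * Tb (fo n k) (fo n k)) = 1 := by
      rw [mul_assoc, ← mul_assoc (Tb (fe n k) (fe n k)), r3, one_mul, r4]
    have mv : ∀ (i j : Fin (2 * n)) (U k' l k'' l'),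
        U * S i j * (T k' l * Tb k'' l' * S (fe n k) (fo n k)) =
          U * (T k' l * Tb k'' l') * (S i j * S (fe n k) (fo n k)) := by
      intro i j U k' l k'' l'
      rw [mul_assoc, ← mul_assoc (S i j), (cx k' l k'' l').eq]
      simp only [mul_assoc]
    have mv1 := fun i j k' l k'' l' => mv i j 1 k' l k'' l'
    simp only [one_mul] at mv1
    simp only [add_mul, mul_add, mv, mv1, r7, r8, r9, r10, hQ, smul_add, smul_mul_assoc, one_mul]
    rw [smul_inv_smul₀ (pow_ne_zero 2 hq), smul_inv_smul₀ (pow_ne_zero 2 hq),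
      mul_assoc _ (S (fe n k) (fo n k)) (S (fe n k) (fe n k)), r6, mul_smul_comm]
    abel
  · rw [zval]
    have c1 := (iT k (fo n k) (fo n k)).mul_right (ib k (fe n k) (fe n k))
    rw [mul_assoc (sI k), c1.eq, mul_assoc (S _ _), mul_assoc,
      ← mul_assoc (_ * _) (_ * _) (sI k), ← mul_assoc (T (fe n k) (fe n k) * _),
      mul_assoc (T (fe n k) (fe n k)), g.bar_mul, mul_one, g.mul_bar, one_mul, h.invR]
  · rw [zval]
    have c1 := (cT (fe n k) (fo n k) (fe n k) (fe n k)).mul_right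
      (cb (fe n k) (fo n k) (fo n k) (fo n k))
    rw [mul_assoc (sI k), mul_assoc (S _ _), c1.eq, mul_assoc (sI k), ← mul_assoc (_ * _) (_ * _),
      ← mul_assoc (T (fo n k) (fo n k) * _), mul_assoc (T (fo n k) (fo n k)), g.bar_mul, mul_one,
      g.mul_bar, one_mul, h.invL]

end Twist

section VectorRep

variable {F : Type} [Field F] {N : ℕ}

/-- Right multiplication by a matrix of the vector representation, on a row vector `e`. -/
def rowAct (d u v : F) (j l b : Fin N) (e : Fin N → F) : F :=
  (if j = l then (if j = b then d else 1) * e b else 0)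
    + if j = b then (if j < l then u else if l < j then v else 0) * e l else 0

def IsRowRTT (q d u v d' u' v' : F) (i j k l b : Fin N) (e : Fin N → F) : Prop :=
  (if i = j then q else 1) * (rowAct d' u' v' j l b fun c => rowAct d u v i k c e) +
    (if i < j then q - q⁻¹ else 0) * (rowAct d' u' v' i l b fun c => rowAct d u v j k c e) =
  (if k = l then q else 1) * (rowAct d u v i k b fun c => rowAct d' u' v' j l c e) +
    (if l < k then q - q⁻¹ else 0) * (rowAct d u v i l b fun c => rowAct d' u' v' j k c e)

set_option maxHeartbeats 4000000 in
theorem isRowRTT {q : F} (hq : q ≠ 0) (i j k l b : Fin N) (e : Fin N → F) :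
    IsRowRTT q q (q - q⁻¹) 0 q (q - q⁻¹) 0 i j k l b e ∧
    IsRowRTT q q⁻¹ 0 (q⁻¹ - q) q⁻¹ 0 (q⁻¹ - q) i j k l b e ∧
    IsRowRTT q q (q - q⁻¹) 0 q⁻¹ 0 (q⁻¹ - q) i j k l b e := by
  have hqi : q * q⁻¹ = 1 := mul_inv_cancel₀ hq
  unfold IsRowRTT rowAct
  generalize q⁻¹ = p at *
  by_cases hi : i = k ∨ i = l ∨ i = b
  · by_cases hj : j = k ∨ j = l ∨ j = b
    · rcases lt_trichotomy k l with h1 | h1 | h1 <;> rcases lt_trichotomy k b with h2 | h2 | h2 <;>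
        rcases lt_trichotomy l b with h3 | h3 | h3 <;>
        first
        | (exfalso; omega)
        | (rcases hi with rfl | rfl | rfl <;> rcases hj with rfl | rfl | rfl <;> subst_vars <;>
            simp [*, ne_of_lt, ne_of_gt, not_lt_of_gt, -mul_eq_mul_left_iff,
              -mul_eq_mul_right_iff] <;> grind)
    · push Not at hj
      simp [hj]
  · push Not at hi
    simp [hi]

end VectorRep

section VectorRepMatrix

variable {F : Type} [Field F] {N : ℕ}

/-- The generators `t_ij` in the vector representation. -/
def vecT (q : F) (N : ℕ) : Matrix (Fin N) (Fin N) (Matrix (Fin N) (Fin N) F) :=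
  Matrix.of fun i j => Matrix.of fun a b => Rtil F q N (i, a) (j, b)

/-- The generators `t̄_ij` in the vector representation. -/
def vecTb (q : F) (N : ℕ) : Matrix (Fin N) (Fin N) (Matrix (Fin N) (Fin N) F) :=
  Matrix.of fun i j => Matrix.of fun a b => Rc F q N (i, a) (j, b)

theorem mul_vecT_apply (q : F) (M : Matrix (Fin N) (Fin N) F) (j l a b : Fin N) :
    (M * vecT q N j l) a b = rowAct q⁻¹ 0 (q⁻¹ - q) j l b (M a) := by
  rw [Matrix.mul_apply]
  simp only [vecT, Rtil, Matrix.of_apply, Prod.mk.injEq, mul_add, Finset.sum_add_distrib, rowAct]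
  congr 1
  · rw [Finset.sum_eq_single b]
    · by_cases h : j = l <;> simp [h, mul_comm]
    · intro c _ hc
      simp [hc]
    · simp
  · rw [Finset.sum_eq_single l]
    · rcases lt_trichotomy j l with h | h | h
      · simp [h, h.not_gt]
      · simp [h]
      · by_cases hb : j = b
        · subst hb
          simp [h, h.not_gt, mul_comm]
        · simp [hb]
    · intro c _ hc
      simp [hc]
    · simp

theorem mul_vecTb_apply (q : F) (M : Matrix (Fin N) (Fin N) F) (j l a b : Fin N) :
    (M * vecTb q N j l) a b = rowAct q (q - q⁻¹) 0 j l b (M a) := by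
  rw [Matrix.mul_apply]
  simp only [vecTb, Rc, Matrix.of_apply, Prod.mk.injEq, mul_add, Finset.sum_add_distrib, rowAct]
  congr 1
  · rw [Finset.sum_eq_single b]
    · by_cases h : j = l <;> simp [h, mul_comm]
    · intro c _ hc
      simp [hc]
    · simp
  · rw [Finset.sum_eq_single l]
    · rcases lt_trichotomy j l with h | h | h
      · by_cases hb : j = b <;> simp [h, hb, mul_comm]
      · simp [h]
      · simp [h, h.not_gt]
    · intro c _ hc
      simp [hc]
    · simp

theorem isGlSolution_vec {q : F} (hq : q ≠ 0) (N : ℕ) :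
    IsGlSolution q (vecT q N) (vecTb q N) := by
  have aT : ∀ i k a, vecT q N i k a =
      fun b => rowAct q⁻¹ 0 (q⁻¹ - q) i k b ((1 : Matrix (Fin N) (Fin N) F) a) := by
    intro i k a
    ext b
    rw [← mul_vecT_apply, one_mul]
  have aB : ∀ i k a, vecTb q N i k a =
      fun b => rowAct q (q - q⁻¹) 0 i k b ((1 : Matrix (Fin N) (Fin N) F) a) := by
    intro i k a
    ext b
    rw [← mul_vecTb_apply, one_mul]
  refine ⟨fun i j h => ?_, fun i j h => ?_, fun i => ?_, fun i => ?_, fun i j k l => ?_,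
    fun i j k l => ?_, fun i j k l => ?_⟩
  · ext a b
    simp [aT, rowAct, h.ne, h]
  · ext a b
    simp [aB, rowAct, h.ne', h, h.not_gt]
  · ext a b
    rw [mul_vecTb_apply, aT]
    by_cases h : i = b <;> simp [rowAct, h, hq]
  · ext a b
    rw [mul_vecT_apply, aB]
    by_cases h : i = b <;> simp [rowAct, h, hq]
  · ext a b
    simp only [Matrix.add_apply, Matrix.smul_apply, mul_vecT_apply, aT, smul_eq_mul]
    exact (isRowRTT hq i j k l b _).2.1
  · ext a b
    simp only [Matrix.add_apply, Matrix.smul_apply, mul_vecTb_apply, aB, smul_eq_mul]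
    exact (isRowRTT hq i j k l b _).1
  · ext a b
    simp only [Matrix.add_apply, Matrix.smul_apply, mul_vecTb_apply, mul_vecT_apply, aB, aT,
      smul_eq_mul]
    exact (isRowRTT hq i j k l b _).2.2

end VectorRepMatrix

section ResidueTrace

open scoped Kronecker

variable {O K : Type} [CommRing O] [Field K] (ρ : O →+* K)
variable {m ι P : Type} [Fintype m] [Fintype ι]

/-- The functional `M ↦ Σ φ_ab ρ(M_ab)` on matrices. -/
def resTr (φ : Matrix m m K) (M : Matrix m m O) : K := ∑ a, ∑ b, φ a b * ρ (M a b)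

variable {ρ}

theorem resTr_add (φ : Matrix m m K) (M M' : Matrix m m O) :
    resTr ρ φ (M + M') = resTr ρ φ M + resTr ρ φ M' := by
  simp [resTr, mul_add, Finset.sum_add_distrib]

theorem resTr_smul (φ : Matrix m m K) (c : O) (M : Matrix m m O) :
    resTr ρ φ (c • M) = ρ c * resTr ρ φ M := by
  simp [resTr, Finset.mul_sum, mul_left_comm]

theorem resTr_sum {α : Type} (φ : Matrix m m K) (s : Finset α) (M : α → Matrix m m O) :
    resTr ρ φ (∑ x ∈ s, M x) = ∑ x ∈ s, resTr ρ φ (M x) := by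
  classical
  induction s using Finset.induction_on with
  | empty => simp [resTr]
  | insert a s ha ih => rw [Finset.sum_insert ha, Finset.sum_insert ha, resTr_add, ih]

theorem resTr_kronecker (φ : Matrix m m K) (ψ : Matrix ι ι K) (M : Matrix m m O)
    (M' : Matrix ι ι O) :
    resTr ρ (φ ⊗ₖ ψ) (M ⊗ₖ M') = resTr ρ φ M * resTr ρ ψ M' := by
  simp only [resTr, Fintype.sum_prod_type, Matrix.kroneckerMap_apply, map_mul]
  simp only [Finset.sum_mul_sum]
  refine Finset.sum_congr rfl fun a _ => Finset.sum_congr rfl fun x _ =>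
    Finset.sum_congr rfl fun b _ => Finset.sum_congr rfl fun y _ => mul_mul_mul_comm _ _ _ _

variable [DecidableEq m] [DecidableEq ι]

theorem resTr_prod_kronecker {π : O} (hπ : ρ π = 0) {φ : Matrix m m K} {ψ : Matrix ι ι K}
    (hφ : resTr ρ φ 1 = 0) {s : P → Matrix ι ι O} {Y : P → Matrix m m O}
    (R : P → Matrix (m × ι) (m × ι) O) {d : ℕ} {ξ : P → K} (hY : ∀ p, resTr ρ φ (Y p) = ξ p)
    (hs : ∀ l : List P, l.length ≤ d → resTr ρ ψ (l.map s).prod =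
      if l.length = d then d.factorial * (l.map ξ).prod else 0)
    (l : List P) (hl : l.length ≤ d + 1) :
    resTr ρ (φ ⊗ₖ ψ) (l.map fun p => 1 ⊗ₖ s p + Y p ⊗ₖ 1 + π • R p).prod =
      if l.length = d + 1 then (d + 1).factorial * (l.map ξ).prod else 0 := by
  set t : P → Matrix (m × ι) (m × ι) O := fun p => 1 ⊗ₖ s p + Y p ⊗ₖ 1 + π • R p
  have expand : ∀ (A : Matrix m m O) (us : List P) (p : P) (ps : List P),
      resTr ρ (φ ⊗ₖ ψ) ((A ⊗ₖ (us.map s).prod) * ((p :: ps).map t).prod) =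
        resTr ρ (φ ⊗ₖ ψ) ((A ⊗ₖ ((us ++ [p]).map s).prod) * (ps.map t).prod) +
        resTr ρ (φ ⊗ₖ ψ) (((A * Y p) ⊗ₖ (us.map s).prod) * (ps.map t).prod) := by
    intro A us p ps
    have : (A ⊗ₖ (us.map s).prod) * ((p :: ps).map t).prod =
        (A ⊗ₖ ((us ++ [p]).map s).prod) * (ps.map t).prod +
        ((A * Y p) ⊗ₖ (us.map s).prod) * (ps.map t).prod +
        π • ((A ⊗ₖ (us.map s).prod) * R p * (ps.map t).prod) := by
      rw [List.map_cons, List.prod_cons, ← mul_assoc]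
      simp only [t, mul_add, add_mul, ← Matrix.mul_kronecker_mul, mul_one, List.map_append,
        List.prod_append, List.map_singleton, List.prod_singleton, mul_smul_comm, smul_mul_assoc]
    rw [this, resTr_add, resTr_add, resTr_smul, hπ, zero_mul, add_zero]
  have key : ∀ (ps : List P) (A : Matrix m m O) (us : List P), us.length + ps.length ≤ d →
      resTr ρ (φ ⊗ₖ ψ) ((A ⊗ₖ (us.map s).prod) * (ps.map t).prod) =
        resTr ρ φ A * if us.length + ps.length = d then
          d.factorial * ((us.map ξ).prod * (ps.map ξ).prod) else 0 := by
    intro ps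
    induction ps with
    | nil =>
      intro A us h
      rw [List.map_nil, List.prod_nil, mul_one, resTr_kronecker, hs us h]
      simp
    | cons p ps ih =>
      intro A us h
      rw [List.length_cons] at h
      rw [expand, ih _ _ (by simp; omega), ih _ _ (by omega)]
      rw [if_neg (show ¬ us.length + ps.length = d by omega), mul_zero, add_zero]
      simp [add_right_comm us.length 1, add_assoc, mul_assoc]
  have key2 : ∀ (ps us : List P), us.length + ps.length ≤ d + 1 →
      resTr ρ (φ ⊗ₖ ψ) ((1 ⊗ₖ (us.map s).prod) * (ps.map t).prod) =
        if us.length + ps.length = d + 1 then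
          ps.length * d.factorial * ((us.map ξ).prod * (ps.map ξ).prod) else 0 := by
    intro ps
    induction ps with
    | nil =>
      intro us h
      rw [List.map_nil, List.prod_nil, mul_one, resTr_kronecker, hφ]
      simp
    | cons p ps ih =>
      intro us h
      rw [List.length_cons] at h
      rw [expand, ih _ (by simp; omega), key _ _ _ (by omega), one_mul, hY]
      simp only [List.length_append, List.length_cons, List.length_nil, List.map_append,
        List.prod_append, List.map_cons, List.prod_cons, List.map_nil, List.prod_nil, mul_one]
      by_cases h' : us.length + ps.length = d
      · rw [if_pos (by omega), if_pos h', if_pos (by omega)]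
        push_cast
        ring
      · rw [if_neg (by omega), if_neg h', if_neg (by omega)]
        ring
  have := key2 l [] (by simpa using hl)
  rw [List.map_nil, List.prod_nil, Matrix.one_kronecker_one, one_mul] at this
  rw [this]
  simp only [List.length_nil, zero_add, List.map_nil, List.prod_nil, one_mul]
  split_ifs with h
  · rw [h, Nat.factorial_succ]
    push_cast
    ring
  · rfl

end ResidueTrace

section Constant

/-- The entries of the constant solution `G`. -/
def gSp {O : Type} [CommRing O] (p : O) {N : ℕ} (i j : Fin N) : O :=
  if i.val % 2 = 0 ∧ j.val = i.val + 1 then p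
  else if j.val % 2 = 0 ∧ i.val = j.val + 1 then -1 else 0

variable {F : Type} [Field F] {n : ℕ}

theorem gSp_fe_fe {O : Type} [CommRing O] (p : O) (a b : Fin n) : gSp p (fe n a) (fe n b) = 0 := by
  have ve : ∀ k, (fe n k).val = 2 * k.val := fun _ => rfl
  rw [gSp, ve, ve, if_neg (by omega), if_neg (by omega)]

theorem gSp_fo_fo {O : Type} [CommRing O] (p : O) (a b : Fin n) : gSp p (fo n a) (fo n b) = 0 := by
  have vo : ∀ k, (fo n k).val = 2 * k.val + 1 := fun _ => rfl
  rw [gSp, vo, vo, if_neg (by omega), if_neg (by omega)]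

theorem gSp_fe_fo {O : Type} [CommRing O] (p : O) (a b : Fin n) :
    gSp p (fe n a) (fo n b) = if a = b then p else 0 := by
  have ve : ∀ k, (fe n k).val = 2 * k.val := fun _ => rfl
  have vo : ∀ k, (fo n k).val = 2 * k.val + 1 := fun _ => rfl
  rw [gSp, ve, vo]
  split_ifs <;> first | rfl | (exfalso; omega)

theorem gSp_fo_fe {O : Type} [CommRing O] (p : O) (a b : Fin n) :
    gSp p (fo n a) (fe n b) = if a = b then -1 else 0 := by
  have ve : ∀ k, (fe n k).val = 2 * k.val := fun _ => rfl
  have vo : ∀ k, (fo n k).val = 2 * k.val + 1 := fun _ => rfl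
  rw [gSp, ve, vo]
  split_ifs <;> first | rfl | (exfalso; omega)

theorem exists_eq_fe_or_fo (i : Fin (2 * n)) : ∃ k, i = fe n k ∨ i = fo n k := by
  refine ⟨⟨i.val / 2, by omega⟩, ?_⟩
  have ve : (fe n ⟨i.val / 2, by omega⟩).val = 2 * (i.val / 2) := rfl
  have vo : (fo n ⟨i.val / 2, by omega⟩).val = 2 * (i.val / 2) + 1 := rfl
  omega

set_option maxHeartbeats 4000000 in
theorem gSp_reflection {q : F} (hq : q ≠ 0) (i j k l : Fin (2 * n)) :
    (if i = j then q else 1) * ((if k = j then q else 1) * (gSp q i k * gSp q j l)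
        + (if k < j then q - q⁻¹ else 0) * (gSp q i j * gSp q k l))
      + (if i < j then q - q⁻¹ else 0) * ((if k = i then q else 1) * (gSp q j k * gSp q i l)
        + (if k < i then q - q⁻¹ else 0) * (gSp q j i * gSp q k l)) =
      (if k = l then q else 1) * ((if i = l then q else 1) * (gSp q j l * gSp q i k)
        + (if l < i then q - q⁻¹ else 0) * (gSp q j i * gSp q l k))
      + (if l < k then q - q⁻¹ else 0) * ((if i = k then q else 1) * (gSp q j k * gSp q i l)
        + (if k < i then q - q⁻¹ else 0) * (gSp q j i * gSp q k l)) := by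
  have hqi : q * q⁻¹ = 1 := mul_inv_cancel₀ hq
  generalize q⁻¹ = p at *
  have ve : ∀ k, (fe n k).val = 2 * k.val := fun _ => rfl
  have vo : ∀ k, (fo n k).val = 2 * k.val + 1 := fun _ => rfl
  have e1 : ∀ a b, (fe n a = fe n b) ↔ a = b := fun a b => by rw [Fin.ext_iff, ve, ve]; omega
  have e2 : ∀ a b, (fo n a = fo n b) ↔ a = b := fun a b => by rw [Fin.ext_iff, vo, vo]; omega
  have e3 : ∀ a b, (fe n a = fo n b) ↔ False := fun a b =>
    iff_false_intro (by rw [Fin.ext_iff, ve, vo]; omega)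
  have e4 : ∀ a b, (fo n a = fe n b) ↔ False := fun a b =>
    iff_false_intro (by rw [Fin.ext_iff, vo, ve]; omega)
  have l1 : ∀ a b, (fe n a < fe n b) ↔ a < b := fun a b => by rw [Fin.lt_def, ve, ve]; omega
  have l2 : ∀ a b, (fo n a < fo n b) ↔ a < b := fun a b => by rw [Fin.lt_def, vo, vo]; omega
  have l3 : ∀ a b, (fe n a < fo n b) ↔ a ≤ b := fun a b => by rw [Fin.lt_def, ve, vo]; omega
  have l4 : ∀ a b, (fo n a < fe n b) ↔ a < b := fun a b => by rw [Fin.lt_def, vo, ve]; omega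
  obtain ⟨a, rfl | rfl⟩ := exists_eq_fe_or_fo i <;> obtain ⟨b, rfl | rfl⟩ := exists_eq_fe_or_fo j <;>
    obtain ⟨c, rfl | rfl⟩ := exists_eq_fe_or_fo k <;>
    obtain ⟨d, rfl | rfl⟩ := exists_eq_fe_or_fo l <;>
    simp only [gSp_fe_fe, gSp_fo_fo, mul_zero, zero_mul, add_zero] <;>
    simp only [gSp_fe_fo, gSp_fo_fe, e1, e2, e3, e4, l1, l2, l3, l4, if_false, zero_add,
      one_mul] <;> grind

end Constant

section Map

variable {F : Type} [Field F] {q : F} {N n : ℕ} {A B : Type} [Ring A] [Algebra F A] [Ring B]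
  [Algebra F B]

theorem IsRTT.map {X Y : Matrix (Fin N) (Fin N) A} (h : IsRTT q X Y) (f : A →ₐ[F] B) :
    IsRTT q (X.map f) (Y.map f) := by
  intro i j k l
  have := congrArg f (h i j k l)
  simpa only [map_add, map_smul, map_mul, Matrix.map_apply] using this

theorem IsGlSolution.map {T Tb : Matrix (Fin N) (Fin N) A} (h : IsGlSolution q T Tb)
    (f : A →ₐ[F] B) : IsGlSolution q (T.map f) (Tb.map f) where
  lower i j hij := by rw [Matrix.map_apply, h.lower i j hij, map_zero]
  upper i j hij := by rw [Matrix.map_apply, h.upper i j hij, map_zero]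
  mul_bar i := by rw [Matrix.map_apply, Matrix.map_apply, ← map_mul, h.mul_bar, map_one]
  bar_mul i := by rw [Matrix.map_apply, Matrix.map_apply, ← map_mul, h.bar_mul, map_one]
  rtt := h.rtt.map f
  rbb := h.rbb.map f
  rbt := h.rbt.map f

theorem IsSpSolution.map {S : Matrix (Fin (2 * n)) (Fin (2 * n)) A} {sI : Fin n → A}
    (h : IsSpSolution F q S sI) (f : A →ₐ[F] B) : IsSpSolution F q (S.map f) (fun k => f (sI k)) where
  tri i j hij h' := by rw [Matrix.map_apply, h.tri i j hij h', map_zero]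
  quad k := by
    simp only [Matrix.map_apply, ← map_mul, h.quad, map_add, map_smul, AlgHom.commutes]
  invR k := by rw [Matrix.map_apply, ← map_mul, h.invR, map_one]
  invL k := by rw [Matrix.map_apply, ← map_mul, h.invL, map_one]
  refl := by
    ext ⟨i, j⟩ ⟨k, l⟩
    have := congrFun (congrFun h.refl (i, j)) (k, l)
    rw [← (AlgHom.map_liftF_mul F q f S i j k l).1, this, (AlgHom.map_liftF_mul F q f S i j k l).2]

end Map

section Kronecker

open scoped Kronecker

theorem kronecker_map_algebraMap {R m ι F : Type} [CommRing R] [Field F] [Algebra R F]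
    (A : Matrix m m R) (B : Matrix ι ι R) :
    (A ⊗ₖ B).map (algebraMap R F) = A.map (algebraMap R F) ⊗ₖ B.map (algebraMap R F) := by
  ext ⟨a, x⟩ ⟨b, y⟩
  simp

variable {R m ι : Type} [CommRing R] [Fintype m] [DecidableEq m] [Fintype ι] [DecidableEq ι]

/-- `A ↦ A ⊗ 1` on matrices. -/
def kronLeft (R m ι : Type) [CommRing R] [Fintype m] [DecidableEq m] [Fintype ι] [DecidableEq ι] :
    Matrix m m R →ₐ[R] Matrix (m × ι) (m × ι) R :=
  AlgHom.ofLinearMap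
    { toFun := fun A => A ⊗ₖ 1
      map_add' := fun A B => Matrix.add_kronecker A B 1
      map_smul' := fun c A => Matrix.smul_kronecker c A 1 }
    Matrix.one_kronecker_one
    fun A B => by simp [← Matrix.mul_kronecker_mul]

/-- `B ↦ 1 ⊗ B` on matrices. -/
def kronRight (R m ι : Type) [CommRing R] [Fintype m] [DecidableEq m] [Fintype ι] [DecidableEq ι] :
    Matrix ι ι R →ₐ[R] Matrix (m × ι) (m × ι) R :=
  AlgHom.ofLinearMap
    { toFun := fun A => 1 ⊗ₖ A
      map_add' := fun A B => Matrix.kronecker_add 1 A B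
      map_smul' := fun c A => Matrix.kronecker_smul c 1 A }
    Matrix.one_kronecker_one
    fun A B => by simp [← Matrix.mul_kronecker_mul]

theorem kronLeft_apply (A : Matrix m m R) : kronLeft R m ι A = A ⊗ₖ 1 := rfl

theorem kronRight_apply (A : Matrix ι ι R) : kronRight R m ι A = 1 ⊗ₖ A := rfl

theorem kron_commute (A : Matrix ι ι R) (B : Matrix m m R) :
    Commute (kronRight R m ι A) (kronLeft R m ι B) := by
  rw [Commute, SemiconjBy, kronLeft_apply, kronRight_apply, ← Matrix.mul_kronecker_mul,
    ← Matrix.mul_kronecker_mul]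
  simp

end Kronecker

section FirstOrder

open scoped Kronecker

variable {O F : Type} [CommRing O] [Field F] [Algebra O F] {N n : ℕ}

/-- `t_ij = δ_ij + (q - 1) τ_ij` in the vector representation. -/
def tauT (p p' : O) (N : ℕ) (i j : Fin N) : Matrix (Fin N) (Fin N) O := Matrix.of fun a b =>
  (if i = j ∧ a = b ∧ i = a then -p' else 0)
    + if i = b ∧ a = j ∧ a < i then -(p' * (p + 1)) else 0

/-- `t̄_ij = δ_ij + (q - 1) τ̄_ij` in the vector representation. -/
def tauB (p p' : O) (N : ℕ) (i j : Fin N) : Matrix (Fin N) (Fin N) O := Matrix.of fun a b =>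
  (if i = j ∧ a = b ∧ i = a then 1 else 0)
    + if i = b ∧ a = j ∧ i < a then p' * (p + 1) else 0

variable {p p' : O}

theorem inv_algebraMap_eq (hp : p * p' = 1) : (algebraMap O F p)⁻¹ = algebraMap O F p' :=
  inv_eq_of_mul_eq_one_right (by rw [← map_mul, hp, map_one])

theorem vecT_eq_map (hp : p * p' = 1) (i j : Fin N) : vecT (algebraMap O F p) N i j =
    ((if i = j then 1 else 0) + (p - 1) • tauT p p' N i j).map (algebraMap O F) := by
  have e1 : p' = 1 + (p - 1) * -p' := by linear_combination hp
  have e2 : p' - p = (p - 1) * -(p' * (p + 1)) := by linear_combination p * hp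
  ext a b
  simp only [vecT, Rtil, tauT, Matrix.of_apply, Prod.mk.injEq, inv_algebraMap_eq hp,
    Matrix.map_apply, Matrix.add_apply, Matrix.smul_apply, smul_eq_mul, ← map_sub]
  by_cases h : i = j ∧ a = b
  · obtain ⟨rfl, rfl⟩ := h
    rw [if_neg (show ¬(i = a ∧ a = i ∧ a < i) by omega),
      if_neg (show ¬(i = a ∧ a = i ∧ a < i) by omega), if_pos ⟨rfl, rfl⟩, if_pos rfl]
    by_cases h' : i = a
    · rw [if_pos h', if_pos ⟨rfl, rfl, h'⟩, add_zero, add_zero, Matrix.one_apply_eq, ← e1]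
    · rw [if_neg h', if_neg (by tauto)]
      simp
  · have h1 : (if i = j then (1 : Matrix (Fin N) (Fin N) O) else 0) a b = 0 := by
      by_cases hij : i = j
      · rw [if_pos hij, Matrix.one_apply_ne (by tauto)]
      · rw [if_neg hij, Matrix.zero_apply]
    rw [if_neg h, if_neg (show ¬(i = j ∧ a = b ∧ i = a) by tauto), h1, zero_add, zero_add, zero_add]
    split_ifs
    · rw [e2]
    · simp

theorem vecTb_eq_map (hp : p * p' = 1) (i j : Fin N) : vecTb (algebraMap O F p) N i j =
    ((if i = j then 1 else 0) + (p - 1) • tauB p p' N i j).map (algebraMap O F) := by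
  have e1 : p = 1 + (p - 1) * 1 := by ring
  have e2 : p - p' = (p - 1) * (p' * (p + 1)) := by linear_combination -p * hp
  ext a b
  simp only [vecTb, Rc, tauB, Matrix.of_apply, Prod.mk.injEq, inv_algebraMap_eq hp,
    Matrix.map_apply, Matrix.add_apply, Matrix.smul_apply, smul_eq_mul, ← map_sub]
  by_cases h : i = j ∧ a = b
  · obtain ⟨rfl, rfl⟩ := h
    rw [if_neg (show ¬(i = a ∧ a = i ∧ i < a) by omega),
      if_neg (show ¬(i = a ∧ a = i ∧ i < a) by omega), if_pos ⟨rfl, rfl⟩, if_pos rfl]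
    by_cases h' : i = a
    · rw [if_pos h', if_pos ⟨rfl, rfl, h'⟩, add_zero, add_zero, Matrix.one_apply_eq, ← e1]
    · rw [if_neg h', if_neg (by tauto)]
      simp
  · have h1 : (if i = j then (1 : Matrix (Fin N) (Fin N) O) else 0) a b = 0 := by
      by_cases hij : i = j
      · rw [if_pos hij, Matrix.one_apply_ne (by tauto)]
      · rw [if_neg hij, Matrix.zero_apply]
    rw [if_neg h, if_neg (show ¬(i = j ∧ a = b ∧ i = a) by tauto), h1, zero_add, zero_add, zero_add]
    split_ifs
    · rw [e2]
    · simp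

end FirstOrder

section Existence

open scoped Kronecker

variable {O F K : Type} [CommRing O] [Field F] [Field K] [Algebra O F] {n : ℕ}

/-- `t_ia t̄_jb = δ_ia δ_jb + (q - 1) w` in the vector representation. -/
def wMat (p p' : O) {N : ℕ} (i j a b : Fin N) : Matrix (Fin N) (Fin N) O :=
  (if j = b then tauT p p' N i a else 0) + (if i = a then tauB p p' N j b else 0) +
    (p - 1) • (tauT p p' N i a * tauB p p' N j b)

/-- The first-order part of the coaction on the constant solution `G`. -/
def yMat (p p' : O) {N : ℕ} (i j : Fin N) : Matrix (Fin N) (Fin N) O :=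
  ∑ b, ∑ a, gSp p a b • wMat p p' i j a b

theorem vecT_mul_vecTb_eq_map {p p' : O} (hp : p * p' = 1) {N : ℕ} (i j a b : Fin N) :
    vecT (algebraMap O F p) N i a * vecTb (algebraMap O F p) N j b =
      ((if i = a ∧ j = b then 1 else 0) + (p - 1) • wMat p p' i j a b).map (algebraMap O F) := by
  rw [vecT_eq_map hp, vecTb_eq_map hp, ← Matrix.map_mul]
  congr 1
  rw [wMat]
  by_cases h1 : i = a <;> by_cases h2 : j = b <;>
    simp only [h1, h2, if_true, if_false, and_true, and_false, and_self, zero_add, add_mul, mul_add,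
      one_mul, mul_one, smul_mul_smul_comm, smul_add, smul_smul, add_zero, add_assoc]

theorem isSpSolution_gSp {q : F} (hq : q ≠ 0) {A : Type} [Ring A] [Algebra F A] :
    IsSpSolution F q (Matrix.of fun i j => algebraMap F A (gSp q (i : Fin (2 * n)) j))
      (fun _ : Fin n => algebraMap F A q⁻¹) where
  tri i j hij h' := by
    rw [Matrix.of_apply, gSp, if_neg h', if_neg (by omega), map_zero]
  quad k := by
    simp only [Matrix.of_apply, gSp_fe_fe, gSp_fo_fo, gSp_fe_fo, gSp_fo_fe, if_true]
    simp only [Algebra.smul_def, ← map_mul, ← map_add]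
    congr 1
    ring
  invR k := by
    simp only [Matrix.of_apply, gSp_fe_fo, if_true]
    rw [← map_mul, mul_inv_cancel₀ hq, map_one]
  invL k := by
    simp only [Matrix.of_apply, gSp_fe_fo, if_true]
    rw [← map_mul, inv_mul_cancel₀ hq, map_one]
  refl := by
    ext ⟨i, j⟩ ⟨k, l⟩
    rw [reflLHS_apply, reflRHS_apply]
    simp only [Matrix.of_apply, Algebra.smul_def, ← map_mul, ← map_add]
    rw [gSp_reflection hq]

theorem algebraMap_gSp (p : O) {N : ℕ} (i j : Fin N) :
    algebraMap O F (gSp p i j) = gSp (algebraMap O F p) i j := by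
  simp only [gSp]
  split_ifs <;> simp

theorem sum_wMat_kronecker (p p' : O) {N : ℕ} {ι : Type} [DecidableEq ι]
    (s : Fin N × Fin N → Matrix ι ι O) (i j : Fin N) :
    ∑ b, ∑ a, ((if i = a ∧ j = b then 1 else 0) + (p - 1) • wMat p p' i j a b) ⊗ₖ
        (gSp p a b • 1 + (p - 1) • s (a, b)) =
      gSp p i j • 1 + (p - 1) • (1 ⊗ₖ s (i, j) + yMat p p' i j ⊗ₖ 1 +
        (p - 1) • ∑ b, ∑ a, wMat p p' i j a b ⊗ₖ s (a, b)) := by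
  have e : ∀ X : Fin N → Fin N → Matrix ι ι O,
      ∑ b, ∑ a, (if i = a ∧ j = b then 1 else 0 : Matrix (Fin N) (Fin N) O) ⊗ₖ X a b =
        1 ⊗ₖ X i j := by
    intro X
    rw [Finset.sum_eq_single j, Finset.sum_eq_single i]
    · simp
    · intro a _ ha
      simp [ha.symm]
    · simp
    · intro b _ hb
      simp [hb.symm]
    · simp
  have e2 : yMat p p' i j ⊗ₖ (1 : Matrix ι ι O) =
      ∑ b, ∑ a, gSp p a b • (wMat p p' i j a b ⊗ₖ (1 : Matrix ι ι O)) := by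
    ext ⟨a, x⟩ ⟨b, y⟩
    simp [yMat, Matrix.sum_apply, Finset.sum_mul, mul_assoc]
  simp only [Matrix.add_kronecker, Finset.sum_add_distrib]
  rw [e, e2]
  simp only [Matrix.kronecker_add, Matrix.kronecker_smul, Matrix.smul_kronecker,
    Matrix.one_kronecker_one, smul_add, Finset.sum_add_distrib, Finset.smul_sum,
    smul_comm (p - 1) (gSp p _ _)]
  abel

theorem isSpSolution_step {p p' : O} (hp : p * p' = 1) (hF : algebraMap O F p ≠ 0)
    {ι : Type} [Fintype ι] [DecidableEq ι] (s : Fin (2 * n) × Fin (2 * n) → Matrix ι ι O)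
    {sI : Fin n → Matrix ι ι F} (h : IsSpSolution F (algebraMap O F p) (Matrix.of fun i j =>
      (gSp p i j • (1 : Matrix ι ι O) + (p - 1) • s (i, j)).map (algebraMap O F)) sI) :
    IsSpSolution F (algebraMap O F p) (Matrix.of fun i j =>
      (gSp p i j • 1 + (p - 1) • (1 ⊗ₖ s (i, j) + yMat p p' i j ⊗ₖ 1 +
        (p - 1) • ∑ b, ∑ a, wMat p p' i j a b ⊗ₖ s (a, b))).map (algebraMap O F))
      (fun k => kronRight F (Fin (2 * n)) ι (sI k) *
        (vecT (algebraMap O F p) (2 * n)).map (kronLeft F (Fin (2 * n)) ι) (fo n k) (fo n k) *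
        (vecTb (algebraMap O F p) (2 * n)).map (kronLeft F (Fin (2 * n)) ι) (fe n k) (fe n k)) := by
  have key := (h.map (kronRight F (Fin (2 * n)) ι)).coaction hF
    ((isGlSolution_vec hF (2 * n)).map (kronLeft F (Fin (2 * n)) ι))
    (fun i j k l => kron_commute _ _) (fun i j k l => kron_commute _ _)
    (fun i k l => kron_commute _ _) (fun i k l => kron_commute _ _)
  convert key using 1
  ext1 i j
  rw [coaction_apply fun i j k l => kron_commute _ _]
  simp only [Matrix.map_apply, Matrix.of_apply, mul_assoc, ← map_mul,
    vecT_mul_vecTb_eq_map hp]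
  simp only [kronLeft_apply, kronRight_apply, ← Matrix.mul_kronecker_mul, one_mul, mul_one,
    ← kronecker_map_algebraMap]
  rw [← sum_wMat_kronecker]
  simp only [← RingHom.mapMatrix_apply, map_sum]

theorem exists_isSpSolution {p p' : O} (hp : p * p' = 1) (hF : algebraMap O F p ≠ 0)
    {ρ : O →+* K} (hρ : ρ p = 1) {φ : Matrix (Fin (2 * n)) (Fin (2 * n)) K}
    (hφ : resTr ρ φ 1 = 0) (d : ℕ) :
    ∃ (ι : Type) (_ : Fintype ι) (_ : DecidableEq ι)
      (s : Fin (2 * n) × Fin (2 * n) → Matrix ι ι O) (sI : Fin n → Matrix ι ι F) (ψ : Matrix ι ι K),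
      IsSpSolution F (algebraMap O F p) (Matrix.of fun i j =>
        (gSp p i j • (1 : Matrix ι ι O) + (p - 1) • s (i, j)).map (algebraMap O F)) sI ∧
      ∀ l : List (Fin (2 * n) × Fin (2 * n)), l.length ≤ d → resTr ρ ψ (l.map s).prod =
        if l.length = d then
          d.factorial * (l.map fun x => resTr ρ φ (yMat p p' x.1 x.2)).prod else 0 := by
  have hπ : ρ (p - 1) = 0 := by rw [map_sub, hρ, map_one, sub_self]
  induction d with
  | zero =>
    refine ⟨Unit, inferInstance, inferInstance, fun _ => 0,
      fun _ => algebraMap F _ (algebraMap O F p)⁻¹, 1, ?_, ?_⟩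
    · convert isSpSolution_gSp (n := n) hF (A := Matrix Unit Unit F) using 1
      ext i j a b
      simp [Matrix.algebraMap_matrix_apply, algebraMap_gSp]
    · intro l hl
      obtain rfl : l = [] := by simpa using hl
      simp [resTr]
  | succ d ih =>
    obtain ⟨ι, _, _, s, sI, ψ, h, hψ⟩ := ih
    let r (x : Fin (2 * n) × Fin (2 * n)) : Matrix (Fin (2 * n) × ι) (Fin (2 * n) × ι) O :=
      ∑ b, ∑ a, wMat p p' x.1 x.2 a b ⊗ₖ s (a, b)
    exact ⟨Fin (2 * n) × ι, instFintypeProd _ _, instDecidableEqProd, _, _, φ ⊗ₖ ψ,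
      isSpSolution_step hp hF s h, resTr_prod_kronecker hπ hφ r (fun _ => rfl) hψ⟩

end Existence

section FirstOrderValues

variable {O K : Type} [CommRing O] [Field K] {n : ℕ}

/-- The involution `i ↦ i'`. -/
def mate {n : ℕ} (i : Fin (2 * n)) : Fin (2 * n) :=
  ⟨if i.val % 2 = 0 then i.val + 1 else i.val - 1, by split_ifs <;> omega⟩

/-- The sign of the position `i` in the symplectic form. -/
def sgnSp (K : Type) [Field K] {N : ℕ} (i : Fin N) : K := if i.val % 2 = 0 then 1 else -1

theorem val_mate (i : Fin (2 * n)) :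
    (mate i).val = if i.val % 2 = 0 then i.val + 1 else i.val - 1 := rfl

theorem mate_mate (i : Fin (2 * n)) : mate (mate i) = i := by
  ext
  rw [val_mate, val_mate]
  split_ifs <;> omega

theorem sgnSp_mate (i : Fin (2 * n)) : sgnSp K (mate i) = -sgnSp K i := by
  rw [sgnSp, sgnSp, val_mate]
  split_ifs <;> first | (exfalso; omega) | simp

theorem sgnSp_mul_self (i : Fin (2 * n)) : sgnSp K i * sgnSp K i = 1 := by
  rw [sgnSp]
  split_ifs <;> simp

theorem map_gSp_mate {ρ : O →+* K} {p : O} (hρ : ρ p = 1) (a b : Fin (2 * n)) :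
    ρ (gSp p a b) = if a = mate b then sgnSp K a else 0 := by
  have e : a = mate b ↔ a.val = (mate b).val := Fin.ext_iff
  rw [val_mate] at e
  simp only [gSp, sgnSp, e]
  split_ifs <;> first | (exfalso; omega) | simp [hρ]

variable {ρ : O →+* K} {p p' : O}

theorem resTr_tauT (hρ : ρ p = 1) (hρ' : ρ p' = 1) (φ : Matrix (Fin n) (Fin n) K) (i j : Fin n) :
    resTr ρ φ (tauT p p' n i j) =
      -((if i = j then φ i i else 0) + 2 * if j < i then φ j i else 0) := by
  have e : ∀ a b, φ a b * ρ (tauT p p' n i j a b) =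
      (if a = i then if b = i then if i = j then -φ i i else 0 else 0 else 0) +
      (if a = j then if b = i then if j < i then -2 * φ j i else 0 else 0 else 0) := by
    intro a b
    simp only [tauT, Matrix.of_apply, map_add, apply_ite ρ, map_neg, map_mul, hρ, hρ', map_zero,
      map_one]
    grind
  simp only [resTr, e, Finset.sum_add_distrib, Finset.sum_ite_eq', Finset.mem_univ, if_true,
    Finset.sum_ite_irrel, Finset.sum_const_zero]
  split_ifs <;> ring

theorem resTr_tauB (hρ : ρ p = 1) (hρ' : ρ p' = 1) (φ : Matrix (Fin n) (Fin n) K) (i j : Fin n) :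
    resTr ρ φ (tauB p p' n i j) =
      (if i = j then φ i i else 0) + 2 * if i < j then φ j i else 0 := by
  have e : ∀ a b, φ a b * ρ (tauB p p' n i j a b) =
      (if a = i then if b = i then if i = j then φ i i else 0 else 0 else 0) +
      (if a = j then if b = i then if i < j then 2 * φ j i else 0 else 0 else 0) := by
    intro a b
    simp only [tauB, Matrix.of_apply, map_add, apply_ite ρ, map_mul, hρ, hρ', map_zero,
      map_one]
    grind
  simp only [resTr, e, Finset.sum_add_distrib, Finset.sum_ite_eq', Finset.mem_univ, if_true,
    Finset.sum_ite_irrel, Finset.sum_const_zero]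
  split_ifs <;> ring

theorem resTr_yMat (hρ : ρ p = 1) (hρ' : ρ p' = 1) (φ : Matrix (Fin (2 * n)) (Fin (2 * n)) K)
    (i j : Fin (2 * n)) :
    resTr ρ φ (yMat p p' i j) =
      sgnSp K j * ((if i = mate j then φ i i else 0) + 2 * if mate j < i then φ (mate j) i else 0)
      + sgnSp K i *
        ((if j = mate i then φ j j else 0) + 2 * if j < mate i then φ (mate i) j else 0) := by
  have e : ∀ a b, resTr ρ φ (gSp p a b • wMat p p' i j a b) =
      (if a = mate j then if b = j then -sgnSp K j * resTr ρ φ (tauT p p' (2 * n) i (mate j))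
        else 0 else 0) +
      (if b = mate i then if a = i then sgnSp K i * resTr ρ φ (tauB p p' (2 * n) j (mate i))
        else 0 else 0) := by
    intro a b
    have z : resTr ρ φ (0 : Matrix (Fin (2 * n)) (Fin (2 * n)) O) = 0 := by simp [resTr]
    have m : a = mate b ↔ b = mate a :=
      ⟨fun h => by rw [h, mate_mate], fun h => by rw [h, mate_mate]⟩
    rw [resTr_smul, wMat, resTr_add, resTr_add, resTr_smul, map_sub, hρ, map_one, sub_self,
      zero_mul, add_zero, apply_ite (resTr ρ φ), apply_ite (resTr ρ φ), z, map_gSp_mate hρ]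
    by_cases hm : a = mate b
    · subst hm
      rw [if_pos rfl, mul_add]
      congr 1
      · by_cases hb : j = b
        · subst hb
          simp [sgnSp_mate]
        · rw [if_neg hb, if_neg (Ne.symm hb), mul_zero, ite_self]
      · by_cases hb : i = mate b
        · subst hb
          simp [mate_mate]
        · rw [if_neg hb, if_neg (Ne.symm hb), mul_zero, ite_self]
    · rw [if_neg hm, zero_mul]
      have : ¬ (a = mate j ∧ b = j) := by rintro ⟨rfl, rfl⟩; exact hm rfl
      have : ¬ (b = mate i ∧ a = i) := by rintro ⟨rfl, rfl⟩; exact hm (mate_mate _).symm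
      grind
  rw [yMat, resTr_sum]
  simp only [resTr_sum, e, Finset.sum_add_distrib, Finset.sum_ite_eq', Finset.mem_univ, if_true,
    Finset.sum_ite_irrel, Finset.sum_const_zero, resTr_tauT hρ hρ', resTr_tauB hρ hρ']
  ring

/-- The positions of the independent generators. -/
def goodSp (n : ℕ) (x : Fin (2 * n) × Fin (2 * n)) : Prop :=
  (x.1.val % 2 = 0 ∧ x.2.val ≤ x.1.val + 1) ∨
    (x.1.val % 2 = 1 ∧ (x.2 = x.1 ∨ x.2.val + 2 ≤ x.1.val))

theorem exists_resTr_yMat_eq [CharZero K] (hρ : ρ p = 1) (hρ' : ρ p' = 1)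
    (ξ : Fin (2 * n) × Fin (2 * n) → K) :
    ∃ φ : Matrix (Fin (2 * n)) (Fin (2 * n)) K, resTr ρ φ 1 = 0 ∧
      ∀ x, goodSp n x → resTr ρ φ (yMat p p' x.1 x.2) = ξ x := by
  let c (a : Fin (2 * n)) : K := if a.val % 2 = 0 then ξ (a, mate a) else ξ (mate a, a)
  have hc : ∀ a, c (mate a) = c a := by
    intro a
    simp only [c, mate_mate, val_mate]
    split_ifs <;> first | rfl | (exfalso; omega)
  refine ⟨Matrix.of fun a b => if a = b then -(sgnSp K a * c a) / 2 else
    if a = mate b then sgnSp K b * ξ (b, b) / 2 else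
    if a < b then -(sgnSp K a * ξ (b, mate a)) / 2 else 0, ?_, ?_⟩
  · have e : ∀ a b : Fin (2 * n), ρ ((1 : Matrix (Fin (2 * n)) (Fin (2 * n)) O) a b) =
        if a = b then 1 else 0 := fun a b => by rw [Matrix.one_apply, apply_ite ρ]; simp
    simp only [resTr, e, mul_ite, mul_one, mul_zero, Finset.sum_ite_eq, Finset.mem_univ, if_true,
      Matrix.of_apply]
    refine Finset.sum_involution (fun a _ => mate a) ?_ ?_ (by simp) (fun a _ => mate_mate a)
    · intro a _
      rw [hc, sgnSp_mate]
      ring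
    · intro a _ _ h
      have := congrArg Fin.val h
      rw [val_mate] at this
      split_ifs at this <;> omega
  · rintro ⟨i, j⟩ h
    have s1 := sgnSp_mul_self (K := K) i
    have s2 := sgnSp_mul_self (K := K) j
    have m1 := sgnSp_mate (K := K) i
    have m2 := sgnSp_mate (K := K) j
    rw [resTr_yMat hρ hρ']
    simp only [Matrix.of_apply, mate_mate]
    simp only [goodSp] at h
    have vi := val_mate i
    have vj := val_mate j
    have c2 : (2 : K) ≠ 0 := two_ne_zero
    by_cases h1 : j = i
    · subst h1
      have n1 : j ≠ mate j := fun e => by have := congrArg Fin.val e; split_ifs at vj <;> omega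
      rw [if_neg n1, zero_add, if_neg n1.symm, if_pos rfl, zero_add]
      rcases Nat.mod_two_eq_zero_or_one j.val with hj | hj
      · rw [if_neg (by rw [if_pos hj] at vj; omega), if_pos (by rw [if_pos hj] at vj; omega)]
        linear_combination (ξ (j, j)) * s1
      · rw [if_pos (by rw [if_neg (by omega)] at vj; omega),
          if_neg (by rw [if_neg (by omega)] at vj; omega)]
        linear_combination (ξ (j, j)) * s1
    by_cases h2 : j = mate i
    · have h0 : i.val % 2 = 0 := by split_ifs at vi <;> omega
      subst h2
      simp only [mate_mate, if_true, lt_irrefl, if_false, hc, m1, c, if_pos h0]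
      linear_combination (ξ (i, mate i)) * s1
    have n1 : i ≠ mate j := fun e => h2 (by rw [e, mate_mate])
    have n2 : mate j ≠ mate i := fun e => h1 (by rw [← mate_mate j, e, mate_mate])
    have n3 : mate i ≠ mate j := fun e => n2 e.symm
    have l1 : mate j < i := by rw [Fin.lt_def]; split_ifs at vi vj <;> omega
    have l2 : ¬ mate i < j := by rw [Fin.lt_def]; split_ifs at vi vj <;> omega
    rw [if_neg n1, if_neg h2, if_pos l1, if_neg n2, if_pos l1, if_neg (Ne.symm h2), if_neg n3,
      if_neg l2, m2]
    rw [if_neg (Ne.symm n1), ite_self]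
    linear_combination (ξ (i, j)) * s2

end FirstOrderValues

section Specialization

open Polynomial IsDedekindDomain

theorem exists_valuationSubring : ∃ (V : ValuationSubring FF) (p p' : V), (p : FF) = qq ∧
    p * p' = 1 ∧ IsLocalRing.residue V p = 1 ∧ CharZero (IsLocalRing.ResidueField V) := by
  let v : HeightOneSpectrum ℂ[X] :=
    { asIdeal := Ideal.span {X - C 1}
      isPrime := (Ideal.span_singleton_prime (X_sub_C_ne_zero 1)).2 (prime_X_sub_C 1)
      ne_bot := by simpa using X_sub_C_ne_zero (1 : ℂ) }
  let V := (v.valuation FF).valuationSubring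
  have hV : ∀ x : FF, x ∈ V ↔ v.valuation FF x ≤ 1 := fun x => Iff.rfl
  let p : V := ⟨qq, by rw [hV, qq, ← RatFunc.algebraMap_X]; exact v.valuation_le_one X⟩
  let f : ℂ[X] →+* V := (algebraMap ℂ[X] FF).codRestrict V fun x => by
    exact (hV _).2 (v.valuation_le_one x)
  have fX : f X = p := by
    ext
    exact RatFunc.algebraMap_X
  have h1 : IsLocalRing.residue V p = 1 := by
    rw [← sub_eq_zero, ← map_one (IsLocalRing.residue V), ← map_sub, IsLocalRing.residue_eq_zero_iff]
    have : p - 1 = f (X - C 1) := by rw [map_sub, fX, C_1, map_one]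
    rw [this, Valuation.mem_maximalIdeal_iff]
    exact (v.valuation_lt_one_iff_mem _).2 (Ideal.mem_span_singleton_self _)
  have hu : IsUnit p := by
    rw [← IsLocalRing.residue_ne_zero_iff_isUnit, h1]
    exact one_ne_zero
  obtain ⟨p', hp'⟩ := hu.exists_right_inv
  exact ⟨V, p, p', rfl, hp', h1,
    charZero_of_injective_ringHom (((IsLocalRing.residue V).comp f).comp C).injective⟩

end Specialization

section Independence

theorem eq_zero_of_sum_mul_prod_pow_eq_zero {K σ : Type} [Field K] [Infinite K] [Fintype σ]
    (T : Finset (σ → ℕ)) (c : (σ → ℕ) → K)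
    (h : ∀ ξ : σ → K, ∑ m ∈ T, c m * ∏ x, ξ x ^ m x = 0) {m : σ → ℕ} (hm : m ∈ T) : c m = 0 := by
  classical
  have hf : (∑ m ∈ T, MvPolynomial.monomial (Finsupp.equivFunOnFinite.symm m) (c m)) = 0 := by
    refine MvPolynomial.funext fun ξ => ?_
    rw [map_sum, map_zero, ← h ξ]
    refine Finset.sum_congr rfl fun m _ => ?_
    rw [MvPolynomial.eval_monomial, Finsupp.prod_fintype _ _ fun _ => pow_zero _]
    rfl
  have := congrArg (MvPolynomial.coeff (Finsupp.equivFunOnFinite.symm m)) hf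
  simpa [MvPolynomial.coeff_sum, MvPolynomial.coeff_monomial, hm] using this

/-- The word `x₁ … x₁ x₂ … x₂ …` with multiplicities `m` along the list `L`. -/
def orderedWord {P : Type} (L : List P) (m : P → ℕ) : List P :=
  L.flatMap fun x => List.replicate (m x) x

theorem prod_map_orderedWord {P M : Type} [Monoid M] (L : List P) (m : P → ℕ) (f : P → M) :
    ((orderedWord L m).map f).prod = (L.map fun x => f x ^ m x).prod := by
  simp [orderedWord, List.prod_map_flatMap]

theorem length_orderedWord {P : Type} (L : List P) (m : P → ℕ) :
    (orderedWord L m).length = (L.map m).sum := by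
  simp [orderedWord, List.length_flatMap]

theorem prod_map_eq_prod_univ {P M : Type} [Fintype P] [CommMonoid M] {L : List P} (hL : L.Nodup)
    (f : P → M) (hf : ∀ x, x ∉ L → f x = 1) : (L.map f).prod = ∏ x, f x := by
  classical
  rw [← List.prod_toFinset f hL]
  exact Finset.prod_subset (Finset.subset_univ _) fun x _ hx => hf x (by simpa using hx)

/-- The rescaled generators `(s_x - g_x) / (q - 1)`. -/
def sTilde (n : ℕ) (x : Fin (2 * n) × Fin (2 * n)) : AlgSp FF qq n :=
  (qq - 1)⁻¹ • (sSpP FF qq n x.1 x.2 - algebraMap FF _ (gSp qq x.1 x.2))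

theorem qq_sub_one_ne_zero : qq - 1 ≠ 0 := by
  rw [sub_ne_zero, qq, ← RatFunc.algebraMap_X, ← map_one (algebraMap (Polynomial ℂ) FF)]
  refine (RatFunc.algebraMap_injective ℂ).ne fun h => ?_
  simpa using congrArg Polynomial.natDegree h

theorem mapMatrix_algebraMap_smul {O F ι : Type} [CommRing O] [Field F] [Algebra O F] [Fintype ι]
    [DecidableEq ι] (c : O) (M : Matrix ι ι O) : (algebraMap O F).mapMatrix (c • M) =
      algebraMap O F c • (algebraMap O F).mapMatrix M := by
  ext
  simp

theorem linearIndepOn_sTilde {n : ℕ} {L : List (Fin (2 * n) × Fin (2 * n))} (hL : L.Nodup)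
    (hg : ∀ x ∈ L, goodSp n x) :
    LinearIndepOn FF (fun m : Fin (2 * n) × Fin (2 * n) → ℕ =>
      (L.map fun x => sTilde n x ^ m x).prod) {m | ∀ x, x ∉ L → m x = 0} := by
  classical
  rw [linearIndepOn_iff']
  intro T c hT hc
  by_contra! hne
  obtain ⟨m₁, hm₁T, hm₁⟩ := hne
  obtain ⟨V, p, p', hp, hpp', hρ, _⟩ := exists_valuationSubring
  set ρ := IsLocalRing.residue V
  obtain ⟨j, hjT, hj⟩ := T.exists_max_image (fun m => V.valuation (c m)) ⟨m₁, hm₁T⟩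
  have hj0 : c j ≠ 0 := by
    intro h0
    have := hj m₁ hm₁T
    rw [h0, map_zero, le_zero_iff, map_eq_zero] at this
    exact hm₁ this
  have hmem : ∀ m ∈ T, c m / c j ∈ V := by
    intro m hm
    rw [← V.valuation_le_one_iff, map_div₀]
    exact div_le_one_of_le₀ (hj m hm) zero_le
  let a (m : Fin (2 * n) × Fin (2 * n) → ℕ) : V := if h : c m / c j ∈ V then ⟨_, h⟩ else 0
  have ha : ∀ m ∈ T, algebraMap V FF (a m) = c m / c j := by
    intro m hm
    simp only [a, dif_pos (hmem m hm)]
    rfl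
  have haj : ρ (a j) = 1 := by
    have : a j = 1 := by
      apply Subtype.val_injective
      change algebraMap V FF (a j) = algebraMap V FF 1
      rw [ha j hjT, div_self hj0, map_one]
    rw [this, map_one]
  have hrel : ∑ m ∈ T, (algebraMap V FF (a m)) • (L.map fun x => sTilde n x ^ m x).prod = 0 := by
    rw [← smul_zero (c j)⁻¹, ← hc, Finset.smul_sum]
    refine Finset.sum_congr rfl fun m hm => ?_
    rw [ha m hm, smul_smul, div_eq_inv_mul]
  obtain ⟨j', hj'T, hj'⟩ := (T.filter fun m => ρ (a m) ≠ 0).exists_max_image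
    (fun m => ∑ x, m x) ⟨j, by simp [hjT, haj]⟩
  rw [Finset.mem_filter] at hj'T
  set d := ∑ x, j' x
  have : Infinite (IsLocalRing.ResidueField V) := Infinite.of_injective _ Nat.cast_injective
  refine hj'T.2 (eq_zero_of_sum_mul_prod_pow_eq_zero (T.filter fun m => ∑ x, m x = d)
    (fun m => ρ (a m)) (fun ξ => ?_) (Finset.mem_filter.2 ⟨hj'T.1, rfl⟩))
  have hρ' : ρ p' = 1 := by
    have := congrArg ρ hpp'
    rwa [map_mul, hρ, one_mul, map_one] at this
  obtain ⟨φ, hφ, hφξ⟩ := exists_resTr_yMat_eq hρ hρ' ξ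
  have hpq : algebraMap V FF p = qq := hp
  have hq0 : qq ≠ 0 := RatFunc.X_ne_zero
  obtain ⟨ι, _, _, s, sI, ψ, hS, hψ⟩ :=
    exists_isSpSolution (F := FF) hpp' (by rwa [hpq]) hρ hφ d
  rw [hpq] at hS
  obtain ⟨f, hf, -⟩ := hS.exists_lift
  have hfs : ∀ x, f (sTilde n x) = (algebraMap V FF).mapMatrix (s x) := by
    intro x
    rw [sTilde, map_smul, map_sub, hf, AlgHom.commutes, ← hpq, ← algebraMap_gSp, inv_smul_eq_iff₀]
    · ext b c
      simp only [Matrix.of_apply, Matrix.map_apply, Matrix.sub_apply, Matrix.add_apply,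
        Matrix.smul_apply, Matrix.one_apply, Matrix.algebraMap_matrix_apply, smul_eq_mul, mul_ite,
        mul_one, mul_zero, RingHom.mapMatrix_apply, map_add, map_mul, map_sub, map_one,
        apply_ite (algebraMap V FF), map_zero, Algebra.algebraMap_self_apply]
      ring
    · rw [hpq]
      exact qq_sub_one_ne_zero
  have hrelV : ∑ m ∈ T, a m • ((orderedWord L m).map s).prod = 0 := by
    apply Matrix.map_injective (f := algebraMap V FF) Subtype.val_injective
    have := congrArg f hrel
    rw [map_zero, map_sum] at this
    change (algebraMap V FF).mapMatrix _ = (algebraMap V FF).mapMatrix 0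
    rw [map_zero, map_sum, ← this]
    refine Finset.sum_congr rfl fun m _ => ?_
    rw [mapMatrix_algebraMap_smul, map_smul, map_list_prod, map_list_prod, List.map_map,
      List.map_map, prod_map_orderedWord]
    simp only [Function.comp_apply, Function.comp_def, map_pow, hfs]
  have key := congrArg (resTr ρ ψ) hrelV
  have hval : ∀ m ∈ T, ρ (a m) * resTr ρ ψ ((orderedWord L m).map s).prod =
      if ∑ x, m x = d then d.factorial * (ρ (a m) * ∏ x, ξ x ^ m x) else 0 := by
    intro m hm
    have hlen : (orderedWord L m).length = ∑ x, m x := by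
      rw [length_orderedWord, ← List.sum_toFinset m hL]
      exact Finset.sum_subset (Finset.subset_univ _) fun x _ hx => hT hm x (by simpa using hx)
    by_cases h0 : ρ (a m) = 0
    · rw [h0, zero_mul, zero_mul, mul_zero, ite_self]
    · rw [hψ _ (by rw [hlen]; exact hj' m (Finset.mem_filter.2 ⟨hm, h0⟩)), hlen]
      split_ifs with hd
      · rw [prod_map_orderedWord, List.map_congr_left (fun x hx => by rw [hφξ x (hg x hx)]),
          prod_map_eq_prod_univ hL _ fun x hx => by rw [hT hm x hx, pow_zero]]
        ring
      · rw [mul_zero]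
  rw [resTr_sum] at key
  simp only [resTr_smul] at key
  rw [Finset.sum_congr rfl hval, ← Finset.sum_filter, ← Finset.mul_sum] at key
  have hz : resTr ρ ψ 0 = 0 := by simp [resTr]
  rw [hz] at key
  exact (mul_eq_zero.1 key).resolve_left (Nat.cast_ne_zero.2 d.factorial_ne_zero)

end Independence

section Transfer

variable {F A P : Type} [Field F] [Ring A] [Algebra F A]

theorem prod_pow_mem_span {u s : P → A} {α β : P → F}
    (h : ∀ x, u x = α x • s x + algebraMap F A (β x)) [DecidableEq P] {L : List P} (hL : L.Nodup)
    (M : P → ℕ) : (L.map fun x => u x ^ M x).prod ∈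
      Submodule.span F ((fun m : P → ℕ => (L.map fun x => s x ^ m x).prod) '' Set.Iic M) := by
  induction L with
  | nil => exact Submodule.subset_span ⟨M, Set.self_mem_Iic, rfl⟩
  | cons x L ih =>
    obtain ⟨hx, hL⟩ := List.nodup_cons.1 hL
    have hu : ∀ k, u x ^ k ∈ Submodule.span F ((fun j => s x ^ j) '' Set.Iic k) := by
      intro k
      induction k with
      | zero => exact Submodule.subset_span ⟨0, Set.self_mem_Iic, by simp⟩
      | succ k ihk =>
        have e : u x ^ (k + 1) = α x • (s x * u x ^ k) + β x • u x ^ k := by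
          rw [pow_succ']
          nth_rewrite 1 [h]
          rw [add_mul, smul_mul_assoc, ← Algebra.smul_def]
        rw [e]
        refine add_mem (Submodule.smul_mem _ _ ?_) (Submodule.smul_mem _ _
          (Submodule.span_mono (Set.image_mono (Set.Iic_subset_Iic.2 k.le_succ)) ihk))
        have := Submodule.mem_map_of_mem (f := LinearMap.mulLeft F (s x)) ihk
        rw [Submodule.map_span] at this
        refine Submodule.span_mono ?_ this
        rintro _ ⟨_, ⟨j, hj, rfl⟩, rfl⟩
        exact ⟨j + 1, Nat.succ_le_succ hj, pow_succ' _ _⟩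
    rw [List.map_cons, List.prod_cons]
    have := Submodule.mul_mem_mul (hu (M x)) (ih hL)
    rw [Submodule.span_mul_span] at this
    refine Submodule.span_mono ?_ this
    rintro _ ⟨_, ⟨j, hj, rfl⟩, _, ⟨m, hm, rfl⟩, rfl⟩
    refine ⟨Function.update m x j, ?_, ?_⟩
    · intro y
      by_cases hy : y = x
      · subst hy
        simpa using hj
      · simpa [hy] using hm y
    · simp only [List.map_cons, List.prod_cons, Function.update_self]
      congr 2
      refine List.map_congr_left fun y hy => ?_
      rw [Function.update_of_ne (by rintro rfl; exact hx hy)]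

theorem linearIndepOn_of_affine [Fintype P] {u s : P → A} {α β : P → F}
    (h : ∀ x, u x = α x • s x + algebraMap F A (β x)) {L : List P} (hL : L.Nodup)
    (hu : LinearIndepOn F (fun m : P → ℕ => (L.map fun x => u x ^ m x).prod)
      {m | ∀ x, x ∉ L → m x = 0}) :
    LinearIndepOn F (fun m : P → ℕ => (L.map fun x => s x ^ m x).prod)
      {m | ∀ x, x ∉ L → m x = 0} := by
  classical
  have hM : ∀ M : P → ℕ, (∀ x, x ∉ L → M x = 0) →
      LinearIndepOn F (fun m : P → ℕ => (L.map fun x => s x ^ m x).prod) (Finset.Iic M) := by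
    intro M hM
    have hu' := hu.mono (t := (Finset.Iic M : Set (P → ℕ))) fun m hm x hx =>
      Nat.le_zero.1 ((Finset.mem_Iic.1 hm x).trans_eq (hM x hx))
    rw [LinearIndepOn, linearIndependent_iff_card_eq_finrank_span] at hu'
    rw [LinearIndepOn, linearIndependent_iff_card_le_finrank_span, hu']
    have : FiniteDimensional F (Submodule.span F (Set.range
        fun m : (Finset.Iic M : Set (P → ℕ)) => (L.map fun x => s x ^ m.1 x).prod)) :=
      FiniteDimensional.span_of_finite F (Set.finite_range _)
    refine Submodule.finrank_mono (Submodule.span_le.2 ?_)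
    rintro _ ⟨m, rfl⟩
    refine Submodule.span_mono ?_ (prod_pow_mem_span h hL m.1)
    rintro _ ⟨m', hm', rfl⟩
    exact ⟨⟨m', Finset.mem_coe.2 (Finset.mem_Iic.2 (hm'.trans (Finset.mem_Iic.1 m.2)))⟩, rfl⟩
  rw [linearIndepOn_iff']
  intro T c hT hc
  refine linearIndepOn_iff'.1 (hM (T.sup id) fun x hx => ?_) T c
    (fun m hm => Finset.mem_coe.2 (Finset.mem_Iic.2 (Finset.le_sup (f := id) hm))) hc
  rw [Finset.sup_apply]
  exact Nat.le_zero.1 (Finset.sup_le fun m hm => (hT hm x hx).le)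

theorem linearIndepOn_sSpP {n : ℕ} {L : List (Fin (2 * n) × Fin (2 * n))} (hL : L.Nodup)
    (hg : ∀ x ∈ L, goodSp n x) :
    LinearIndepOn FF (fun m : Fin (2 * n) × Fin (2 * n) → ℕ =>
      (L.map fun x => sSpP FF qq n x.1 x.2 ^ m x).prod) {m | ∀ x, x ∉ L → m x = 0} := by
  refine linearIndepOn_of_affine (u := sTilde n) (α := fun _ => (qq - 1)⁻¹)
    (β := fun x => -((qq - 1)⁻¹ * gSp qq x.1 x.2)) (fun x => ?_) hL (linearIndepOn_sTilde hL hg)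
  rw [sTilde, smul_sub, map_neg, map_mul, ← Algebra.smul_def, sub_eq_add_neg]

end Transfer

section IntegerExponents

section ScalarEq

variable {F A : Type} [Field F] [Ring A] [Algebra F A]

/-- Equality up to a nonzero scalar. -/
def ScalarEq (F : Type) {A : Type} [Field F] [Ring A] [Algebra F A] (x y : A) : Prop :=
  ∃ c : F, c ≠ 0 ∧ x = c • y

theorem ScalarEq.refl (x : A) : ScalarEq F x x := ⟨1, one_ne_zero, (one_smul F x).symm⟩

theorem ScalarEq.symm {x y : A} : ScalarEq F x y → ScalarEq F y x := by
  rintro ⟨c, hc, rfl⟩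
  exact ⟨c⁻¹, inv_ne_zero hc, by rw [smul_smul, inv_mul_cancel₀ hc, one_smul]⟩

theorem ScalarEq.trans {x y z : A} : ScalarEq F x y → ScalarEq F y z → ScalarEq F x z := by
  rintro ⟨c, hc, rfl⟩ ⟨d, hd, rfl⟩
  exact ⟨c * d, mul_ne_zero hc hd, smul_smul _ _ _⟩

theorem ScalarEq.mul {x y x' y' : A} : ScalarEq F x y → ScalarEq F x' y' →
    ScalarEq F (x * x') (y * y') := by
  rintro ⟨c, hc, rfl⟩ ⟨d, hd, rfl⟩
  exact ⟨c * d, mul_ne_zero hc hd, smul_mul_smul_comm _ _ _ _⟩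

/-- Commutation up to a nonzero scalar. -/
def ScalarComm (F : Type) {A : Type} [Field F] [Ring A] [Algebra F A] (x y : A) : Prop :=
  ScalarEq F (x * y) (y * x)

theorem ScalarComm.symm {x y : A} (h : ScalarComm F x y) : ScalarComm F y x := ScalarEq.symm h

theorem Commute.scalarComm {x y : A} (h : Commute x y) : ScalarComm F x y := by
  rw [ScalarComm, h.eq]; exact .refl _

theorem ScalarComm.mul_right {x y z : A} (hy : ScalarComm F x y) (hz : ScalarComm F x z) :
    ScalarComm F x (y * z) := by
  have h1 := ScalarEq.mul hy (ScalarEq.refl (F := F) z)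
  have h2 := ScalarEq.mul (ScalarEq.refl (F := F) y) hz
  simp only [← mul_assoc] at h1 h2
  rw [ScalarComm, ← mul_assoc]
  exact h1.trans h2

theorem ScalarComm.pow_right {x y : A} (h : ScalarComm F x y) (k : ℕ) :
    ScalarComm F x (y ^ k) := by
  induction k with
  | zero => rw [pow_zero]; exact (Commute.one_right x).scalarComm
  | succ k ih => rw [pow_succ]; exact ih.mul_right h

theorem ScalarComm.list_prod_right {x : A} {l : List A} (h : ∀ y ∈ l, ScalarComm F x y) :
    ScalarComm F x l.prod := by
  induction l with
  | nil => exact (Commute.one_right x).scalarComm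
  | cons y l ih =>
    rw [List.prod_cons]
    exact (h y List.mem_cons_self).mul_right (ih fun z hz => h z (List.mem_cons_of_mem _ hz))

theorem scalarEq_prod_mul_prod {ι : Type} {b z b' : ι → A} (hc : ∀ j k, ScalarComm F (z j) (b k))
    (hb : ∀ k, ScalarEq F (b k * z k) (b' k)) (l : List ι) :
    ScalarEq F ((l.map b).prod * (l.map z).prod) (l.map b').prod := by
  induction l with
  | nil => simpa using ScalarEq.refl (1 : A)
  | cons k l ih =>
    simp only [List.map_cons, List.prod_cons]
    have h1 : ScalarComm F (z k) (l.map b).prod := by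
      refine .list_prod_right fun y hy => ?_
      obtain ⟨j, -, rfl⟩ := List.mem_map.1 hy
      exact hc k j
    have h2 := ((ScalarEq.refl (F := F) (b k)).mul h1.symm).mul (.refl (l.map z).prod)
    have h3 := (hb k).mul ih
    simp only [mul_assoc] at h2 h3 ⊢
    exact h2.trans h3

end ScalarEq

theorem zpow_ite_mul_pow {M : Type} [Monoid M] {z z' : M} (h : z' * z = 1) {t : ℤ} {K : ℕ}
    (ht : 0 ≤ t + K) :
    (if 0 ≤ t then z ^ t.toNat else z' ^ (-t).toNat) * z ^ K = z ^ (t + K).toNat := by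
  split_ifs with h0
  · rw [← pow_add]; congr 1; omega
  · have : K = (-t).toNat + (t + K).toNat := by omega
    nth_rewrite 1 [this]
    rw [pow_add, ← mul_assoc, pow_mul_pow_eq_one _ h, one_mul]

/-- The positions occurring in the ordered monomials, in order. -/
def posOrd (n : ℕ) : List (Fin (2 * n) × Fin (2 * n)) :=
  (List.finRange n).flatMap fun k => rowA n k ++ (fe n k, fo n k) :: (fo n k, fo n k) :: rowB n k

theorem nodup_posOrd (n : ℕ) : (posOrd n).Nodup := by
  have : posOrd n = (spOrd n).filterMap Sum.getLeft? := by
    simp [posOrd, spOrd, List.filterMap_flatMap, List.filterMap_cons, List.filterMap_map, Function.comp_def]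
  rw [this]
  refine (nodup_spOrd n).filterMap ?_
  rintro (a | a) (b | b) c ha hb <;> simp_all

theorem mem_posOrd {n : ℕ} {x : Fin (2 * n) × Fin (2 * n)} : x ∈ posOrd n ↔ goodSp n x := by
  obtain ⟨⟨a, ha⟩, ⟨b, hb⟩⟩ := x
  simp only [posOrd, List.mem_flatMap, List.mem_finRange, true_and, List.mem_append,
    List.mem_cons, mem_rowA, mem_rowB, goodSp, Prod.mk.injEq, fe, fo, Fin.mk.injEq]
  constructor
  · rintro ⟨⟨k, hk⟩, h⟩
    simp only at h
    omega
  · intro h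
    refine ⟨⟨a / 2, by omega⟩, ?_⟩
    simp only
    omega

/-- The exponents of an ordered monomial after multiplication by the `K`-th powers of all
`s_{ii'}`, `i` odd. -/
def shiftExp {n : ℕ} (K : ℕ)
    (kk : ({p : Fin (2 * n) × Fin (2 * n) // allowedSp n p} → ℕ) × (Fin n → ℤ))
    (x : Fin (2 * n) × Fin (2 * n)) : ℕ :=
  if h : allowedSp n x then kk.1 ⟨x, h⟩ else
    if x.1.val % 2 = 0 ∧ x.2.val = x.1.val + 1 then
      (kk.2 ⟨x.1.val / 2, by omega⟩ + K).toNat else 0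

theorem shiftExp_fe_fo {n : ℕ} (K : ℕ)
    (kk : ({p : Fin (2 * n) × Fin (2 * n) // allowedSp n p} → ℕ) × (Fin n → ℤ)) (k : Fin n) :
    shiftExp K kk (fe n k, fo n k) = (kk.2 k + K).toNat := by
  have ve : (fe n k).val = 2 * k.val := rfl
  have vo : (fo n k).val = 2 * k.val + 1 := rfl
  have hk : (⟨(fe n k).val / 2, by omega⟩ : Fin n) = k := Fin.ext (by simp only [ve]; omega)
  have ha : ¬allowedSp n (fe n k, fo n k) := by
    simp only [allowedSp, ve, vo]
    omega
  rw [shiftExp, dif_neg ha, if_pos ⟨by simp only [ve]; omega, by simp only [ve, vo]⟩, hk]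

theorem shiftExp_eq_zero {n K : ℕ}
    (kk : ({p : Fin (2 * n) × Fin (2 * n) // allowedSp n p} → ℕ) × (Fin n → ℤ))
    (x : Fin (2 * n) × Fin (2 * n)) (hx : x ∉ posOrd n) : shiftExp K kk x = 0 := by
  rw [mem_posOrd] at hx
  unfold goodSp at hx
  rw [shiftExp, dif_neg (by unfold allowedSp; omega), if_neg (by omega)]

theorem shiftExp_injOn {n K : ℕ} : Set.InjOn (shiftExp (n := n) K) {kk | ∀ k, 0 ≤ kk.2 k + K} := by
  intro kk h kk' h' e
  refine Prod.ext (funext fun p => ?_) (funext fun k => ?_)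
  · have := congrFun e p.1
    rwa [shiftExp, shiftExp, dif_pos p.2, dif_pos p.2] at this
  · have := congrFun e (fe n k, fo n k)
    rw [shiftExp_fe_fo, shiftExp_fe_fo] at this
    have := h k
    have := h' k
    omega

theorem scalarEq_famSp_mul {n K : ℕ}
    (kk : ({p : Fin (2 * n) × Fin (2 * n) // allowedSp n p} → ℕ) × (Fin n → ℤ))
    (hK : ∀ k, 0 ≤ kk.2 k + K) :
    ScalarEq FF (famSp n kk *
        ((List.finRange n).map fun k => sSpP FF qq n (fe n k) (fo n k) ^ K).prod)
      ((posOrd n).map fun x => sSpP FF qq n x.1 x.2 ^ shiftExp K kk x).prod := by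
  have hq : qq ≠ 0 := RatFunc.X_ne_zero
  have hsol := isSpSolution_algSp FF qq n
  have hz : ∀ k a b, ScalarComm FF (sSpP FF qq n (fe n k) (fo n k)) (sSpP FF qq n a b) :=
    fun k a b => hsol.z_comm hq k a b
  have hzpow : ∀ k a b (i j : ℕ),
      ScalarComm FF (sSpP FF qq n (fe n k) (fo n k) ^ i) (sSpP FF qq n a b ^ j) :=
    fun k a b i j => (((hz k a b).pow_right j).symm.pow_right i).symm
  have hzI : ∀ k j (i i' : ℕ),
      ScalarComm FF (sSpP FF qq n (fe n k) (fo n k) ^ i) (sInvP FF qq n j ^ i') := by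
    intro k j i i'
    obtain ⟨c, hc, e⟩ := hz j (fe n k) (fo n k)
    have : ScalarComm FF (sSpP FF qq n (fe n k) (fo n k)) (sInvP FF qq n j) :=
      ⟨c, hc, smul_mul_swap_of_inverse (hsol.invR j) (hsol.invL j) e⟩
    exact ((this.pow_right i').symm.pow_right i).symm
  have hrow : ∀ k (f : Fin (2 * n) × Fin (2 * n) → ℕ) (l : List (Fin (2 * n) × Fin (2 * n))),
      ScalarComm FF (sSpP FF qq n (fe n k) (fo n k) ^ K)
        (l.map fun p => sSpP FF qq n p.1 p.2 ^ f p).prod := by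
    intro k f l
    refine .list_prod_right fun y hy => ?_
    obtain ⟨p, -, rfl⟩ := List.mem_map.1 hy
    exact hzpow _ _ _ _ _
  rw [posOrd, List.prod_map_flatMap]
  refine scalarEq_prod_mul_prod (fun j k => ?_) (fun k => ?_) _
  · refine (((hrow j _ _).mul_right ?_).mul_right (hzpow _ _ _ _ _)).mul_right (hrow j _ _)
    split_ifs
    · exact hzpow _ _ _ _ _
    · exact hzI _ _ _ _
  · simp only [List.map_append, List.map_cons, List.prod_append, List.prod_cons, shiftExp_fe_fo]
    have hexp : ∀ p, allowedSp n p → shiftExp K kk p =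
        if h : allowedSp n p then kk.1 ⟨p, h⟩ else 0 := by
      intro p hp
      rw [shiftExp, dif_pos hp, dif_pos hp]
    have hA : ((rowA n k).map fun x => sSpP FF qq n x.1 x.2 ^ shiftExp K kk x) =
        (rowA n k).map fun p => sSpP FF qq n p.1 p.2 ^
          if h : allowedSp n p then kk.1 ⟨p, h⟩ else 0 := by
      refine List.map_congr_left fun p hp => ?_
      rw [mem_rowA] at hp
      rw [hexp p (by unfold allowedSp; omega)]
    have hB : ((rowB n k).map fun x => sSpP FF qq n x.1 x.2 ^ shiftExp K kk x) =
        (rowB n k).map fun p => sSpP FF qq n p.1 p.2 ^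
          if h : allowedSp n p then kk.1 ⟨p, h⟩ else 0 := by
      refine List.map_congr_left fun p hp => ?_
      rw [mem_rowB] at hp
      rw [hexp p (by unfold allowedSp; omega)]
    rw [hA, hB, hexp (fo n k, fo n k) (Or.inr (by simp [fo])),
      ← zpow_ite_mul_pow (z := sSpP FF qq n (fe n k) (fo n k)) (hsol.invL k) (hK k)]
    have hcomm := ((hzpow k (fo n k) (fo n k) K
      (if h : allowedSp n (fo n k, fo n k) then kk.1 ⟨(fo n k, fo n k), h⟩ else 0)).mul_right
        (hrow k (fun p => if h : allowedSp n p then kk.1 ⟨p, h⟩ else 0) (rowB n k))).symm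
    have := (ScalarEq.refl (F := FF) (((rowA n k).map fun p => sSpP FF qq n p.1 p.2 ^
      if h : allowedSp n p then kk.1 ⟨p, h⟩ else 0).prod * (if 0 ≤ kk.2 k then
        sSpP FF qq n (fe n k) (fo n k) ^ (kk.2 k).toNat else
        sInvP FF qq n k ^ (-(kk.2 k)).toNat))).mul hcomm
    simpa only [mul_assoc] using this

theorem linearIndependent_famSp (n : ℕ) : LinearIndependent FF (famSp n) := by
  rw [linearIndependent_iff']
  intro T c hc
  obtain ⟨K, hK⟩ : ∃ K : ℕ, ∀ kk ∈ T, ∀ k, 0 ≤ kk.2 k + K := by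
    refine ⟨T.sup fun kk => Finset.univ.sup fun k => (-(kk.2 k)).toNat, fun kk hkk k => ?_⟩
    have h1 := Finset.le_sup (f := fun kk : ({p : Fin (2 * n) × Fin (2 * n) // allowedSp n p} → ℕ) ×
      (Fin n → ℤ) => Finset.univ.sup fun k => (-(kk.2 k)).toNat) hkk
    have h2 := Finset.le_sup (f := fun k => (-(kk.2 k)).toNat) (Finset.mem_univ k)
    have := h2.trans h1
    omega
  have hL := linearIndepOn_sSpP (nodup_posOrd n) fun x hx => mem_posOrd.1 hx
  have hT : ∀ kk, ∃ d : FF, d ≠ 0 ∧ (kk ∈ T → famSp n kk *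
      ((List.finRange n).map fun k => sSpP FF qq n (fe n k) (fo n k) ^ K).prod =
      d • ((posOrd n).map fun x => sSpP FF qq n x.1 x.2 ^ shiftExp K kk x).prod) := by
    intro kk
    by_cases hkk : kk ∈ T
    · obtain ⟨d, hd, e⟩ := scalarEq_famSp_mul kk (hK kk hkk)
      exact ⟨d, hd, fun _ => e⟩
    · exact ⟨1, one_ne_zero, fun h => absurd h hkk⟩
  choose d hd e using hT
  have hinj : Set.InjOn (shiftExp K) (T : Set (({p : Fin (2 * n) × Fin (2 * n) // allowedSp n p} →
      ℕ) × (Fin n → ℤ))) := shiftExp_injOn.mono hK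
  have hli := (hL.mono (t := shiftExp K '' (T : Set _)) (by
    rintro _ ⟨kk, -, rfl⟩ x hx
    exact shiftExp_eq_zero kk x hx)).comp_of_image hinj
  have hsum : ∑ kk ∈ T, (c kk * d kk) •
      ((posOrd n).map fun x => sSpP FF qq n x.1 x.2 ^ shiftExp K kk x).prod = 0 := by
    have := congrArg (· * ((List.finRange n).map fun k =>
      sSpP FF qq n (fe n k) (fo n k) ^ K).prod) hc
    rw [zero_mul, Finset.sum_mul] at this
    rw [← this]
    refine Finset.sum_congr rfl fun kk hkk => ?_
    rw [smul_mul_assoc, e kk hkk, smul_smul]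
  intro kk hkk
  have := linearIndepOn_iff'.1 hli T _ subset_rfl hsum kk hkk
  exact (mul_eq_zero.1 this).resolve_right (hd kk)

end IntegerExponents

/-- The ordered monomials of the symplectic algebra `𝒮` form a basis. -/
theorem stmt7 (n : ℕ) :
    LinearIndependent FF (famSp n) ∧ Submodule.span FF (Set.range (famSp n)) = ⊤ :=
  ⟨linearIndependent_famSp n, span_famSp n⟩
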